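/- Let φ = (φ₁,…,φ_k): [a,b] → ℝ^k be analytic with image not contained in a proper affine subspace. Then Dirichlet's theorem cannot be improved for φ(s) for Lebesgue-almost every s ∈ [a,b]: for every 0 < μ < 1 and almost every s, there are infinitely many positive integers N for which there is no (q₁,…,q_k,p) ∈ ℤ^k×ℤ with 0 < max_i|q_i| ≤ μN and |q₁φ₁(s)+⋯+q_kφ_k(s) − p| ≤ μN^{−k}. -/

import Mathlib

open MeasureTheory

theorem exists_zero_of_iterated_rolle (m : ℕ) : ∀ (g : ℕ → ℝ → ℝ) (a b : ℝ),
    (∀ j < m, ∀ x ∈ Set.Icc a b, HasDerivAt (g j) (g (j + 1) x) x) →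
    ∀ t : ℕ → ℝ, (∀ i ≤ m, t i ∈ Set.Icc a b) → (∀ i < m, t i < t (i + 1)) →
    (∀ i ≤ m, g 0 (t i) = 0) → ∃ x ∈ Set.Icc a b, g m x = 0 := by
  induction m with
  | zero => intro g a b _ t ht _ h0; exact ⟨t 0, ht 0 le_rfl, h0 0 le_rfl⟩
  | succ m ih =>
    intro g a b hg t ht hlt h0
    have key : ∀ i, ∃ y, i ≤ m → y ∈ Set.Ioo (t i) (t (i + 1)) ∧ g 1 y = 0 := by
      intro i
      by_cases hi : i ≤ m
      · have hsub : Set.Icc (t i) (t (i + 1)) ⊆ Set.Icc a b :=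
          Set.Icc_subset_Icc (ht i (by omega)).1 (ht (i + 1) (by omega)).2
        obtain ⟨y, hy, hy0⟩ := exists_hasDerivAt_eq_zero (f := g 0) (f' := g 1)
          (hlt i (by omega))
          (fun x hx => (hg 0 (by omega) x (hsub hx)).continuousAt.continuousWithinAt)
          (by rw [h0 i (by omega), h0 (i + 1) (by omega)])
          (fun x hx => hg 0 (by omega) x (hsub (Set.Ioo_subset_Icc_self hx)))
        exact ⟨y, fun _ => ⟨hy, hy0⟩⟩
      · exact ⟨0, fun h => absurd h hi⟩
    choose u hu using key
    refine ih (fun j => g (j + 1)) a b (fun j hj x hx => hg (j + 1) (by omega) x hx) u ?_ ?_ ?_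
    · intro i hi
      exact ⟨(ht i (by omega)).1.trans (hu i hi).1.1.le,
        (hu i hi).1.2.le.trans (ht (i + 1) (by omega)).2⟩
    · intro i hi
      exact (hu i hi.le).1.2.trans (hu (i + 1) hi).1.1
    · intro i hi; exact (hu i hi).2

theorem exists_eq_divided_difference (m : ℕ) (f : ℕ → ℝ → ℝ) (a b : ℝ)
    (hf : ∀ j < m, ∀ x ∈ Set.Icc a b, HasDerivAt (f j) (f (j + 1) x) x)
    (s : Finset ℝ) (hs : s.card = m + 1) (hsub : ↑s ⊆ Set.Icc a b) :
    ∃ ξ ∈ Set.Icc a b, f m ξ = m.factorial * ∑ x ∈ s, f 0 x / ∏ y ∈ s.erase x, (x - y) := by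
  set P := Lagrange.interpolate s id (f 0) with hP
  have hinj : Set.InjOn (id : ℝ → ℝ) s := Set.injOn_id _
  have hdeg : P.degree < s.card := Lagrange.degree_interpolate_lt _ hinj
  have hval : ∀ x ∈ s, P.eval x = f 0 x := fun x hx =>
    Lagrange.eval_interpolate_at_node (f 0) hinj hx
  have hder : ∀ j x, HasDerivAt (fun x => (Polynomial.derivative^[j] P).eval x)
      ((Polynomial.derivative^[j + 1] P).eval x) x := by
    intro j x
    rw [Function.iterate_succ_apply']
    exact Polynomial.hasDerivAt _ x
  let e := s.orderEmbOfFin hs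
  have hmem : ∀ i, e i ∈ s := fun i => s.orderEmbOfFin_mem hs i
  obtain ⟨ξ, hξ, h⟩ := exists_zero_of_iterated_rolle m
    (fun j x => f j x - (Polynomial.derivative^[j] P).eval x) a b
    (fun j hj x hx => (hf j hj x hx).sub (hder j x))
    (fun i => if h : i < m + 1 then e ⟨i, h⟩ else 0)
    (by
      intro i hi
      rw [dif_pos (by omega)]
      exact hsub (hmem _))
    (by
      intro i hi
      rw [dif_pos (by omega), dif_pos (by omega)]
      exact e.strictMono (by simp [Fin.lt_def]))
    (by
      intro i hi
      simp only [Function.iterate_zero, id]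
      rw [dif_pos (by omega), hval _ (hmem _), sub_self])
  refine ⟨ξ, hξ, ?_⟩
  have h2 := sub_eq_zero.1 h
  rw [h2]
  have hm : P.natDegree ≤ m := by
    have : P.degree < ((m + 1 : ℕ) : WithBot ℕ) := by rw [← hs]; exact hdeg
    rw [Polynomial.natDegree_le_iff_degree_le]
    exact Order.le_of_lt_succ (by exact_mod_cast this)
  have h3 : Polynomial.derivative^[m] P = Polynomial.C (m.factorial * P.coeff m) := by
    apply Polynomial.ext
    intro n
    rw [Polynomial.coeff_iterate_derivative, Polynomial.coeff_C]
    split_ifs with hn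
    · subst hn
      simp [Nat.descFactorial_self]
    · rw [Polynomial.coeff_eq_zero_of_natDegree_lt (by omega)]; simp
  rw [h3, Polynomial.eval_C]
  congr 1
  have := Lagrange.coeff_eq_sum (s := s) (v := id) hinj hdeg
  rw [hs] at this
  simp only [Nat.add_sub_cancel, id] at this
  rw [this]
  exact Finset.sum_congr rfl fun x hx => by rw [hval x hx]

theorem exists_separated_finset (E : Set ℝ) (z d : ℝ) (j : ℕ)
    (hE : ENNReal.ofReal (2 * d * j) < volume E) (hd : 0 < d) :
    ∃ s : Finset ℝ, s.card = j ∧ ↑s ⊆ E ∧ z ∉ s ∧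
      ∀ x ∈ insert z s, ∀ y ∈ insert z s, x ≠ y → d ≤ |x - y| := by
  induction j with
  | zero => exact ⟨∅, by simp, by simp, by simp, by simp⟩
  | succ j ih =>
    obtain ⟨s, hsc, hsE, hz, hs⟩ := ih (lt_of_le_of_lt
      (ENNReal.ofReal_le_ofReal (by push_cast; nlinarith)) hE)
    have hcov : ¬ E ⊆ ⋃ x ∈ insert z s, Metric.ball x d := by
      intro hc
      have h1 := (measure_mono hc).trans (measure_biUnion_finset_le (μ := volume) _ _)
      simp only [Real.volume_ball, Finset.sum_const, nsmul_eq_mul,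
        Finset.card_insert_of_notMem hz, hsc] at h1
      rw [mul_comm 2 d, ← ENNReal.ofReal_natCast, ← ENNReal.ofReal_mul (by positivity)] at h1
      refine absurd h1 (not_le.2 (lt_of_le_of_lt (ENNReal.ofReal_le_ofReal ?_) hE))
      linarith
    obtain ⟨w, hwE, hw⟩ := Set.not_subset.1 hcov
    simp only [Set.mem_iUnion, not_exists, Metric.mem_ball, not_lt, Real.dist_eq] at hw
    have hwn : w ∉ insert z s := fun h => by
      have := hw w h; simp only [sub_self, abs_zero] at this; linarith
    have hw' : w ≠ z ∧ w ∉ s := by simpa using hwn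
    refine ⟨insert w s, by rw [Finset.card_insert_of_notMem hw'.2, hsc], ?_, ?_, ?_⟩
    · intro x hx; rcases Finset.mem_insert.1 (Finset.mem_coe.1 hx) with rfl | h
      exacts [hwE, hsE h]
    · simp only [Finset.mem_insert, not_or]; exact ⟨Ne.symm hw'.1, hz⟩
    · intro x hx y hy hxy
      rw [Finset.insert_comm, Finset.mem_insert] at hx hy
      rcases hx with rfl | hx <;> rcases hy with rfl | hy
      · exact absurd rfl hxy
      · exact hw y hy
      · rw [abs_sub_comm]; exact hw x hx
      · exact hs x hx y hy hxy

theorem abs_le_of_bounded_derivative (m : ℕ) (f : ℕ → ℝ → ℝ) (a b : ℝ) {κ A ε d : ℝ}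
    (hf : ∀ j < m, ∀ x ∈ Set.Icc a b, HasDerivAt (f j) (f (j + 1) x) x)
    (hκ : 0 < κ) (hκf : ∀ x ∈ Set.Icc a b, κ ≤ |f m x|) (hA : ∀ x ∈ Set.Icc a b, |f m x| ≤ A)
    (hd : 0 < d) (hε : 0 ≤ ε)
    (hE : ENNReal.ofReal (2 * d * (m + 1 : ℕ)) < volume {x ∈ Set.Icc a b | |f 0 x| < ε})
    {z : ℝ} (hz : z ∈ Set.Icc a b) :
    |f 0 z| ≤ ((b - a) / d) ^ m * (A * (m + 1) / κ + m) * ε := by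
  obtain ⟨s, hsc, hsE, hzs, hs⟩ := exists_separated_finset _ z d (m + 1) hE hd
  have hsI : ↑s ⊆ Set.Icc a b := fun x hx => (hsE hx).1
  have hab : a ≤ b := hz.1.trans hz.2
  have hA0 : 0 ≤ A := (abs_nonneg _).trans (hA z hz)
  have hprod : ∀ u : Finset ℝ, u ⊆ insert z s → u.card = m + 1 → ∀ x ∈ u,
      d ^ m ≤ |∏ y ∈ u.erase x, (x - y)| := by
    intro u hu hc x hx
    rw [Finset.abs_prod]
    have : (u.erase x).card = m := by rw [Finset.card_erase_of_mem hx, hc]; rfl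
    rw [← this, ← Finset.prod_const]
    refine Finset.prod_le_prod (fun _ _ => hd.le) fun y hy => ?_
    rw [Finset.mem_erase] at hy
    exact hs x (hu hx) y (hu hy.2) hy.1.symm
  have hfac : (0 : ℝ) < m.factorial := by positivity
  -- lower bound on `ε`
  have h1 : κ * d ^ m ≤ m.factorial * ((m + 1) * ε) := by
    obtain ⟨ξ, hξ, h⟩ := exists_eq_divided_difference m f a b hf s hsc hsI
    have h2 : |∑ x ∈ s, f 0 x / ∏ y ∈ s.erase x, (x - y)| ≤ (m + 1) * (ε / d ^ m) := by
      refine (Finset.abs_sum_le_sum_abs _ _).trans ?_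
      have : ((m : ℝ) + 1) = s.card := by rw [hsc]; push_cast; rfl
      rw [this, ← nsmul_eq_mul]
      refine Finset.sum_le_card_nsmul _ _ _ fun x hx => ?_
      rw [abs_div]
      exact div_le_div₀ hε (hsE hx).2.le (by positivity)
        (hprod s (Finset.subset_insert _ _) hsc x hx)
    have h3 := hκf ξ hξ
    rw [h, abs_mul, abs_of_pos hfac] at h3
    have h4 : κ ≤ m.factorial * ((m + 1) * (ε / d ^ m)) := h3.trans (by gcongr)
    calc κ * d ^ m ≤ m.factorial * ((m + 1) * (ε / d ^ m)) * d ^ m := by gcongr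
      _ = _ := by field_simp
  obtain ⟨s0, hs0, hs0c⟩ := Finset.exists_subset_card_eq (s := s) (n := m) (by omega)
  have hzs0 : z ∉ s0 := fun h => hzs (hs0 h)
  obtain ⟨ξ, hξ, h⟩ := exists_eq_divided_difference m f a b hf (insert z s0)
    (by rw [Finset.card_insert_of_notMem hzs0, hs0c])
    (by rw [Finset.coe_insert]; exact Set.insert_subset hz ((Finset.coe_subset.2 hs0).trans hsI))
  rw [Finset.sum_insert hzs0, Finset.erase_insert hzs0] at h
  set Q := ∏ y ∈ s0, (z - y) with hQ
  set T := ∑ x ∈ s0, f 0 x / ∏ y ∈ (insert z s0).erase x, (x - y) with hT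
  have hQ0 : Q ≠ 0 := Finset.prod_ne_zero_iff.2 fun y hy => sub_ne_zero.2 fun hzy =>
    hzs0 (hzy ▸ hy)
  have hQL : |Q| ≤ (b - a) ^ m := by
    rw [hQ, Finset.abs_prod, ← hs0c, ← Finset.prod_const]
    refine Finset.prod_le_prod (fun _ _ => abs_nonneg _) fun y hy => ?_
    have hy' := hsI (hs0 hy)
    rw [abs_le]; constructor <;> linarith [hz.1, hz.2, hy'.1, hy'.2]
  have hTb : |T| ≤ m * (ε / d ^ m) := by
    refine (Finset.abs_sum_le_sum_abs _ _).trans ?_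
    have : (m : ℝ) = s0.card := by rw [hs0c]
    rw [this, ← nsmul_eq_mul]
    refine Finset.sum_le_card_nsmul _ _ _ fun x hx => ?_
    rw [abs_div]
    have := hprod (insert z s0) (Finset.insert_subset_insert _ hs0)
        (by rw [Finset.card_insert_of_notMem hzs0, hs0c]) x (Finset.mem_insert_of_mem hx)
    exact div_le_div₀ hε (hsE (hs0 hx)).2.le (by positivity) this
  have hfz : f 0 z = Q * (f m ξ / m.factorial - T) := by
    rw [h]; field_simp; ring
  have hba : 0 ≤ b - a := by linarith
  have h5 : |f m ξ / m.factorial - T| ≤ A / m.factorial + m * (ε / d ^ m) := by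
    refine (abs_sub _ _).trans (add_le_add ?_ hTb)
    rw [abs_div, abs_of_pos hfac]
    gcongr
    exact hA ξ hξ
  have h6 : A / m.factorial ≤ A * (m + 1) / κ * (ε / d ^ m) := by
    rw [div_mul_div_comm, div_le_div_iff₀ hfac (by positivity)]
    calc A * (κ * d ^ m) ≤ A * (m.factorial * ((m + 1) * ε)) := by gcongr
      _ = _ := by ring
  rw [hfz, abs_mul]
  calc |Q| * |f m ξ / m.factorial - T| ≤ (b - a) ^ m * (A * (m + 1) / κ * (ε / d ^ m)
        + m * (ε / d ^ m)) := by gcongr; linarith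
    _ = _ := by rw [div_pow]; field_simp

theorem AnalyticAt.analyticAt_iteratedDeriv {f : ℝ → ℝ} {x : ℝ} (hf : AnalyticAt ℝ f x) (n : ℕ) :
    AnalyticAt ℝ (iteratedDeriv n f) x := by
  rw [iteratedDeriv_eq_iterate]; exact hf.iterated_deriv n

theorem exists_radius_uniform_derivative_bound {ι : Type*} [Fintype ι] (G : ι → ℝ → ℝ) (x0 : ℝ)
    (K : Submodule ℝ (ι → ℝ)) {R0 : ℝ} (hR0 : 0 < R0)
    (hG : ∀ i, AnalyticOnNhd ℝ (G i) (Metric.closedBall x0 R0))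
    (hK : ∀ c ∈ K, (∀ x ∈ Metric.closedBall x0 R0, ∑ i, c i * G i x = 0) → c = 0) :
    ∃ R > 0, R ≤ R0 ∧ ∃ κ > 0, ∃ m : ℕ, ∀ c ∈ K, ‖c‖ = 1 → ∃ j ≤ m,
      ∀ x ∈ Metric.closedBall x0 R, κ ≤ |∑ i, c i * iteratedDeriv j (G i) x| := by
  have hcpt : IsCompact ((K : Set (ι → ℝ)) ∩ Metric.sphere 0 1) :=
    (isCompact_sphere _ _).inter_left K.closed_of_finiteDimensional
  have main : ∃ R > 0, R ≤ R0 ∧ ∃ κ > 0, ∃ m : ℕ, ∀ c ∈ (K : Set (ι → ℝ)) ∩ Metric.sphere 0 1,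
      ∃ j ≤ m, ∀ x ∈ Metric.closedBall x0 R, κ ≤ |∑ i, c i * iteratedDeriv j (G i) x| := by
    refine hcpt.induction_on (p := fun S => ∃ R > 0, R ≤ R0 ∧ ∃ κ > 0, ∃ m : ℕ, ∀ c ∈ S,
      ∃ j ≤ m, ∀ x ∈ Metric.closedBall x0 R, κ ≤ |∑ i, c i * iteratedDeriv j (G i) x|)
      ⟨R0, hR0, le_rfl, 1, one_pos, 0, by simp⟩ ?_ ?_ ?_
    · rintro s t hst ⟨R, hR, hRR, κ, hκ, m, h⟩
      exact ⟨R, hR, hRR, κ, hκ, m, fun c hc => h c (hst hc)⟩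
    · rintro s t ⟨R, hR, hRR, κ, hκ, m, h⟩ ⟨R', hR', hRR', κ', hκ', m', h'⟩
      refine ⟨min R R', lt_min hR hR', (min_le_left _ _).trans hRR, min κ κ', lt_min hκ hκ',
        max m m', ?_⟩
      rintro c (hc | hc)
      · obtain ⟨j, hj, hx⟩ := h c hc
        exact ⟨j, hj.trans (le_max_left _ _), fun x hxx => (min_le_left _ _).trans
          (hx x (Metric.closedBall_subset_closedBall (min_le_left _ _) hxx))⟩
      · obtain ⟨j, hj, hx⟩ := h' c hc
        exact ⟨j, hj.trans (le_max_right _ _), fun x hxx => (min_le_right _ _).trans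
          (hx x (Metric.closedBall_subset_closedBall (min_le_right _ _) hxx))⟩
    · rintro c ⟨hcK, hc1⟩
      have hx0 : x0 ∈ Metric.closedBall x0 R0 := Metric.mem_closedBall_self hR0.le
      have hex : ∃ j, ∑ i, c i * iteratedDeriv j (G i) x0 ≠ 0 := by
        by_contra! hall
        have hfa : AnalyticOnNhd ℝ (fun x => ∑ i, c i * G i x) (Metric.closedBall x0 R0) :=
          fun x hx => Finset.analyticAt_fun_sum _ fun i _ => analyticAt_const.mul (hG i x hx)
        have hps := (hfa x0 hx0).hasFPowerSeriesAt
        have hz : ∀ n, iteratedDeriv n (fun x => ∑ i, c i * G i x) x0 = 0 := by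
          intro n
          rw [iteratedDeriv_fun_sum (f := fun i x => c i * G i x) fun i _ =>
            (analyticAt_const.mul (hG i x0 hx0)).contDiffAt, ← hall n]
          exact Finset.sum_congr rfl fun i _ => iteratedDeriv_const_mul_field _ _
        have hz0 : (FormalMultilinearSeries.ofScalars ℝ (fun n =>
            iteratedDeriv n (fun x => ∑ i, c i * G i x) x0 / (n.factorial : ℝ))) = 0 := by
          ext n
          simp [hz, FormalMultilinearSeries.ofScalars]
        rw [hz0] at hps
        have hev := hps.eventually_eq_zero
        have := hfa.eqOn_zero_of_preconnected_of_eventuallyEq_zero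
          (convex_closedBall x0 R0).isPreconnected hx0 hev
        have hc0 := hK c hcK fun x hx => this hx
        rw [hc0] at hc1
        simp at hc1
      obtain ⟨j, hj⟩ := hex
      have hcont : ContinuousAt (fun p : (ι → ℝ) × ℝ =>
          |∑ i, p.1 i * iteratedDeriv j (G i) p.2|) (c, x0) := by
        refine ContinuousAt.abs (tendsto_finsetSum _ fun i _ => ?_)
        refine ContinuousAt.mul (by fun_prop) ?_
        exact ContinuousAt.comp (x := (c, x0)) (f := Prod.snd)
          ((hG i x0 hx0).analyticAt_iteratedDeriv j).continuousAt continuousAt_snd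
      have hpos : 0 < |∑ i, c i * iteratedDeriv j (G i) x0| := abs_pos.2 hj
      have hev := hcont.eventually (lt_mem_nhds (half_lt_self hpos))
      rw [nhds_prod_eq, Filter.eventually_prod_iff] at hev
      obtain ⟨pa, hpa, pb, hpb, hab⟩ := hev
      obtain ⟨δ, hδ, hball⟩ := Metric.eventually_nhds_iff_ball.1 hpb
      refine ⟨{c | pa c}, mem_nhdsWithin_of_mem_nhds hpa, min (δ / 2) R0, by positivity,
        min_le_right _ _, _, half_pos hpos, j, fun c' hc' => ⟨j, le_rfl, fun x hx => ?_⟩⟩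
      refine (hab hc' (hball x ?_)).le
      rw [Metric.mem_closedBall] at hx
      rw [Metric.mem_ball]
      linarith [hx.trans (min_le_left _ _)]
  obtain ⟨R, hR, hRR, κ, hκ, m, h⟩ := main
  exact ⟨R, hR, hRR, κ, hκ, m, fun c hc h1 => h c ⟨hc, by simpa using h1⟩⟩

theorem exists_good_radius {ι : Type*} [Fintype ι] (G : ι → ℝ → ℝ) (x0 : ℝ)
    (hG : ∀ i, AnalyticAt ℝ (G i) x0) :
    ∃ R > 0, (∀ i, AnalyticOnNhd ℝ (G i) (Metric.closedBall x0 R)) ∧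
      ∀ θ > 0, ∃ η > 0, ∀ c : ι → ℝ, ∀ a b, a < b → Set.Icc a b ⊆ Metric.closedBall x0 R →
        ∀ z ∈ Set.Icc a b,
        volume {x ∈ Set.Icc a b | |∑ i, c i * G i x| < η * |∑ i, c i * G i z|}
          ≤ ENNReal.ofReal (θ * (b - a)) := by
  have hev : ∀ᶠ y in nhds x0, ∀ i, AnalyticAt ℝ (G i) y :=
    Filter.eventually_all.2 fun i => (hG i).eventually_analyticAt
  obtain ⟨R1, hR1, hb1⟩ := Metric.eventually_nhds_iff_ball.1 hev
  set R0 := R1 / 2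
  have hR0 : 0 < R0 := half_pos hR1
  have hG0 : ∀ i, AnalyticOnNhd ℝ (G i) (Metric.closedBall x0 R0) := fun i x hx =>
    hb1 x (Metric.closedBall_subset_ball (half_lt_self hR1) hx) i
  let K : Submodule ℝ (ι → ℝ) :=
    { carrier := {c | ∀ x ∈ Metric.closedBall x0 R0, ∑ i, c i * G i x = 0}
      add_mem' := fun {c d} hc hd x hx => by
        simp only [Pi.add_apply, add_mul, Finset.sum_add_distrib, hc x hx, hd x hx, add_zero]
      zero_mem' := fun x _ => by simp
      smul_mem' := fun r c hc x hx => by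
        simp only [Pi.smul_apply, smul_eq_mul, mul_assoc, ← Finset.mul_sum, hc x hx, mul_zero] }
  obtain ⟨K', hK'⟩ := K.exists_isCompl
  obtain ⟨R, hR, hRR, κ, hκ, m, hlow⟩ := exists_radius_uniform_derivative_bound G x0 K' hR0 hG0
    (fun c hc h => (Submodule.disjoint_def.1 hK'.disjoint) c h hc)
  have hsubR : Metric.closedBall x0 R ⊆ Metric.closedBall x0 R0 :=
    Metric.closedBall_subset_closedBall hRR
  have hbd : ∃ A : ℝ, 0 < A ∧ ∀ j ≤ m, ∀ i, ∀ x ∈ Metric.closedBall x0 R,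
      |iteratedDeriv j (G i) x| ≤ A := by
    have : ∀ j i, ∃ A : ℝ, ∀ x ∈ Metric.closedBall x0 R, |iteratedDeriv j (G i) x| ≤ A := by
      intro j i
      have hc : ContinuousOn (iteratedDeriv j (G i)) (Metric.closedBall x0 R) := fun x hx =>
        ((hG0 i x (hsubR hx)).analyticAt_iteratedDeriv j).continuousAt.continuousWithinAt
      obtain ⟨A, hA⟩ := (isCompact_closedBall x0 R).exists_bound_of_continuousOn hc
      exact ⟨A, hA⟩
    choose A hA using this
    refine ⟨1 + ∑ j ∈ Finset.range (m + 1), ∑ i, |A j i|, by positivity, fun j hj i x hx => ?_⟩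
    have h1 := Finset.single_le_sum (f := fun i => |A j i|) (fun i _ => abs_nonneg _)
      (Finset.mem_univ i)
    have h2 := Finset.single_le_sum (f := fun j => ∑ i, |A j i|)
      (fun j _ => Finset.sum_nonneg fun i _ => abs_nonneg _)
      (Finset.mem_range.2 (Nat.lt_succ_of_le hj))
    have := hA j i x hx
    have := le_abs_self (A j i)
    linarith
  obtain ⟨A, hA0, hA⟩ := hbd
  refine ⟨R, hR, fun i x hx => hG0 i x (hsubR hx), fun θ hθ => ?_⟩
  set B := Fintype.card ι * A with hB
  have hB0 : 0 ≤ B := by positivity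
  set C := (1 + 2 * (m + 1) / θ) ^ m * (B * (m + 1) / κ + m) with hC
  have hC0 : 0 ≤ C := by positivity
  refine ⟨1 / (C + 1), by positivity, fun c a b hab hI z hz => ?_⟩
  obtain ⟨c0, hc0, c1, hc1, rfl⟩ := Submodule.mem_sup.1
    (show c ∈ K ⊔ K' by rw [hK'.sup_eq_top]; trivial)
  have hf : ∀ x ∈ Set.Icc a b, ∑ i, (c0 + c1) i * G i x = ∑ i, c1 i * G i x := by
    intro x hx
    simp only [Pi.add_apply, add_mul, Finset.sum_add_distrib, hc0 x (hsubR (hI hx)), zero_add]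
  rw [hf z hz]
  by_contra! hlt
  have hne : c1 ≠ 0 := by
    rintro rfl
    have : {x ∈ Set.Icc a b | |∑ i, (c0 + 0) i * G i x| <
        1 / (C + 1) * |∑ i, (0 : ι → ℝ) i * G i z|} = ∅ := by
      ext x; simp
    rw [this] at hlt
    simp at hlt
  have hn : 0 < ‖c1‖ := norm_pos_iff.2 hne
  obtain ⟨j, hj, hjl⟩ := hlow (‖c1‖⁻¹ • c1) (K'.smul_mem _ hc1)
    (by rw [norm_smul, norm_inv, norm_norm, inv_mul_cancel₀ hn.ne'])
  have hupp : ∀ x ∈ Set.Icc a b, |∑ i, (‖c1‖⁻¹ • c1) i * iteratedDeriv j (G i) x| ≤ B := by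
    intro x hx
    refine (Finset.abs_sum_le_sum_abs _ _).trans ?_
    rw [hB, ← nsmul_eq_mul]
    refine Finset.sum_le_card_nsmul _ _ _ fun i _ => ?_
    rw [abs_mul]
    have h1 : |(‖c1‖⁻¹ • c1) i| ≤ 1 := by
      have := norm_le_pi_norm (‖c1‖⁻¹ • c1) i
      rwa [norm_smul, norm_inv, norm_norm, inv_mul_cancel₀ hn.ne', Real.norm_eq_abs] at this
    calc _ ≤ 1 * A := mul_le_mul h1 (hA j hj i x (hI hx)) (abs_nonneg _) zero_le_one
      _ = A := one_mul A
  have hfs : ∀ x, |∑ i, c1 i * G i x| = ‖c1‖ * |∑ i, (‖c1‖⁻¹ • c1) i * G i x| := by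
    intro x
    rw [← abs_of_pos hn, ← abs_mul, Finset.mul_sum, abs_of_pos hn]
    congr 1
    refine Finset.sum_congr rfl fun i _ => ?_
    simp only [Pi.smul_apply, smul_eq_mul]
    field_simp
  set g : ℕ → ℝ → ℝ := fun j x => ∑ i, (‖c1‖⁻¹ • c1) i * iteratedDeriv j (G i) x with hg
  set ε := 1 / (C + 1) * |g 0 z| with hε
  have hset : {x ∈ Set.Icc a b | |∑ i, (c0 + c1) i * G i x| < 1 / (C + 1) * |∑ i, c1 i * G i z|} =
      {x ∈ Set.Icc a b | |g 0 x| < ε} := by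
    ext x
    simp only [Set.mem_sep_iff, and_congr_right_iff]
    intro hx
    rw [hf x hx, hfs, hfs, mul_left_comm, mul_lt_mul_iff_right₀ hn]
    simp only [hε, hg, iteratedDeriv_zero]
  rw [hset] at hlt
  have hba : 0 < b - a := sub_pos.2 hab
  have hres := abs_le_of_bounded_derivative j g a b (κ := κ) (A := B) (ε := ε)
    (d := θ * (b - a) / (2 * (j + 1)))
    (fun l hl x hx => by
      refine HasDerivAt.fun_sum fun i _ => HasDerivAt.const_mul _ ?_
      rw [iteratedDeriv_succ]
      exact ((hG0 i x (hsubR (hI hx))).analyticAt_iteratedDeriv l).differentiableAt.hasDerivAt)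
    hκ (fun x hx => hjl x (hI hx)) hupp (by positivity) (by positivity)
    (by
      have : 2 * (θ * (b - a) / (2 * (j + 1))) * ((j + 1 : ℕ) : ℝ) = θ * (b - a) := by
        push_cast; field_simp
      rw [this]; exact hlt) hz
  have hjm : (j : ℝ) ≤ m := by exact_mod_cast hj
  have hr : (b - a) / (θ * (b - a) / (2 * (j + 1))) = 2 * (j + 1) / θ := by field_simp
  have hle : ((b - a) / (θ * (b - a) / (2 * (j + 1)))) ^ j * (B * (j + 1) / κ + j) ≤ C := by
    rw [hr, hC]
    have h1 : (2 * ((j : ℝ) + 1) / θ) ^ j ≤ (1 + 2 * (m + 1) / θ) ^ m := by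
      calc (2 * ((j : ℝ) + 1) / θ) ^ j ≤ (1 + 2 * (m + 1) / θ) ^ j := by
            gcongr
            have : 2 * ((j : ℝ) + 1) / θ ≤ 2 * (m + 1) / θ := by gcongr
            linarith
        _ ≤ _ := pow_le_pow_right₀ (by
            have : 0 ≤ 2 * ((m : ℝ) + 1) / θ := by positivity
            linarith) hj
    gcongr
  have hgz : 0 < |g 0 z| := by
    rcases (abs_nonneg (g 0 z)).eq_or_lt with h | h
    · have : {x ∈ Set.Icc a b | |g 0 x| < ε} = ∅ := by
        ext x; simp [hε, ← h]
      rw [this] at hlt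
      simp at hlt
    · exact h
  have hfin : |g 0 z| ≤ C * ε := hres.trans (by gcongr)
  rw [hε] at hfin
  have : C * (1 / (C + 1) * |g 0 z|) < |g 0 z| := by
    rw [← mul_assoc, mul_one_div]
    calc _ < 1 * |g 0 z| := by
          gcongr
          rw [div_lt_one (by positivity)]; linarith
      _ = _ := one_mul _
  linarith

/-- `x` is marked by a finite flag `F ⊆ Q` on which `ψ` is between `ε` and `ρ`, while `ψ` is at
least `ρ` at every other element of `Q` comparable with all of `F`. -/
def IsMarked {P : Type*} (rel : P → P → Prop) (ψ : P → ℝ → ℝ) (ε ρ : ℝ) (Q : Set P) (x : ℝ) :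
    Prop :=
  ∃ F : Set P, F.Finite ∧ F ⊆ Q ∧ F.Pairwise rel ∧ (∀ p ∈ F, ε ≤ ψ p x ∧ ψ p x ≤ ρ) ∧
    ∀ q ∈ Q, q ∉ F → (∀ p ∈ F, rel p q) → ρ ≤ ψ q x

/-- The constant in the Kleinbock–Margulis covering argument for flags of length `k`. -/
def markedConst : ℕ → ℝ
  | 0 => 0
  | k + 1 => 60 * markedConst k + 120

theorem markedConst_nonneg (k : ℕ) : 0 ≤ markedConst k := by
  induction k with
  | zero => exact le_rfl
  | succ k ih => simp only [markedConst]; positivity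

theorem exists_maximal_radius {P : Type*} (ψ : P → ℝ → ℝ) {ρ r c y : ℝ} {J : Set ℝ} {Q : Set P}
    (hr : 0 < r) (hJ : Metric.closedBall c (5 * r) ⊆ J)
    (hcont : ∀ p, ContinuousOn (ψ p) J)
    (hQ : ∀ p ∈ Q, ∃ x ∈ Metric.closedBall c r, ρ ≤ ψ p x)
    (hy : y ∈ Metric.closedBall c r) (hlow : ∃ q ∈ Q, ψ q y < ρ) :
    ∃ p ∈ Q, ∃ s > 0, s ≤ 2 * r ∧ (∀ x ∈ Metric.ball y s, ψ p x < ρ) ∧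
      ∀ q ∈ Q, ∃ x ∈ Metric.closedBall y (2 * s), ρ ≤ ψ q x := by
  set S : Set ℝ := {s | 0 < s ∧ ∃ q ∈ Q, ∀ x ∈ Metric.ball y s, ψ q x < ρ} with hS
  have hbd : ∀ s ∈ S, s ≤ 2 * r := by
    rintro s ⟨hs, q, hq, hqs⟩
    by_contra! hlt
    obtain ⟨x, hx, hxρ⟩ := hQ q hq
    refine absurd (hqs x ?_) (not_lt.2 hxρ)
    rw [Metric.mem_closedBall] at hx hy
    rw [Metric.mem_ball]
    linarith [dist_triangle_right x y c]
  have hne : S.Nonempty := by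
    obtain ⟨q, hq, hqy⟩ := hlow
    have hyJ : J ∈ nhds y := by
      refine Filter.mem_of_superset (Metric.ball_mem_nhds y hr) (subset_trans ?_ hJ)
      intro x hx
      rw [Metric.mem_ball] at hx
      rw [Metric.mem_closedBall] at hy ⊢
      linarith [dist_triangle x y c]
    have := ((hcont q).continuousAt hyJ).eventually (gt_mem_nhds hqy)
    obtain ⟨s, hs, hb⟩ := Metric.eventually_nhds_iff_ball.1 this
    exact ⟨s, hs, q, hq, hb⟩
  have hSbdd : BddAbove S := ⟨2 * r, hbd⟩
  have hpos : 0 < sSup S := by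
    obtain ⟨s, hs⟩ := hne
    exact hs.1.trans_le (le_csSup hSbdd hs)
  obtain ⟨s, hs, hlt⟩ := exists_lt_of_lt_csSup hne (half_lt_self hpos)
  obtain ⟨hs0, p, hp, hps⟩ := id hs
  refine ⟨p, hp, s, hs0, hbd s hs, hps, fun q hq => ?_⟩
  by_contra! hcon
  have : 2 * s ∈ S := ⟨by positivity, q, hq, fun x hx => hcon x (Metric.ball_subset_closedBall hx)⟩
  have := le_csSup hSbdd this
  linarith

theorem volume_not_isMarked_le {P : Type*} (rel : P → P → Prop) (hsymm : ∀ p q, rel p q → rel q p)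
    (ψ : P → ℝ → ℝ) {ε ρ θ : ℝ} (hθ : 0 ≤ θ) {J : Set ℝ} (hcont : ∀ p, ContinuousOn (ψ p) J)
    (hgood : ∀ p, ∀ a b, a < b → Set.Icc a b ⊆ J → (∃ x ∈ Set.Icc a b, ρ ≤ ψ p x) →
      volume {x ∈ Set.Icc a b | ψ p x < ε} ≤ ENNReal.ofReal (θ * (b - a))) (k : ℕ) :
    ∀ (Q : Set P) (_ : ∀ F : Finset P, ↑F ⊆ Q → (F : Set P).Pairwise rel → F.card ≤ k)
      (c r : ℝ), 0 < r → Metric.closedBall c (5 ^ k * r) ⊆ J →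
      (∀ p ∈ Q, ∃ x ∈ Metric.closedBall c r, ρ ≤ ψ p x) →
      volume {x ∈ Metric.closedBall c r | ¬ IsMarked rel ψ ε ρ Q x} ≤
        ENNReal.ofReal (markedConst k * θ * r) := by
  induction k with
  | zero =>
    intro Q hQ c r hr hJ hQB
    have hempty : Q = ∅ := by
      by_contra! hne
      obtain ⟨q, hq⟩ := hne
      have := hQ {q} (by simpa using hq) (by simp)
      simp at this
    have : {x ∈ Metric.closedBall c r | ¬ IsMarked rel ψ ε ρ Q x} = ∅ := by
      ext x
      simp only [Set.mem_sep_iff, Set.mem_empty_iff_false, iff_false, not_and, not_not]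
      intro _
      exact ⟨∅, Set.finite_empty, by simp, by simp, by simp, by simp [hempty]⟩
    rw [this]; simp
  | succ k ih =>
    intro Q hQ c r hr hJ hQB
    classical
    have h5 : (1 : ℝ) ≤ 5 ^ k := one_le_pow₀ (by norm_num)
    have hJ5 : Metric.closedBall c (5 * r) ⊆ J := by
      refine subset_trans (Metric.closedBall_subset_closedBall ?_) hJ
      rw [pow_succ]; nlinarith
    set Bad : Set ℝ := {x ∈ Metric.closedBall c r | ¬ IsMarked rel ψ ε ρ Q x} with hBad
    rcases isEmpty_or_nonempty P with hP | hP
    · have : Bad = ∅ := by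
        ext x
        simp only [hBad, Set.mem_sep_iff, Set.mem_empty_iff_false, iff_false, not_and, not_not]
        exact fun _ => ⟨∅, Set.finite_empty, by simp, by simp, by simp, fun q => hP.elim q⟩
      rw [this]; simp
    have hsel : ∀ y, ∃ p s, y ∈ Bad → p ∈ Q ∧ 0 < s ∧ s ≤ 2 * r ∧
        (∀ x ∈ Metric.ball y s, ψ p x < ρ) ∧
        ∀ q ∈ Q, ∃ x ∈ Metric.closedBall y (2 * s), ρ ≤ ψ q x := by
      intro y
      by_cases hy : y ∈ Bad
      · have hlow : ∃ q ∈ Q, ψ q y < ρ := by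
          by_contra! hcon
          exact hy.2 ⟨∅, Set.finite_empty, by simp, by simp, by simp, fun q hq _ _ => hcon q hq⟩
        obtain ⟨p, hp, s, hs⟩ := exists_maximal_radius ψ hr hJ5 hcont hQB hy.1 hlow
        exact ⟨p, s, fun _ => ⟨hp, hs⟩⟩
      · exact ⟨hP.some, 0, fun h => absurd h hy⟩
    choose p s hps using hsel
    have hbound : ∀ y ∈ Bad, volume (Bad ∩ Metric.closedBall y (5 * (s y / 10))) ≤
        ENNReal.ofReal ((10 * markedConst k + 20) * θ) *
          volume (Metric.closedBall y (s y / 10)) := by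
      intro y hy
      obtain ⟨hpQ, hs0, hsr, hψ, hq⟩ := hps y hy
      set Qy : Set P := {q ∈ Q | q ≠ p y ∧ rel (p y) q} with hQy
      have hsubJ : Metric.closedBall y (5 ^ k * (2 * s y)) ⊆ J := by
        refine subset_trans (fun x hx => ?_) hJ
        have hyc := hy.1
        rw [Metric.mem_closedBall] at hx hyc ⊢
        have : 5 ^ k * (2 * s y) ≤ 5 ^ k * (4 * r) :=
          mul_le_mul_of_nonneg_left (by linarith) (by positivity)
        have h3 : r ≤ 5 ^ k * r := le_mul_of_one_le_left hr.le h5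
        rw [pow_succ]
        linarith [dist_triangle x y c]
      have h1 := ih Qy (by
        intro F hF hFr
        have hpF : p y ∉ F := fun h => (hF h).2.1 rfl
        have := hQ (insert (p y) F) (by
          rw [Finset.coe_insert]
          exact Set.insert_subset hpQ fun q hq => (hF hq).1) (by
          rw [Finset.coe_insert]
          refine hFr.insert fun q hq _ => ⟨(hF hq).2.2, hsymm _ _ (hF hq).2.2⟩)
        rw [Finset.card_insert_of_notMem hpF] at this
        omega) y (2 * s y) (by positivity) hsubJ (fun q hqq => hq q hqq.1)
      have h2 := hgood (p y) (y - 2 * s y) (y + 2 * s y) (by linarith) (by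
        rw [← Real.closedBall_eq_Icc]
        refine subset_trans (Metric.closedBall_subset_closedBall ?_) hsubJ
        nlinarith) (by rw [← Real.closedBall_eq_Icc]; exact hq _ hpQ)
      rw [← Real.closedBall_eq_Icc] at h2
      have hcov : Bad ∩ Metric.closedBall y (5 * (s y / 10)) ⊆
          {x ∈ Metric.closedBall y (2 * s y) | ¬ IsMarked rel ψ ε ρ Qy x} ∪
          {x ∈ Metric.closedBall y (2 * s y) | ψ (p y) x < ε} := by
        rintro x ⟨hxB, hxy⟩
        have hx2 : x ∈ Metric.closedBall y (2 * s y) :=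
          Metric.closedBall_subset_closedBall (by linarith) hxy
        have hxb : x ∈ Metric.ball y (s y) := by
          rw [Metric.mem_closedBall] at hxy; rw [Metric.mem_ball]; linarith
        by_contra hcon
        simp only [Set.mem_union, Set.mem_sep_iff, hx2, true_and, not_or, not_not, not_lt] at hcon
        obtain ⟨⟨F, hFfin, hFQ, hFr, hFψ, hFq⟩, hε⟩ := hcon
        refine hxB.2 ⟨insert (p y) F, hFfin.insert _, ?_, ?_, ?_, ?_⟩
        · exact Set.insert_subset hpQ fun q hq => (hFQ hq).1
        · exact hFr.insert fun q hq _ => ⟨(hFQ hq).2.2, hsymm _ _ (hFQ hq).2.2⟩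
        · rintro q (rfl | hq)
          · exact ⟨hε, (hψ x hxb).le⟩
          · exact hFψ q hq
        · intro q hqQ hqF hqr
          have hqF' := not_or.1 (Set.mem_insert_iff.not.1 hqF)
          exact hFq q ⟨hqQ, hqF'.1, hqr _ (Set.mem_insert _ _)⟩ hqF'.2
            fun p' hp' => hqr p' (Set.mem_insert_of_mem _ hp')
      refine (measure_mono hcov).trans ((measure_union_le _ _).trans ((add_le_add h1 h2).trans ?_))
      have := markedConst_nonneg k
      rw [Real.volume_closedBall, ← ENNReal.ofReal_mul (by positivity),
        ← ENNReal.ofReal_add (by positivity)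
            (by rw [show y + 2 * s y - (y - 2 * s y) = 4 * s y by ring]; positivity)]
      exact ENNReal.ofReal_le_ofReal (by nlinarith)
    obtain ⟨u, huB, hdisj, hcov⟩ := Vitali.exists_disjoint_subfamily_covering_enlargement_closedBall
      Bad id (fun y => s y / 10) r (fun y hy => by have := (hps y hy).2.2.1; linarith) 5
      (by norm_num)
    have hucount : u.Countable := hdisj.countable_of_nonempty_interior fun y hy => by
      have hs0 := (hps y (huB hy)).2.1
      exact ⟨y, mem_interior_iff_mem_nhds.2 (Metric.closedBall_mem_nhds y (by positivity))⟩
    have hBadcov : Bad ⊆ ⋃ y ∈ u, Bad ∩ Metric.closedBall y (5 * (s y / 10)) := by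
      intro y hy
      obtain ⟨b, hb, hyb⟩ := hcov y hy
      have hs0 := (hps y hy).2.1
      exact Set.mem_biUnion hb ⟨hy, hyb (Metric.mem_closedBall_self (by positivity))⟩
    calc volume Bad ≤ ∑' y : u, volume (Bad ∩ Metric.closedBall (y : ℝ) (5 * (s y / 10))) :=
          (measure_mono hBadcov).trans (measure_biUnion_le _ hucount _)
      _ ≤ ∑' y : u, ENNReal.ofReal ((10 * markedConst k + 20) * θ) *
          volume (Metric.closedBall (y : ℝ) (s y / 10)) :=
          ENNReal.tsum_le_tsum fun y => hbound y (huB y.2)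
      _ = ENNReal.ofReal ((10 * markedConst k + 20) * θ) *
          volume (⋃ y ∈ u, Metric.closedBall (y : ℝ) (s y / 10)) := by
          rw [ENNReal.tsum_mul_left,
            measure_biUnion (f := fun y => Metric.closedBall y (s y / 10)) hucount hdisj
            fun _ _ => Metric.isClosed_closedBall.measurableSet]
      _ ≤ ENNReal.ofReal ((10 * markedConst k + 20) * θ) *
          volume (Metric.closedBall c (3 * r)) := by
          gcongr
          refine Set.iUnion₂_subset fun y hy x hx => ?_
          have h1 := (huB hy).1
          have h2 := (hps y (huB hy)).2.2.1
          rw [Metric.mem_closedBall] at hx h1 ⊢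
          linarith [dist_triangle x y c]
      _ = ENNReal.ofReal (markedConst (k + 1) * θ * r) := by
          have := markedConst_nonneg k
          rw [Real.volume_closedBall, ← ENNReal.ofReal_mul (by positivity), markedConst]
          congr 1; ring

/-- The matrix with columns the given integer vectors. -/
def intCols {ι : Type*} {j : ℕ} (b : Fin j → ι → ℤ) : Matrix ι (Fin j) ℝ :=
  Matrix.of fun i l => (b l i : ℝ)

/-- The sum of the absolute values of all maximal minors (rows chosen with repetition). -/
noncomputable def minorSum {R : Type*} [Fintype R] {j : ℕ} (A : Matrix R (Fin j) ℝ) : ℝ :=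
  ∑ I : Fin j → R, |(A.submatrix I id).det|

theorem minorSum_nonneg {R : Type*} [Fintype R] {j : ℕ} (A : Matrix R (Fin j) ℝ) :
    0 ≤ minorSum A :=
  Finset.sum_nonneg fun _ _ => abs_nonneg _

theorem minorSum_mul {R : Type*} [Fintype R] {j : ℕ} (A : Matrix R (Fin j) ℝ)
    (C : Matrix (Fin j) (Fin j) ℝ) : minorSum (A * C) = minorSum A * |C.det| := by
  rw [minorSum, minorSum, Finset.sum_mul]
  refine Finset.sum_congr rfl fun I _ => ?_
  rw [← abs_mul, ← Matrix.det_mul]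
  congr 2

theorem minorSum_cons_le {R : Type*} [Fintype R] {j : ℕ} (A : Matrix R (Fin (j + 1)) ℝ) {δ : ℝ}
    (hδ : ∀ i, |A i 0| ≤ δ) :
    minorSum A ≤ (j + 1) * Fintype.card R * δ * minorSum (A.submatrix id Fin.succ) := by
  classical
  calc minorSum A ≤ ∑ I : Fin (j + 1) → R, ∑ a : Fin (j + 1),
        δ * |((A.submatrix id Fin.succ).submatrix (fun l => I (a.succAbove l)) id).det| := by
        refine Finset.sum_le_sum fun I _ => ?_
        rw [Matrix.det_succ_column_zero]
        refine (Finset.abs_sum_le_sum_abs _ _).trans (Finset.sum_le_sum fun a _ => ?_)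
        rw [abs_mul, abs_mul, abs_pow, abs_neg, abs_one, one_pow, one_mul]
        exact mul_le_mul_of_nonneg_right (hδ _) (abs_nonneg _)
    _ = ∑ a : Fin (j + 1), Fintype.card R * δ * minorSum (A.submatrix id Fin.succ) := by
        rw [Finset.sum_comm]
        refine Finset.sum_congr rfl fun a _ => ?_
        rw [← (Fin.insertNthEquiv (fun _ => R) a).sum_comp, Fintype.sum_prod_type]
        simp only [Fin.insertNthEquiv_apply, Fin.insertNth_apply_succAbove, ← Finset.mul_sum,
          Finset.sum_const, Finset.card_univ, nsmul_eq_mul]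
        simp only [minorSum]
        ring
    _ = _ := by
        simp only [Finset.sum_const, Finset.card_univ, Fintype.card_fin, nsmul_eq_mul]
        push_cast; ring

/-- The inclusion of integer vectors in rational vectors. -/
def intVecToRat (ι : Type*) : (ι → ℤ) →ₗ[ℤ] (ι → ℚ) :=
  (Int.castAddHom ℚ).toIntLinearMap.compLeft ι

theorem intVecToRat_apply {ι : Type*} (w : ι → ℤ) (i : ι) : intVecToRat ι w i = w i := rfl

theorem intVecToRat_injective (ι : Type*) : Function.Injective (intVecToRat ι) := by
  intro v w h
  ext i
  have := congrFun h i
  simpa [intVecToRat_apply] using this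

theorem exists_int_multiple {ι : Type*} [Finite ι] (x : ι → ℚ) :
    ∃ d : ℤ, d ≠ 0 ∧ ∃ w : ι → ℤ, intVecToRat ι w = (d : ℚ) • x := by
  obtain ⟨⟨d, hd⟩, h⟩ := IsLocalization.exist_integer_multiples_of_finite (nonZeroDivisors ℤ) x
  choose w hw using h
  refine ⟨d, nonZeroDivisors.ne_zero hd, w, ?_⟩
  ext i
  have := hw i
  simp only [algebraMap_int_eq, eq_intCast, zsmul_eq_mul] at this
  simp [intVecToRat_apply, this]

theorem exists_integral_basis {ι : Type*} [Fintype ι] (S : Submodule ℚ (ι → ℚ)) :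
    ∃ b : Fin (Module.finrank ℚ S) → ι → ℤ, LinearIndependent ℤ b ∧
      (∀ l, intVecToRat ι (b l) ∈ S) ∧
      ∀ w : ι → ℤ, intVecToRat ι w ∈ S → ∃ c : Fin (Module.finrank ℚ S) → ℤ,
        w = ∑ l, c l • b l := by
  set N : Submodule ℤ (ι → ℤ) := (S.restrictScalars ℤ).comap (intVecToRat ι) with hN
  obtain ⟨n, bs⟩ := Submodule.basisOfPid (Pi.basisFun ℤ ι) N
  have hli : LinearIndependent ℤ (fun l => intVecToRat ι (bs l : ι → ℤ)) := by
    have h1 : LinearIndependent ℤ (fun l => ((bs l : N) : ι → ℤ)) :=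
      bs.linearIndependent.map' N.subtype N.ker_subtype
    exact h1.map' (intVecToRat ι) (LinearMap.ker_eq_bot.2 (intVecToRat_injective ι))
  have hliQ : LinearIndependent ℚ (fun l => (⟨intVecToRat ι (bs l : ι → ℤ), (bs l).2⟩ : S)) := by
    have := (LinearIndependent.iff_fractionRing ℤ ℚ).1 hli
    exact LinearIndependent.of_comp S.subtype this
  have hrep : ∀ w : ι → ℤ, intVecToRat ι w ∈ S → ∃ c : Fin n → ℤ,
      w = ∑ l, c l • (bs l : ι → ℤ) := by
    intro w hw
    refine ⟨bs.repr ⟨w, hw⟩, ?_⟩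
    have := congrArg (fun x : N => (x : ι → ℤ)) (bs.sum_repr ⟨w, hw⟩)
    simp only [Submodule.coe_sum, Submodule.coe_smul] at this
    exact this.symm
  have hspan : ⊤ ≤ Submodule.span ℚ
      (Set.range (fun l => (⟨intVecToRat ι (bs l : ι → ℤ), (bs l).2⟩ : S))) := by
    rintro ⟨x, hx⟩ -
    obtain ⟨d, hd, w, hw⟩ := exists_int_multiple x
    obtain ⟨c, hc⟩ := hrep w (by rw [hw]; exact S.smul_mem _ hx)
    have : (⟨x, hx⟩ : S) = ∑ l, ((d : ℚ)⁻¹ * c l) •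
        (⟨intVecToRat ι (bs l : ι → ℤ), (bs l).2⟩ : S) := by
      apply Subtype.ext
      have hdq : (d : ℚ) ≠ 0 := by exact_mod_cast hd
      have h1 : x = (d : ℚ)⁻¹ • intVecToRat ι w := by rw [hw, smul_smul, inv_mul_cancel₀ hdq, one_smul]
      simp only [Submodule.coe_sum, Submodule.coe_smul]
      rw [h1, hc, map_sum, Finset.smul_sum]
      refine Finset.sum_congr rfl fun l _ => ?_
      rw [map_zsmul, mul_smul, Int.cast_smul_eq_zsmul]
    rw [this]
    exact Submodule.sum_mem _ fun l _ => Submodule.smul_mem _ _ (Submodule.subset_span ⟨l, rfl⟩)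
  have hn : Module.finrank ℚ S = n := by
    rw [Module.finrank_eq_card_basis (Module.Basis.mk hliQ hspan), Fintype.card_fin]
  rw [hn]
  exact ⟨fun l => bs l, bs.linearIndependent.map' N.subtype N.ker_subtype, fun l => (bs l).2, hrep⟩

theorem minorSum_le_of_int_combination {R ι : Type*} [Fintype R] [Fintype ι] {j : ℕ}
    (H : Matrix R ι ℝ) (b b' : Fin j → ι → ℤ) (hb' : LinearIndependent ℤ b')
    (h : ∀ l, ∃ c : Fin j → ℤ, b' l = ∑ i, c i • b i) :
    minorSum (H * intCols b) ≤ minorSum (H * intCols b') := by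
  choose c hc using h
  let C : Matrix (Fin j) (Fin j) ℤ := Matrix.of fun i l => c l i
  have hmul : intCols b' = intCols b * C.map (Int.cast : ℤ → ℝ) := by
    ext i l
    simp only [intCols, Matrix.of_apply, Matrix.mul_apply, Matrix.map_apply, C]
    rw [hc l]
    simp [Finset.sum_apply, mul_comm]
  have hdet : C.det ≠ 0 := by
    intro h0
    obtain ⟨v, hv, hCv⟩ := Matrix.exists_mulVec_eq_zero_iff.2 h0
    apply hv
    have hsum : ∑ l, v l • b' l = 0 := by
      have h2 : ∑ l, v l • b' l = ∑ i, (C.mulVec v) i • b i := by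
        simp only [hc, Finset.smul_sum, Matrix.mulVec, dotProduct, Finset.sum_smul, C,
          Matrix.of_apply, smul_smul]
        rw [Finset.sum_comm]
        simp only [mul_comm]
      rw [h2, hCv]; simp
    ext l
    exact Fintype.linearIndependent_iff.1 hb' v hsum l
  rw [hmul, ← Matrix.mul_assoc, minorSum_mul]
  have h1 : (1 : ℝ) ≤ |(C.map (Int.cast : ℤ → ℝ)).det| := by
    have : (C.map (Int.cast : ℤ → ℝ)).det = (C.det : ℝ) := by
      exact (RingHom.map_det (Int.castRingHom ℝ) C).symm
    rw [this, ← Int.cast_abs]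
    exact_mod_cast Int.one_le_abs hdet
  exact le_mul_of_one_le_right (minorSum_nonneg _) h1

/-- A chosen integral basis of the integer points of a rational subspace. -/
noncomputable def integralBasis {ι : Type*} [Fintype ι] (S : Submodule ℚ (ι → ℚ)) :
    Fin (Module.finrank ℚ S) → ι → ℤ :=
  (exists_integral_basis S).choose

/-- The covolume-like function of the lattice of integer points of `S`. -/
noncomputable def subspaceMinor {R ι : Type*} [Fintype R] [Fintype ι] (H : Matrix R ι ℝ)
    (S : Submodule ℚ (ι → ℚ)) : ℝ :=
  minorSum (H * intCols (integralBasis S))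

theorem subspaceMinor_le {R ι : Type*} [Fintype R] [Fintype ι] (H : Matrix R ι ℝ)
    (S : Submodule ℚ (ι → ℚ)) {j : ℕ} (hj : Module.finrank ℚ S = j) (b : Fin j → ι → ℤ)
    (hb : LinearIndependent ℤ b) (hbS : ∀ l, intVecToRat ι (b l) ∈ S) :
    subspaceMinor H S ≤ minorSum (H * intCols b) := by
  subst hj
  exact minorSum_le_of_int_combination H _ b hb
    fun l => (exists_integral_basis S).choose_spec.2.2 (b l) (hbS l)

theorem linearIndependent_intVecToRat {ι : Type*} {j : ℕ} {b : Fin j → ι → ℤ}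
    (hb : LinearIndependent ℤ b) : LinearIndependent ℚ (fun l => intVecToRat ι (b l)) :=
  (LinearIndependent.iff_fractionRing ℤ ℚ).1
    (hb.map' (intVecToRat ι) (LinearMap.ker_eq_bot.2 (intVecToRat_injective ι)))

theorem linearIndependent_of_intVecToRat {ι : Type*} {j : ℕ} {b : Fin j → ι → ℤ}
    (hb : LinearIndependent ℚ (fun l => intVecToRat ι (b l))) : LinearIndependent ℤ b :=
  LinearIndependent.of_comp (intVecToRat ι) ((LinearIndependent.iff_fractionRing ℤ ℚ).2 hb)

theorem subspaceMinor_sup_span_le {R ι : Type*} [Fintype R] [Fintype ι] (H : Matrix R ι ℝ)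
    (S : Submodule ℚ (ι → ℚ)) (w : ι → ℤ) (hw : intVecToRat ι w ∉ S) {δ : ℝ}
    (hδ : ∀ i, |∑ l, H i l * (w l : ℝ)| ≤ δ) :
    subspaceMinor H (S ⊔ Submodule.span ℚ {intVecToRat ι w}) ≤
      Fintype.card ι * Fintype.card R * δ * subspaceMinor H S := by
  set b := integralBasis S with hb
  have hbS := (exists_integral_basis S).choose_spec.2.1
  have hbli := (exists_integral_basis S).choose_spec.1
  set b' : Fin (Module.finrank ℚ S + 1) → ι → ℤ := Fin.cons w b with hb'
  have hspan : Submodule.span ℚ (Set.range fun l => intVecToRat ι (b l)) ≤ S := by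
    rw [Submodule.span_le]
    rintro _ ⟨l, rfl⟩
    exact hbS l
  have hliQ : LinearIndependent ℚ (fun l => intVecToRat ι (b' l)) := by
    have : (fun l => intVecToRat ι (b' l)) =
        (Fin.cons (intVecToRat ι w) (fun l => intVecToRat ι (b l)) : Fin _ → ι → ℚ) := by
      funext l
      refine Fin.cases ?_ (fun l => ?_) l <;> simp [hb']
    rw [this, linearIndependent_finCons]
    exact ⟨linearIndependent_intVecToRat hbli, fun h => hw (hspan h)⟩
  have hmem : ∀ l, intVecToRat ι (b' l) ∈ S ⊔ Submodule.span ℚ {intVecToRat ι w} := by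
    intro l
    refine Fin.cases ?_ (fun l => ?_) l
    · exact Submodule.mem_sup_right (Submodule.mem_span_singleton_self _)
    · exact Submodule.mem_sup_left (hbS l)
  have hle : Module.finrank ℚ S + 1 ≤ Fintype.card ι := by
    have := hliQ.fintype_card_le_finrank
    simpa using this
  have hfin : Module.finrank ℚ ↥(S ⊔ Submodule.span ℚ {intVecToRat ι w}) =
      Module.finrank ℚ S + 1 := by
    apply le_antisymm
    · refine (Submodule.finrank_add_le_finrank_add_finrank _ _).trans ?_
      gcongr
      exact (finrank_span_le_card _).trans (by simp)
    · have := (LinearIndependent.of_comp (Submodule.subtype _)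
        (v := fun l => (⟨_, hmem l⟩ : ↥(S ⊔ Submodule.span ℚ {intVecToRat ι w})))
        hliQ).fintype_card_le_finrank
      simpa using this
  have hH : ∀ i, |(H * intCols b') i 0| ≤ δ := by
    intro i
    simpa [Matrix.mul_apply, intCols, hb'] using hδ i
  refine (subspaceMinor_le H _ hfin b' (linearIndependent_of_intVecToRat hliQ) hmem).trans
    ((minorSum_cons_le _ hH).trans ?_)
  have hsub : (H * intCols b').submatrix id Fin.succ = H * intCols b := by
    ext i l
    simp [Matrix.mul_apply, intCols, hb']
  rw [hsub]
  have h0 := minorSum_nonneg (H * intCols b)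
  by_cases hR : Nonempty R
  · have hδ0 : 0 ≤ δ := (abs_nonneg _).trans (hδ hR.some)
    have : ((Module.finrank ℚ S : ℝ) + 1) ≤ Fintype.card ι := by exact_mod_cast hle
    show _ ≤ Fintype.card ι * Fintype.card R * δ * minorSum (H * intCols b)
    gcongr
  · rw [not_nonempty_iff] at hR
    simp

/-- Quantitative nondivergence for a one-parameter family of matrices acting on integer vectors. -/
theorem volume_short_vectors_le {R ι : Type*} [Fintype R] [Fintype ι] (H : ℝ → Matrix R ι ℝ)
    {J : Set ℝ} {θ η ρ c r : ℝ} (hθ : 0 ≤ θ) (hη : 0 < η) (hη1 : η ≤ 1) (hρ : 0 < ρ) (hρ1 : ρ ≤ 1)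
    (hr : 0 < r) (hJ : Metric.closedBall c (5 ^ Fintype.card ι * r) ⊆ J)
    (hcont : ∀ i l, ContinuousOn (fun x => H x i l) J)
    (hgood : ∀ (j : ℕ) (b : Fin j → ι → ℤ) (I : Fin j → R) (α β : ℝ), α < β →
      Set.Icc α β ⊆ J → ∀ z ∈ Set.Icc α β,
      volume {x ∈ Set.Icc α β | |((H x * intCols b).submatrix I id).det| <
        η * |((H z * intCols b).submatrix I id).det|} ≤ ENNReal.ofReal (θ * (β - α)))
    (hlow : ∀ (j : ℕ) (b : Fin (j + 1) → ι → ℤ), LinearIndependent ℤ b →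
      ∃ x ∈ Metric.closedBall c r, ρ ≤ minorSum (H x * intCols b)) :
    volume {x ∈ Metric.closedBall c r | ∃ w : ι → ℤ, w ≠ 0 ∧ ∀ i, |∑ l, H x i l * (w l : ℝ)| ≤
      η * ρ / ((Fintype.card R + 1) ^ Fintype.card ι * (Fintype.card ι * Fintype.card R + 1))} ≤
      ENNReal.ofReal (markedConst (Fintype.card ι) * θ * r) := by
  classical
  set n := Fintype.card ι with hn
  set m := Fintype.card R with hm
  set ε : ℝ := η * ρ / (m + 1) ^ n with hε
  have hε0 : 0 < ε := by positivity
  have hερ : ε ≤ ρ := by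
    rw [hε, div_le_iff₀ (by positivity)]
    have : (1 : ℝ) ≤ (m + 1) ^ n := one_le_pow₀ (by linarith [Nat.cast_nonneg (α := ℝ) m])
    nlinarith
  let rel : Submodule ℚ (ι → ℚ) → Submodule ℚ (ι → ℚ) → Prop := fun S S' => S ≤ S' ∨ S' ≤ S
  let ψ : Submodule ℚ (ι → ℚ) → ℝ → ℝ := fun S x => subspaceMinor (H x) S
  have hfr : ∀ S : Submodule ℚ (ι → ℚ), Module.finrank ℚ S ≤ n := fun S => by
    simpa using S.finrank_le
  have hdetcont : ∀ (j : ℕ) (b : Fin j → ι → ℤ),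
      ContinuousOn (fun x => minorSum (H x * intCols b)) J := by
    intro j b
    refine continuousOn_finsetSum _ fun I _ => ContinuousOn.abs ?_
    simp only [Matrix.det_apply]
    refine continuousOn_finsetSum _ fun σ _ => ContinuousOn.const_smul
      (continuousOn_finsetProd _ fun a _ => ?_) _
    simp only [Matrix.submatrix_apply, Matrix.mul_apply]
    exact continuousOn_finsetSum _ fun l _ => (hcont _ l).mul continuousOn_const
  have key := volume_not_isMarked_le rel (fun _ _ h => h.symm) ψ (ε := ε) (ρ := ρ) hθ
    (J := J) (fun S => hdetcont _ _) (by
      rintro S α β hαβ hsub ⟨z, hz, hzρ⟩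
      have : ∃ I : Fin (Module.finrank ℚ S) → R, ρ / (m + 1) ^ n ≤
          |((H z * intCols (integralBasis S)).submatrix I id).det| := by
        by_contra! hcon
        have hlt : ψ S z ≤ ∑ _I : Fin (Module.finrank ℚ S) → R, ρ / (m + 1) ^ n :=
          Finset.sum_le_sum fun I _ => (hcon I).le
        have h2 : (∑ _I : Fin (Module.finrank ℚ S) → R, ρ / ((m : ℝ) + 1) ^ n) ≤ ρ := by
          rw [Finset.sum_const, Finset.card_univ, nsmul_eq_mul, Fintype.card_fun, Fintype.card_fin,
            mul_div_assoc', div_le_iff₀ (by positivity), mul_comm]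
          gcongr
          push_cast
          calc (m : ℝ) ^ Module.finrank ℚ S ≤ (m + 1) ^ Module.finrank ℚ S := by gcongr; linarith
            _ ≤ (m + 1) ^ n := pow_le_pow_right₀ (by linarith [Nat.cast_nonneg (α := ℝ) m]) (hfr S)
        rcases isEmpty_or_nonempty (Fin (Module.finrank ℚ S) → R) with hI | hI
        · have : ψ S z = 0 := Fintype.sum_empty _
          linarith
        · have hlt' : ψ S z < ∑ _I : Fin (Module.finrank ℚ S) → R, ρ / (m + 1) ^ n :=
            Finset.sum_lt_sum_of_nonempty Finset.univ_nonempty fun I _ => hcon I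
          linarith
      obtain ⟨I, hI⟩ := this
      refine (measure_mono ?_).trans (hgood _ (integralBasis S) I α β hαβ hsub z hz)
      rintro x ⟨hx, hxε⟩
      refine ⟨hx, lt_of_le_of_lt ?_ (hxε.trans_le ?_)⟩
      · exact Finset.single_le_sum (f := fun I =>
          |((H x * intCols (integralBasis S)).submatrix I id).det|)
          (fun _ _ => abs_nonneg _) (Finset.mem_univ I)
      · rw [hε, mul_div_assoc]; gcongr) n {S | S ≠ ⊥} (by
      intro F hF hFr
      have hinj : Set.InjOn (fun S : Submodule ℚ (ι → ℚ) => Module.finrank ℚ S) F := by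
        intro S hS S' hS' h
        by_contra hne
        rcases hFr hS hS' hne with h1 | h1
        · exact hne (Submodule.eq_of_le_of_finrank_eq h1 h)
        · exact hne (Submodule.eq_of_le_of_finrank_eq h1 h.symm).symm
      have : F.card ≤ (Finset.Icc 1 n).card := by
        rw [← Finset.card_image_of_injOn hinj]
        refine Finset.card_le_card fun d hd => ?_
        obtain ⟨S, hS, rfl⟩ := Finset.mem_image.1 hd
        rw [Finset.mem_Icc]
        exact ⟨Submodule.one_le_finrank_iff.2 (hF hS), hfr S⟩
      simpa using this) c r hr hJ (by
      intro S hS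
      have h1 : 1 ≤ Module.finrank ℚ S := Submodule.one_le_finrank_iff.2 hS
      obtain ⟨j, hj⟩ : ∃ j, Module.finrank ℚ S = j + 1 := ⟨_, (Nat.sub_add_cancel h1).symm⟩
      have : ∀ d (b : Fin d → ι → ℤ), d = j + 1 → LinearIndependent ℤ b →
          ∃ x ∈ Metric.closedBall c r, ρ ≤ minorSum (H x * intCols b) := by
        rintro d b rfl hb
        exact hlow j b hb
      exact this _ (integralBasis S) hj (exists_integral_basis S).choose_spec.1)
  refine (measure_mono ?_).trans key
  rintro x ⟨hxB, w, hw0, hw⟩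
  refine ⟨hxB, ?_⟩
  rintro ⟨F, hFfin, hFQ, hFr, hFψ, hFq⟩
  set δ : ℝ := η * ρ / ((m + 1) ^ n * (n * m + 1)) with hδ
  set v := intVecToRat ι w with hv
  have hv0 : v ≠ 0 := fun h => hw0 (intVecToRat_injective ι (by rw [← hv, h, map_zero]))
  have hsmall : ∀ S : Submodule ℚ (ι → ℚ), v ∉ S → ψ S x ≤ 1 →
      ψ (S ⊔ Submodule.span ℚ {v}) x < ε := by
    intro S hS hS1
    refine (subspaceMinor_sup_span_le (H x) S w hS hw).trans_lt ?_
    have h0 : 0 ≤ ψ S x := minorSum_nonneg _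
    have hδ0 : 0 ≤ δ := by positivity
    calc (n : ℝ) * m * δ * ψ S x ≤ n * m * δ * 1 := by gcongr
      _ < (n * m + 1) * δ := by
        have : 0 < δ := by positivity
        nlinarith
      _ = ε := by rw [hδ, hε]; field_simp
  have hcase : ∃ S : Submodule ℚ (ι → ℚ), v ∉ S ∧ ψ S x ≤ 1 ∧ (∀ p ∈ F, v ∉ p → p ≤ S) ∧
      (∀ p ∈ F, v ∈ p → S ≤ p) := by
    rcases Set.eq_empty_or_nonempty {p ∈ F | v ∉ p} with hemp | hne
    · refine ⟨⊥, by simpa using hv0, ?_, fun p hp hvp => ?_, fun _ _ _ => bot_le⟩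
      · refine (subspaceMinor_le (H x) ⊥ (j := 0) (by simp) (fun l => l.elim0)
          linearIndependent_empty_type (fun l => l.elim0)).trans ?_
        simp [minorSum]
      · exact absurd (show p ∈ {p ∈ F | v ∉ p} from ⟨hp, hvp⟩) (by simp [hemp])
    · obtain ⟨S, hS⟩ := (hFfin.subset (Set.sep_subset F fun p => v ∉ p)).exists_maximal hne
      refine ⟨S, hS.prop.2, (hFψ S hS.prop.1).2.trans hρ1, fun p hp hvp => ?_, fun p hp hvp => ?_⟩
      · by_cases hpS : S = p
        · exact hpS.ge
        · rcases hFr hS.prop.1 hp hpS with h | h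
          · exact hS.le_of_ge ⟨hp, hvp⟩ h
          · exact h
      · have hpS : S ≠ p := fun h => hS.prop.2 (h ▸ hvp)
        rcases hFr hS.prop.1 hp hpS with h | h
        · exact h
        · exact absurd (h hvp) hS.prop.2
  obtain ⟨S, hvS, hS1, hbelow, habove⟩ := hcase
  have hlt := hsmall S hvS hS1
  set S' := S ⊔ Submodule.span ℚ {v} with hS'
  have hvS' : v ∈ S' := Submodule.mem_sup_right (Submodule.mem_span_singleton_self _)
  by_cases hmem : S' ∈ F
  · exact absurd (hFψ S' hmem).1 (not_le.2 hlt)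
  · have := hFq S' (fun h => hv0 (by simpa [h] using hvS')) hmem (fun p hp => by
      by_cases hvp : v ∈ p
      · exact Or.inr (sup_le (habove p hp hvp) ((Submodule.span_singleton_le_iff_mem _ _).2 hvp))
      · exact Or.inl ((hbelow p hp hvp).trans le_sup_left))
    linarith

/-- The products of at most `n` members of a family of functions. -/
def familyProducts {P : Type*} (g : P → ℝ → ℝ) (n : ℕ) :
    (Σ j : Fin (n + 1), (Fin j → P)) → ℝ → ℝ :=
  fun i x => ∏ l, g (i.2 l) x

theorem prod_mem_span_familyProducts {P : Type*} (g : P → ℝ → ℝ) {n j : ℕ} (hj : j ≤ n)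
    (f : Fin j → ℝ → ℝ) (hf : ∀ l, f l ∈ Submodule.span ℝ (Set.range g)) :
    (∏ l, f l) ∈ Submodule.span ℝ (Set.range (familyProducts g n)) := by
  have key : ∀ j (f : Fin j → ℝ → ℝ), (∀ l, f l ∈ Submodule.span ℝ (Set.range g)) →
      (∏ l, f l) ∈ Submodule.span ℝ (Set.range fun (q : Fin j → P) => ∏ l, g (q l)) := by
    intro j
    induction j with
    | zero =>
      intro f _
      exact Submodule.subset_span ⟨Fin.elim0, by simp⟩
    | succ j ih =>
      intro f hf
      rw [Fin.prod_univ_succ]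
      have h2 := ih (fun l => f l.succ) fun l => hf _
      have h1 := hf 0
      have := Submodule.mul_mem_mul h1 h2
      rw [Submodule.span_mul_span] at this
      refine Submodule.span_mono ?_ this
      rintro _ ⟨_, ⟨p, rfl⟩, _, ⟨q, rfl⟩, rfl⟩
      exact ⟨Fin.cons p q, by simp [Fin.prod_univ_succ]⟩
  refine Submodule.span_mono ?_ (key j f hf)
  rintro _ ⟨q, rfl⟩
  exact ⟨⟨⟨j, by omega⟩, q⟩, by ext x; simp [familyProducts]⟩

theorem det_submatrix_mul_eq_sum {R ι : Type*} [Fintype ι] {j : ℕ} (A : Matrix R ι ℝ)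
    (B : Matrix ι (Fin j) ℝ) (I : Fin j → R) :
    ((A * B).submatrix I id).det =
      ∑ c : Fin j → ι, (∏ l, A (I l) (c l)) * (B.submatrix c id).det := by
  classical
  have h : ((A * B).submatrix I id) = fun l => ∑ c : ι, A (I l) c • B c := by
    ext l a
    simp [Matrix.mul_apply]
  rw [h]
  change Matrix.detRowAlternating (fun l => ∑ c : ι, A (I l) c • B c) = _
  rw [← AlternatingMap.coe_multilinearMap, MultilinearMap.map_sum]
  refine Finset.sum_congr rfl fun c _ => ?_
  rw [MultilinearMap.map_smul_univ]
  rfl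

theorem minor_mem_span_familyProducts {P R ι : Type*} [Fintype ι] (g : P → ℝ → ℝ)
    (H : ℝ → Matrix R ι ℝ) (hH : ∀ i l, (fun x => H x i l) ∈ Submodule.span ℝ (Set.range g))
    {j : ℕ} (B : Matrix ι (Fin j) ℝ) (I : Fin j → R) :
    (fun x => ((H x * B).submatrix I id).det) ∈
      Submodule.span ℝ (Set.range (familyProducts g (Fintype.card ι))) := by
  classical
  have h : (fun x => ((H x * B).submatrix I id).det) =
      ∑ c : Fin j → ι, (B.submatrix c id).det • ∏ l, (fun x => H x (I l) (c l)) := by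
    ext x
    simp [det_submatrix_mul_eq_sum, mul_comm]
  rw [h]
  refine Submodule.sum_mem _ fun c _ => ?_
  by_cases hj : j ≤ Fintype.card ι
  · exact Submodule.smul_mem _ _ (prod_mem_span_familyProducts g hj _ fun l => hH _ _)
  · have hc : ¬ Function.Injective c := fun h => hj (by simpa using Fintype.card_le_of_injective c h)
    rw [Function.Injective] at hc
    push Not at hc
    obtain ⟨p, q, hpq, hne⟩ := hc
    rw [Matrix.det_zero_of_row_eq hne (by ext a; simp [hpq]), zero_smul]
    exact Submodule.zero_mem _

theorem exists_radius_volume_short_vectors_le {P : Type*} [Fintype P] (R ι : Type*) [Fintype R]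
    [Fintype ι] (g : P → ℝ → ℝ) (x0 : ℝ) (hg : ∀ p, AnalyticAt ℝ (g p) x0) :
    ∃ r0 > 0, (∀ p, AnalyticOnNhd ℝ (g p) (Metric.closedBall x0 r0)) ∧
      ∀ r > 0, r ≤ r0 → ∀ δ > 0, ∀ ρ > 0, ∃ ε > 0, ∀ H : ℝ → Matrix R ι ℝ,
      (∀ i l, (fun x => H x i l) ∈ Submodule.span ℝ (Set.range g)) →
      (∀ (j : ℕ) (b : Fin (j + 1) → ι → ℤ), LinearIndependent ℤ b →
        ∃ x ∈ Metric.closedBall x0 r, ρ ≤ minorSum (H x * intCols b)) →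
      volume {x ∈ Metric.closedBall x0 r | ∃ w : ι → ℤ, w ≠ 0 ∧
        ∀ i, |∑ l, H x i l * (w l : ℝ)| ≤ ε} ≤ ENNReal.ofReal δ := by
  set n := Fintype.card ι with hn
  have hG : ∀ i, AnalyticAt ℝ (Sum.elim g (familyProducts g n) i) x0 := by
    rintro (p | ⟨j, q⟩)
    · exact hg p
    · exact Finset.analyticAt_fun_prod (f := fun l x => g (q l) x) Finset.univ fun l _ => hg _
  obtain ⟨R1, hR1, hRa, hgood⟩ := exists_good_radius _ x0 hG
  have h5 : (1 : ℝ) ≤ 5 ^ n := one_le_pow₀ (by norm_num)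
  have h5' : (0 : ℝ) < 5 ^ n := by positivity
  refine ⟨R1 / 5 ^ n, by positivity, fun p => (hRa (Sum.inl p)).mono
    (Metric.closedBall_subset_closedBall (div_le_self hR1.le h5)), ?_⟩
  intro r hr hrR δ hδ ρ hρ
  have hM := markedConst_nonneg n
  set θ := δ / ((markedConst n + 1) * r) with hθ
  have hθ0 : 0 < θ := by positivity
  obtain ⟨η, hη, hη'⟩ := hgood θ hθ0
  set ρ' := min ρ 1 with hρ'
  have hρ'0 : 0 < ρ' := lt_min hρ one_pos
  set η' := min η 1 with hηd
  have hη'0 : 0 < η' := lt_min hη one_pos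
  refine ⟨η' * ρ' / ((Fintype.card R + 1) ^ Fintype.card ι *
    (Fintype.card ι * Fintype.card R + 1)), by positivity, fun H hH hlow => ?_⟩
  refine (volume_short_vectors_le H (J := Metric.closedBall x0 R1) (θ := θ) hθ0.le hη'0
    (min_le_right _ _) hρ'0 (min_le_right _ _) hr ?_ ?_ ?_ ?_).trans ?_
  · refine Metric.closedBall_subset_closedBall ?_
    rw [le_div_iff₀ h5'] at hrR
    linarith
  · intro i l
    obtain ⟨c, hc⟩ := (Submodule.mem_span_range_iff_exists_fun ℝ).1 (hH i l)
    rw [← hc]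
    have : ∀ p, ContinuousOn (g p) (Metric.closedBall x0 R1) :=
      fun p => (hRa (Sum.inl p)).continuousOn
    have h2 : ContinuousOn (fun x => ∑ p, c p * g p x) (Metric.closedBall x0 R1) :=
      continuousOn_finsetSum _ fun p _ => continuousOn_const.mul (this p)
    refine h2.congr fun x _ => ?_
    simp
  · intro j b I α β hαβ hsub z hz
    obtain ⟨c, hc⟩ := (Submodule.mem_span_range_iff_exists_fun ℝ).1
      (minor_mem_span_familyProducts g H hH (intCols b) I)
    have hc' : ∀ x, ((H x * intCols b).submatrix I id).det =
        ∑ i, Sum.elim (fun _ => 0) c i * Sum.elim g (familyProducts g n) i x := by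
      intro x
      have := congrFun hc x
      simp only [Finset.sum_apply, Pi.smul_apply, smul_eq_mul] at this
      rw [← this]
      rw [Fintype.sum_sum_type]
      simp only [Sum.elim_inl, Sum.elim_inr, zero_mul, Finset.sum_const_zero, zero_add]
      rfl
    have h3 := hη' (Sum.elim (fun _ => 0) c) α β hαβ hsub z hz
    refine (measure_mono ?_).trans h3
    intro x hx
    refine ⟨hx.1, ?_⟩
    rw [← hc', ← hc']
    refine hx.2.trans_le ?_
    exact mul_le_mul_of_nonneg_right (min_le_left _ _) (abs_nonneg _)
  · intro j b hb
    obtain ⟨x, hx, h⟩ := hlow j b hb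
    exact ⟨x, hx, (min_le_left _ _).trans h⟩
  · refine ENNReal.ofReal_le_ofReal ?_
    rw [hθ]
    have : markedConst n * (δ / ((markedConst n + 1) * r)) * r =
        δ * (markedConst n / (markedConst n + 1)) := by
      field_simp
    rw [← hn, this]
    refine mul_le_of_le_one_right hδ.le ?_
    rw [div_le_one (by positivity)]
    linarith

theorem exists_rows_det_ne_zero {K : Type*} [Field K] {R : Type*} [Finite R] {j : ℕ}
    (A : Matrix R (Fin j) K)
    (hA : LinearIndependent K A.col) (X : Set R) :
    ∃ I : Fin j → R, (A.submatrix I id).det ≠ 0 ∧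
      Module.finrank K (Submodule.span K (A.row '' X)) ≤ Nat.card {a // I a ∈ X} := by
  classical
  have := Fintype.ofFinite R
  obtain ⟨s, hsX, -, hs, hsl⟩ := exists_linearIndepOn_extension (K := K) (v := A.row)
    (linearIndepOn_empty _ _) (Set.empty_subset X)
  obtain ⟨t, -, hst, ht, htl⟩ := exists_linearIndepOn_extension (K := K) (v := A.row)
    hsl (Set.subset_univ s)
  have hspan : Submodule.span K (A.row '' t) = ⊤ := by
    have h1 : Module.finrank K (Submodule.span K (Set.range A.row)) = j := by
      rw [← Matrix.rank_eq_finrank_span_row, Matrix.rank_eq_finrank_span_cols,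
        finrank_span_eq_card hA, Fintype.card_fin]
    have h2 : Submodule.span K (Set.range A.row) = ⊤ :=
      Submodule.eq_top_of_finrank_eq (by rw [h1]; simp)
    rw [eq_top_iff, ← h2, Submodule.span_le, ← Set.image_univ]
    exact ht
  have hcard : Fintype.card t = j := by
    have := finrank_span_eq_card htl
    rw [← Set.image_eq_range, hspan] at this
    simpa using this.symm
  let eqv : Fin j ≃ t := (Fintype.equivFinOfCardEq hcard).symm
  refine ⟨fun a => (eqv a : R), ?_, ?_⟩
  · have hli : LinearIndependent K (A.submatrix (fun a => (eqv a : R)) id).row :=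
      (linearIndependent_equiv eqv).2 htl
    have := Matrix.linearIndependent_rows_iff_isUnit.1 hli
    exact ((Matrix.isUnit_iff_isUnit_det _).1 this).ne_zero
  · have h1 : Module.finrank K (Submodule.span K (A.row '' X)) ≤ Nat.card s := by
      have h2 : Submodule.span K (A.row '' X) ≤ Submodule.span K (A.row '' s) :=
        Submodule.span_le.2 hs
      refine (Submodule.finrank_mono h2).trans ?_
      have := finrank_span_eq_card hsl
      rw [← Set.image_eq_range] at this
      rw [this, Nat.card_eq_fintype_card]
    refine h1.trans (Nat.card_le_card_of_injective
      (fun x : s => (⟨eqv.symm ⟨x, hst x.2⟩, by simpa using hsX x.2⟩ :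
        {a // (eqv a : R) ∈ X})) ?_)
    intro x y hxy
    simpa [Subtype.ext_iff] using hxy

theorem exists_rows_intCols_det_ne_zero {ι : Type*} [Fintype ι] {j : ℕ} {b : Fin j → ι → ℤ}
    (hb : LinearIndependent ℤ b) : ∃ I : Fin j → ι, ((intCols b).submatrix I id).det ≠ 0 := by
  have h1 := linearIndependent_intVecToRat hb
  obtain ⟨I, hI, -⟩ := exists_rows_det_ne_zero (Matrix.of fun (i : ι) (l : Fin j) => (b l i : ℚ))
    h1 ∅
  refine ⟨I, ?_⟩
  have h2 : ((intCols b).submatrix I id) =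
      ((Matrix.of fun (i : ι) (l : Fin j) => (b l i : ℚ)).submatrix I id).map (Rat.castHom ℝ) := by
    ext i l
    simp [intCols]
  rw [h2, ← RingHom.mapMatrix_apply, ← RingHom.map_det]
  simpa using hI

theorem one_le_abs_det_intCols {ι : Type*} {j : ℕ} {b : Fin j → ι → ℤ} {I : Fin j → ι}
    (h : ((intCols b).submatrix I id).det ≠ 0) : 1 ≤ |((intCols b).submatrix I id).det| := by
  have h2 : ((intCols b).submatrix I id) =
      ((Matrix.of fun (i : ι) (l : Fin j) => b l i).submatrix I id).map (Int.castRingHom ℝ) := by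
    ext i l
    simp [intCols]
  rw [h2, ← RingHom.mapMatrix_apply, ← RingHom.map_det] at h ⊢
  simp only [eq_intCast] at h ⊢
  exact_mod_cast Int.one_le_abs (by exact_mod_cast h)

/-- An integral frame is a matrix from a fixed compact set times a matrix of determinant at least
one. -/
theorem exists_bounded_factor {ι : Type*} [Fintype ι] {j : ℕ} {b : Fin j → ι → ℤ}
    (hb : LinearIndependent ℤ b) : ∃ (I : Fin j → ι) (Q : Matrix ι (Fin j) ℝ)
      (T : Matrix (Fin j) (Fin j) ℝ), Q.submatrix I id = 1 ∧ (∀ i l, |Q i l| ≤ 1) ∧ 1 ≤ |T.det| ∧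
      intCols b = Q * T := by
  classical
  obtain ⟨I1, hI1⟩ := exists_rows_intCols_det_ne_zero hb
  obtain ⟨I, -, hI⟩ := Finset.exists_max_image (Finset.univ : Finset (Fin j → ι))
    (fun I => |((intCols b).submatrix I id).det|) ⟨I1, Finset.mem_univ _⟩
  have hI0 : ((intCols b).submatrix I id).det ≠ 0 := by
    have := hI I1 (Finset.mem_univ _)
    have h1 := abs_pos.2 hI1
    exact abs_pos.1 (h1.trans_le this)
  set T := (intCols b).submatrix I id with hT
  have hu : IsUnit T.det := hI0.isUnit
  refine ⟨I, intCols b * T⁻¹, T, ?_, ?_, one_le_abs_det_intCols hI0, ?_⟩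
  · have : (intCols b * T⁻¹).submatrix I id = T * T⁻¹ := by
      ext; simp [hT, Matrix.mul_apply]
    rw [this, Matrix.mul_nonsing_inv _ hu]
  · intro i l
    have h1 : (intCols b * T⁻¹) i l = T.det⁻¹ *
        ((intCols b).submatrix (Function.update I l i) id).det := by
      have h2 : ((intCols b).submatrix (Function.update I l i) id) =
          T.updateRow l (intCols b i) := by
        ext a c
        by_cases h : a = l
        · subst h; simp
        · simp [h, hT]
      rw [h2, ← Matrix.cramer_transpose_apply, Matrix.cramer_eq_adjugate_mulVec,
        ← Matrix.adjugate_transpose, Matrix.mulVec_transpose, Matrix.inv_def, Matrix.mul_smul,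
        Matrix.smul_apply, Ring.inverse_eq_inv', smul_eq_mul]
      rfl
    rw [h1, abs_mul, abs_inv, inv_mul_le_iff₀ (abs_pos.2 hI0), mul_one]
    exact hI _ (Finset.mem_univ _)
  · rw [Matrix.mul_assoc, Matrix.nonsing_inv_mul _ hu, Matrix.mul_one]

theorem exists_uniform_minor_bound {R ι : Type*} [Fintype ι] {j : ℕ} (U : Set ℝ)
    (H : ℝ → Matrix R ι ℝ) (good : (Fin j → R) → Prop)
    (hproper : ∀ B : Matrix ι (Fin j) ℝ, LinearIndependent ℝ B.col → ∃ s ∈ U, ∃ I, good I ∧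
      ((H s * B).submatrix I id).det ≠ 0) :
    ∃ c > 0, ∀ b : Fin j → ι → ℤ, LinearIndependent ℤ b → ∃ s ∈ U, ∃ I, good I ∧
      c ≤ |((H s * intCols b).submatrix I id).det| := by
  classical
  set K : Set (Matrix ι (Fin j) ℝ) :=
    (⋃ I : Fin j → ι, {Q | Q.submatrix I id = 1}) ∩ {Q | ∀ i l, Q i l ∈ Set.Icc (-1 : ℝ) 1} with hK
  have hKc : IsCompact K := by
    refine IsCompact.inter_left ?_ (isClosed_iUnion_of_finite fun I => ?_)
    · have := isCompact_univ_pi (X := fun _ : ι => Fin j → ℝ) fun i =>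
        isCompact_univ_pi (X := fun _ : Fin j => ℝ) fun l => isCompact_Icc (a := (-1 : ℝ)) (b := 1)
      have h2 : {Q : Matrix ι (Fin j) ℝ | ∀ i l, Q i l ∈ Set.Icc (-1 : ℝ) 1} =
          Set.univ.pi fun _ : ι => Set.univ.pi fun _ : Fin j => Set.Icc (-1 : ℝ) 1 :=
        Set.ext fun Q => ⟨fun h i _ l _ => h i l, fun h i l => h i trivial l trivial⟩
      rw [h2]
      exact this
    · exact isClosed_eq (continuous_id.matrix_submatrix _ _) continuous_const
  have hmain : ∃ c > 0, ∀ Q ∈ K, ∃ s ∈ U, ∃ I, good I ∧ c ≤ |((H s * Q).submatrix I id).det| := by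
    refine hKc.induction_on (p := fun S => ∃ c > 0, ∀ Q ∈ S, ∃ s ∈ U, ∃ I, good I ∧
      c ≤ |((H s * Q).submatrix I id).det|) ⟨1, one_pos, by simp⟩ ?_ ?_ ?_
    · rintro S S' hSS ⟨c, hc, h⟩
      exact ⟨c, hc, fun Q hQ => h Q (hSS hQ)⟩
    · rintro S S' ⟨c, hc, h⟩ ⟨c', hc', h'⟩
      refine ⟨min c c', lt_min hc hc', ?_⟩
      rintro Q (hQ | hQ)
      · obtain ⟨s, hs, I, hI, h1⟩ := h Q hQ
        exact ⟨s, hs, I, hI, (min_le_left _ _).trans h1⟩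
      · obtain ⟨s, hs, I, hI, h1⟩ := h' Q hQ
        exact ⟨s, hs, I, hI, (min_le_right _ _).trans h1⟩
    · intro Q hQ
      obtain ⟨I0, hI0⟩ := Set.mem_iUnion.1 hQ.1
      have hli : LinearIndependent ℝ Q.col := by
        have h1 : LinearIndependent ℝ (Q.submatrix I0 id).col := by
          rw [Matrix.linearIndependent_cols_iff_isUnit]
          rw [show Q.submatrix I0 id = 1 from hI0]
          exact isUnit_one
        exact LinearIndependent.of_comp (LinearMap.funLeft ℝ ℝ I0) h1
      obtain ⟨s, hs, I, hI, h1⟩ := hproper Q hli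
      have hcont : Continuous fun Q : Matrix ι (Fin j) ℝ => |((H s * Q).submatrix I id).det| :=
        ((continuous_const.matrix_mul continuous_id).matrix_submatrix _ _).matrix_det.abs
      have h2 := abs_pos.2 h1
      refine ⟨{Q' | |((H s * Q).submatrix I id).det| / 2 < |((H s * Q').submatrix I id).det|},
        mem_nhdsWithin_of_mem_nhds ((isOpen_lt continuous_const hcont).mem_nhds (half_lt_self h2)),
        _, half_pos h2, fun Q' hQ' => ⟨s, hs, I, hI, le_of_lt hQ'⟩⟩
  obtain ⟨c, hc, h⟩ := hmain
  refine ⟨c, hc, fun b hb => ?_⟩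
  obtain ⟨I0, Q, T, hQ1, hQ2, hT, hbQ⟩ := exists_bounded_factor hb
  obtain ⟨s, hs, I, hI, h1⟩ := h Q ⟨Set.mem_iUnion.2 ⟨I0, hQ1⟩, fun i l => abs_le.1 (hQ2 i l)⟩
  refine ⟨s, hs, I, hI, ?_⟩
  have h3 : (H s * intCols b).submatrix I id = (H s * Q).submatrix I id * T := by
    rw [hbQ, ← Matrix.mul_assoc]
    rfl
  rw [h3, Matrix.det_mul, abs_mul]
  nlinarith [abs_nonneg ((H s * Q).submatrix I id).det]

theorem abs_det_le_minorSum {R : Type*} [Fintype R] {j : ℕ} (A : Matrix R (Fin j) ℝ)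
    (I : Fin j → R) : |(A.submatrix I id).det| ≤ minorSum A :=
  Finset.single_le_sum (f := fun I : Fin j → R => |(A.submatrix I id).det|)
    (fun _ _ => abs_nonneg _) (Finset.mem_univ I)

theorem det_submatrix_scaled {R ι : Type*} [Fintype ι] {j : ℕ} (d : R → ℝ) (A : Matrix R ι ℝ)
    (B : Matrix ι (Fin j) ℝ) (I : Fin j → R) :
    (((Matrix.of fun i l => d i * A i l) * B).submatrix I id).det =
      (∏ a, d (I a)) * ((A * B).submatrix I id).det := by
  have : ((Matrix.of fun i l => d i * A i l) * B).submatrix I id =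
      Matrix.of fun a l => d (I a) * ((A * B).submatrix I id) a l := by
    ext a l
    simp [Matrix.mul_apply, Finset.mul_sum, mul_assoc]
  rw [this, Matrix.det_mul_column]

theorem exists_equiv_rows_intCols {ι : Type*} [Fintype ι] {j : ℕ} {b : Fin j → ι → ℤ}
    (hb : LinearIndependent ℤ b) (hj : j = Fintype.card ι) :
    ∃ I : Fin j ≃ ι, 1 ≤ |((intCols b).submatrix I id).det| := by
  classical
  obtain ⟨I, hI⟩ := exists_rows_intCols_det_ne_zero hb
  have hinj : Function.Injective I := by
    intro p q hpq
    by_contra hne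
    exact hI (Matrix.det_zero_of_row_eq hne (by ext a; simp [hpq]))
  have hbij : Function.Bijective I :=
    (Fintype.bijective_iff_injective_and_card I).2 ⟨hinj, by simp [hj]⟩
  exact ⟨Equiv.ofBijective I hbij, one_le_abs_det_intCols hI⟩

theorem abs_det_le_minorSum_intCols {ι : Type*} [Fintype ι] [DecidableEq ι] {j : ℕ}
    {b : Fin j → ι → ℤ} (hb : LinearIndependent ℤ b) (hj : j = Fintype.card ι)
    (H : Matrix ι ι ℝ) : |H.det| ≤ minorSum (H * intCols b) := by
  obtain ⟨I, hI⟩ := exists_equiv_rows_intCols hb hj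
  refine le_trans ?_ (abs_det_le_minorSum _ I)
  have h1 : (H * intCols b).submatrix I id = H.submatrix I I * (intCols b).submatrix I id := by
    rw [Matrix.submatrix_mul_equiv]
  rw [h1, Matrix.det_mul, Matrix.det_submatrix_equiv_self, abs_mul]
  exact le_mul_of_one_le_right (abs_nonneg _) hI

theorem exists_radius_curve_volume_le {ι : Type*} [Fintype ι] [DecidableEq ι]
    (H0 : ℝ → Matrix ι ι ℝ) (s0 : ℝ) (hH : ∀ i l, AnalyticAt ℝ (fun s => H0 s i l) s0)
    (hdet : (H0 s0).det ≠ 0) (e : ι → ℤ) (he : ∑ i, e i = 0)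
    (hproper : ∀ j, 0 < j → j < Fintype.card ι → ∀ B : Matrix ι (Fin j) ℝ,
      LinearIndependent ℝ B.col → ∀ r > 0, ∃ s ∈ Metric.closedBall s0 r, ∃ I : Fin j → ι,
        0 < ∑ a, e (I a) ∧ ((H0 s * B).submatrix I id).det ≠ 0) :
    ∃ r0 > 0, ∀ r > 0, r ≤ r0 → ∀ δ > 0, ∃ ε > 0, ∀ κ : ι → ℝ, (∀ i, 0 < κ i) → ∏ i, κ i = 1 →
      ∀ᶠ N : ℕ in Filter.atTop, volume {x ∈ Metric.closedBall s0 r | ∃ w : ι → ℤ, w ≠ 0 ∧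
        ∀ i, |κ i * (N : ℝ) ^ e i * ∑ l, H0 x i l * (w l : ℝ)| ≤ ε} ≤ ENNReal.ofReal δ := by
  obtain ⟨r0, hr0, -, hmain⟩ := exists_radius_volume_short_vectors_le ι ι
    (fun (p : ι × ι) s => H0 s p.1 p.2) s0 fun p => hH _ _
  refine ⟨r0, hr0, fun r hr hrr δ hδ => ?_⟩
  obtain ⟨ε, hε, h⟩ := hmain r hr hrr δ hδ (min 1 |(H0 s0).det|) (lt_min one_pos (abs_pos.2 hdet))
  refine ⟨ε, hε, fun κ hκ hκ1 => ?_⟩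
  have hc : ∀ j, j + 1 < Fintype.card ι → ∃ c > 0, ∀ b : Fin (j + 1) → ι → ℤ,
      LinearIndependent ℤ b → ∃ s ∈ Metric.closedBall s0 r, ∃ I : Fin (j + 1) → ι,
        0 < ∑ a, e (I a) ∧ c ≤ |((H0 s * intCols b).submatrix I id).det| := fun j hj =>
    exists_uniform_minor_bound _ H0 _ fun B hB => hproper (j + 1) j.succ_pos hj B hB r hr
  choose! c hc0 hc using hc
  have hκm : ∃ m > 0, m ≤ 1 ∧ ∀ i, m ≤ κ i := by
    by_cases hne : Nonempty ι
    · obtain ⟨i, hi⟩ := Finite.exists_min κ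
      exact ⟨min 1 (κ i), lt_min one_pos (hκ i), min_le_left _ _,
        fun l => (min_le_right _ _).trans (hi l)⟩
    · exact ⟨1, one_pos, le_rfl, fun i => (hne ⟨i⟩).elim⟩
  obtain ⟨m, hm0, hm1, hm⟩ := hκm
  have hN : ∀ᶠ N : ℕ in Filter.atTop, ∀ j ∈ Finset.range (Fintype.card ι), j + 1 < Fintype.card ι →
      1 ≤ N * (m ^ (j + 1) * c j) := by
    rw [Filter.eventually_all_finset]
    intro j _
    by_cases hj : j + 1 < Fintype.card ι
    · have h1 : 0 < m ^ (j + 1) * c j := mul_pos (pow_pos hm0 _) (hc0 j hj)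
      filter_upwards [(tendsto_natCast_atTop_atTop.atTop_mul_const h1).eventually_ge_atTop 1]
        with N hN _ using hN
    · exact Filter.Eventually.of_forall fun N h => (hj h).elim
  filter_upwards [hN, Filter.eventually_ge_atTop 1] with N hN hN1
  have hN0 : (0 : ℝ) < N := by exact_mod_cast hN1
  have hN1' : (1 : ℝ) ≤ N := by exact_mod_cast hN1
  set d : ι → ℝ := fun i => κ i * (N : ℝ) ^ e i with hd
  have h1 := h (fun x => Matrix.of fun i l => d i * H0 x i l) ?_ ?_
  · refine (measure_mono ?_).trans h1
    rintro x ⟨hx, w, hw, hwi⟩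
    refine ⟨hx, w, hw, fun i => ?_⟩
    have := hwi i
    simpa only [Matrix.of_apply, mul_assoc, hd, Finset.mul_sum] using this
  · intro i l
    exact Submodule.smul_mem _ (d i) (Submodule.subset_span ⟨(i, l), rfl⟩)
  · intro j b hb
    rcases lt_trichotomy (j + 1) (Fintype.card ι) with hj | hj | hj
    · obtain ⟨s, hs, I, hI, hI'⟩ := hc j hj b hb
      refine ⟨s, hs, (min_le_left _ _).trans (le_trans ?_ (abs_det_le_minorSum _ I))⟩
      rw [det_submatrix_scaled, abs_mul]
      have h2 : (N : ℝ) * m ^ (j + 1) ≤ |∏ a, d (I a)| := by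
        have : ∏ a, d (I a) = (∏ a, κ (I a)) * (N : ℝ) ^ (∑ a, e (I a)) := by
          rw [hd, Finset.prod_mul_distrib]
          congr 1
          have : ∀ (s : Finset (Fin (j + 1))), ∏ a ∈ s, (N : ℝ) ^ e (I a) =
              (N : ℝ) ^ (∑ a ∈ s, e (I a)) := by
            intro s
            induction s using Finset.cons_induction with
            | empty => simp
            | cons a s ha ih => rw [Finset.prod_cons, Finset.sum_cons, ih, zpow_add₀ hN0.ne']
          exact this _
        rw [this, abs_of_pos (mul_pos (Finset.prod_pos fun a _ => hκ _) (zpow_pos hN0 _)), mul_comm]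
        refine mul_le_mul ?_ ?_ hN0.le (Finset.prod_nonneg fun a _ => (hκ _).le)
        · calc m ^ (j + 1) = ∏ _a : Fin (j + 1), m := by simp
            _ ≤ _ := Finset.prod_le_prod (fun _ _ => hm0.le) fun a _ => hm _
        · calc (N : ℝ) = (N : ℝ) ^ (1 : ℤ) := (zpow_one _).symm
            _ ≤ _ := zpow_le_zpow_right₀ hN1' (by omega)
      calc (1 : ℝ) ≤ N * (m ^ (j + 1) * c j) := hN j (by simp; omega) hj
        _ = (N * m ^ (j + 1)) * c j := by ring
        _ ≤ _ := mul_le_mul h2 hI' (hc0 j hj).le (abs_nonneg _)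
    · refine ⟨s0, Metric.mem_closedBall_self hr.le, ?_⟩
      refine (min_le_right _ _).trans (le_trans (le_of_eq ?_) (abs_det_le_minorSum_intCols hb hj _))
      rw [Matrix.det_mul_column]
      have : ∏ i, d i = 1 := by
        rw [hd, Finset.prod_mul_distrib, hκ1, one_mul]
        have : ∀ (s : Finset ι), ∏ a ∈ s, (N : ℝ) ^ e a = (N : ℝ) ^ (∑ a ∈ s, e a) := by
          intro s
          induction s using Finset.cons_induction with
          | empty => simp
          | cons a s ha ih => rw [Finset.prod_cons, Finset.sum_cons, ih, zpow_add₀ hN0.ne']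
        rw [this, he, zpow_zero]
      rw [this, one_mul]
    · have := hb.fintype_card_le_finrank
      simp only [Fintype.card_fin, Module.finrank_fintype_fun_eq_card] at this
      omega

theorem finrank_eq_finrank_map_add {V V₂ : Type*} [AddCommGroup V] [Module ℝ V] [AddCommGroup V₂]
    [Module ℝ V₂] [FiniteDimensional ℝ V] (f : V →ₗ[ℝ] V₂) (Ξ : Submodule ℝ V) :
    Module.finrank ℝ Ξ = Module.finrank ℝ (Ξ.map f) +
      Module.finrank ℝ (Ξ ⊓ LinearMap.ker f : Submodule ℝ V) := by
  have := LinearMap.finrank_range_add_finrank_ker (f.domRestrict Ξ)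
  rw [← this, LinearMap.range_domRestrict]
  congr 1
  rw [← Submodule.finrank_map_subtype_eq Ξ, LinearMap.ker_domRestrict,
    Submodule.map_comap_subtype]

/-- A generic contraction of a space of alternating forms is large. -/
theorem exists_generic_contraction {E : Type*} [AddCommGroup E] [Module ℝ E]
    [FiniteDimensional ℝ E] (n : ℕ) : ∀ (X : Submodule ℝ E) (Θ : Submodule ℝ (E →ₗ[ℝ] E →ₗ[ℝ] ℝ))
    (S : Set E), Module.finrank ℝ E = Module.finrank ℝ X + n →
    (∀ B ∈ Θ, ∀ x, B x x = 0) → (∀ B ∈ Θ, ∀ x ∈ X, B x = 0) →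
    (∀ T : Finset (Submodule ℝ E), (∀ W ∈ T, W ≠ ⊤) → ∃ x ∈ S, ∀ W ∈ T, x ∉ W) →
    ∃ x ∈ S, Module.finrank ℝ Θ = 0 ∨
      (2 * Module.finrank ℝ Θ ≤ n * Module.finrank ℝ (Θ.map (LinearMap.applyₗ x)) ∧
      2 * Module.finrank ℝ Θ + n ≤ (n + 1) * Module.finrank ℝ (Θ.map (LinearMap.applyₗ x)) + 1) := by
  classical
  induction n with
  | zero =>
    intro X Θ S hX hΘ hΘX hS
    obtain ⟨x, hx, -⟩ := hS ∅ (by simp)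
    have hXt : X = ⊤ := Submodule.eq_top_of_finrank_eq (by omega)
    have : Θ = ⊥ := by
      rw [eq_bot_iff]
      intro B hB
      refine (Submodule.mem_bot ℝ).2 (LinearMap.ext fun y => hΘX B hB y (hXt ▸ trivial))
    exact ⟨x, hx, Or.inl (by rw [this]; exact finrank_bot ℝ _)⟩
  | succ n ih =>
    intro X Θ S hX hΘ hΘX hS
    have hskew : ∀ B ∈ Θ, ∀ x y, B x y = - B y x := by
      intro B hB x y
      have := hΘ B hB (x + y)
      simp only [map_add, LinearMap.add_apply, hΘ B hB x, hΘ B hB y] at this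
      linarith
    set f : E → ℕ := fun x => Module.finrank ℝ (Θ.map (LinearMap.applyₗ x)) with hf
    have hfb : ∀ x, f x ≤ Module.finrank ℝ (E →ₗ[ℝ] ℝ) := fun x => Submodule.finrank_le _
    obtain ⟨x0, hx0, -⟩ := hS ∅ (by simp)
    obtain ⟨x, hxS, hmax⟩ : ∃ x ∈ S, ∀ y ∈ S, f y ≤ f x := by
      have hb : BddAbove (f '' S) := ⟨_, by rintro _ ⟨y, _, rfl⟩; exact hfb y⟩
      obtain ⟨x, hx, h⟩ := Nat.sSup_mem (s := f '' S) ⟨f x0, x0, hx0, rfl⟩ hb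
      exact ⟨x, hx, fun y hy => h ▸ le_csSup hb ⟨y, hy, rfl⟩⟩
    rcases Nat.eq_zero_or_pos (f x) with h0 | hpos
    · refine ⟨x, hxS, Or.inl ?_⟩
      have hBS : ∀ B ∈ Θ, ∀ y ∈ S, B y = 0 := by
        intro B hB y hy
        have h1 : f y = 0 := Nat.le_zero.1 (h0 ▸ hmax y hy)
        have h2 : Θ.map (LinearMap.applyₗ (R := ℝ) (M₂ := E →ₗ[ℝ] ℝ) y) = ⊥ :=
          Submodule.finrank_eq_zero.1 h1
        have h3 : B y ∈ Θ.map (LinearMap.applyₗ (R := ℝ) (M₂ := E →ₗ[ℝ] ℝ) y) := ⟨B, hB, rfl⟩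
        rw [h2] at h3
        exact (Submodule.mem_bot ℝ).1 h3
      have : Θ = ⊥ := by
        rw [eq_bot_iff]
        intro B hB
        by_contra hne
        obtain ⟨y, hy, hyW⟩ := hS {LinearMap.ker B} (by
          intro W hW
          rw [Finset.mem_singleton] at hW
          rw [hW]
          exact fun h => hne ((Submodule.mem_bot ℝ).2 (LinearMap.ker_eq_top.1 h)))
        exact hyW _ (Finset.mem_singleton_self _) (hBS B hB y hy)
      rw [this]
      exact finrank_bot ℝ _
    · have hxX : x ∉ X := by
        intro hx
        have : Θ.map (LinearMap.applyₗ (R := ℝ) (M₂ := E →ₗ[ℝ] ℝ) x) = ⊥ := by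
          rw [eq_bot_iff]
          rintro _ ⟨B, hB, rfl⟩
          exact (Submodule.mem_bot ℝ).2 (hΘX B hB x hx)
        have h2 : f x = 0 := by
          change Module.finrank ℝ (Θ.map (LinearMap.applyₗ (R := ℝ) (M₂ := E →ₗ[ℝ] ℝ) x)) = 0
          rw [this]; exact finrank_bot ℝ _
        omega
      set X' := X ⊔ Submodule.span ℝ {x} with hX'
      have hx'ne : x ≠ 0 := fun h => hxX (h ▸ X.zero_mem)
      have hXf : Module.finrank ℝ X' = Module.finrank ℝ X + 1 := by
        have h1 := Submodule.finrank_sup_add_finrank_inf_eq X (Submodule.span ℝ {x})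
        have h2 : X ⊓ Submodule.span ℝ {x} = ⊥ := by
          rw [eq_bot_iff]
          rintro y ⟨hy1, hy2⟩
          obtain ⟨c, rfl⟩ := Submodule.mem_span_singleton.1 hy2
          by_cases hc : c = 0
          · simp [hc]
          · exact (hxX ((Submodule.smul_mem_iff _ hc).1 hy1)).elim
        rw [h2, finrank_bot, finrank_span_singleton hx'ne] at h1
        omega
      set Kx : Submodule ℝ (E →ₗ[ℝ] E →ₗ[ℝ] ℝ) :=
        Θ ⊓ LinearMap.ker (LinearMap.applyₗ (R := ℝ) (M₂ := E →ₗ[ℝ] ℝ) x) with hKx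
      have hKx0 : ∀ B ∈ Kx, B x = 0 := fun B hB => hB.2
      have hfx_le : f x ≤ n := by
        have h1 : Θ.map (LinearMap.applyₗ (R := ℝ) (M₂ := E →ₗ[ℝ] ℝ) x) ≤
            X'.dualAnnihilator := by
          rintro _ ⟨B, hB, rfl⟩
          rw [Submodule.mem_dualAnnihilator]
          have : X' ≤ LinearMap.ker (B x) := by
            refine sup_le (fun y hy => ?_) ?_
            · rw [LinearMap.mem_ker, hskew B hB, hΘX B hB y hy]; simp
            · rw [Submodule.span_singleton_le_iff_mem]
              exact hΘ B hB x
          exact fun y hy => this hy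
        have h2 := Submodule.finrank_mono h1
        have h3 := Subspace.finrank_add_finrank_dualAnnihilator_eq X'
        have h4 : Module.finrank ℝ X'.dualAnnihilator = n := by omega
        exact h2.trans h4.le
      obtain ⟨B0, hB0, hB0x⟩ : ∃ B ∈ Θ, B x ≠ 0 := by
        by_contra hcon
        push Not at hcon
        have : Θ.map (LinearMap.applyₗ (R := ℝ) (M₂ := E →ₗ[ℝ] ℝ) x) = ⊥ := by
          rw [eq_bot_iff]
          rintro _ ⟨B, hB, rfl⟩
          exact (Submodule.mem_bot ℝ).2 (hcon B hB)
        have h2 : f x = 0 := by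
          change Module.finrank ℝ (Θ.map (LinearMap.applyₗ (R := ℝ) (M₂ := E →ₗ[ℝ] ℝ) x)) = 0
          rw [this]; exact finrank_bot ℝ _
        omega
      obtain ⟨y, ⟨hyS, hyB⟩, hy⟩ := ih X' Kx (S \ LinearMap.ker (B0 x)) (by omega)
        (fun B hB => hΘ B hB.1) (by
          intro B hB
          have : X' ≤ LinearMap.ker B := by
            refine sup_le (fun y hy => hΘX B hB.1 y hy) ?_
            rw [Submodule.span_singleton_le_iff_mem]
            exact hKx0 B hB
          exact fun y hy => this hy) (by
          intro T hT
          obtain ⟨y, hy, hyT⟩ := hS (insert (LinearMap.ker (B0 x)) T) (by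
            intro W hW
            rcases Finset.mem_insert.1 hW with rfl | hW
            · exact fun h => hB0x (LinearMap.ker_eq_top.1 h)
            · exact hT W hW)
          exact ⟨y, ⟨hy, hyT _ (Finset.mem_insert_self _ _)⟩,
            fun W hW => hyT W (Finset.mem_insert_of_mem hW)⟩)
      have hlt : Module.finrank ℝ (Kx.map (LinearMap.applyₗ (R := ℝ) (M₂ := E →ₗ[ℝ] ℝ) y)) <
          f y := by
        refine Submodule.finrank_lt_finrank_of_lt (lt_of_le_of_ne
          (Submodule.map_mono inf_le_left) fun heq => ?_)
        have h1 : B0 y ∈ Θ.map (LinearMap.applyₗ (R := ℝ) (M₂ := E →ₗ[ℝ] ℝ) y) := ⟨B0, hB0, rfl⟩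
        rw [← heq] at h1
        obtain ⟨B, hB, hBy⟩ := h1
        have h2 : B y x = B0 y x := by
          rw [← hBy]; rfl
        rw [hskew B hB.1, hKx0 B hB, hskew B0 hB0] at h2
        simp only [LinearMap.zero_apply, neg_zero, zero_eq_neg] at h2
        exact hyB h2
      have hyx := hmax y hyS
      have hdim : Module.finrank ℝ Θ = f x + Module.finrank ℝ Kx :=
        finrank_eq_finrank_map_add (V := E →ₗ[ℝ] E →ₗ[ℝ] ℝ) (V₂ := E →ₗ[ℝ] ℝ)
          (LinearMap.applyₗ (R := ℝ) (M₂ := E →ₗ[ℝ] ℝ) x) Θ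
      refine ⟨x, hxS, Or.inr ?_⟩
      change 2 * Module.finrank ℝ Θ ≤ (n + 1) * f x ∧
        2 * Module.finrank ℝ Θ + (n + 1) ≤ (n + 1 + 1) * f x + 1
      rw [hdim]
      rcases hy with hy | ⟨hy, -⟩
      · rw [hy]
        constructor <;> nlinarith
      · constructor <;> nlinarith

/-- Increasing pairs of indices. -/
abbrev IdxPair (n : ℕ) := {p : Fin n × Fin n // p.1 < p.2}

theorem sum_idxPair {M : Type*} [AddCommMonoid M] {n : ℕ} (f : Fin n × Fin n → M) :
    ∑ p : IdxPair n, f p.1 = ∑ b, ∑ a ∈ Finset.Iio b, f (a, b) := by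
  rw [← Finset.sum_subtype (Finset.univ.filter fun p : Fin n × Fin n => p.1 < p.2) (by simp) f,
    Finset.sum_filter, Fintype.sum_prod_type, Finset.sum_comm]
  refine Finset.sum_congr rfl fun b _ => ?_
  rw [← Finset.sum_filter]
  refine Finset.sum_congr ?_ fun _ _ => rfl
  ext a
  simp

theorem two_mul_card_idxPair (n : ℕ) : 2 * Fintype.card (IdxPair n) = n * (n - 1) := by
  have h : Fintype.card (IdxPair n) = ∑ b : Fin n, (b : ℕ) := by
    rw [Fintype.card_eq_sum_ones, sum_idxPair (fun _ => 1)]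
    simp
  rw [h, Fin.sum_univ_eq_sum_range fun i => i, mul_comm, Finset.sum_range_id_mul_two]

/-- The second compound of a square matrix. -/
def compoundTwo {n : ℕ} (A : Matrix (Fin n) (Fin n) ℝ) : Matrix (IdxPair n) (IdxPair n) ℝ :=
  Matrix.of fun p q => A p.1.1 q.1.1 * A p.1.2 q.1.2 - A p.1.1 q.1.2 * A p.1.2 q.1.1

/-- The alternating form with given coordinates. -/
noncomputable def pairForm (n : ℕ) :
    (IdxPair n → ℝ) →ₗ[ℝ] ((Fin n → ℝ) →ₗ[ℝ] (Fin n → ℝ) →ₗ[ℝ] ℝ) :=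
  ∑ q : IdxPair n, (LinearMap.proj q : (IdxPair n → ℝ) →ₗ[ℝ] ℝ).smulRight
    ((LinearMap.proj q.1.1 : (Fin n → ℝ) →ₗ[ℝ] ℝ).smulRight
        (LinearMap.proj q.1.2 : (Fin n → ℝ) →ₗ[ℝ] ℝ) -
      (LinearMap.proj q.1.2 : (Fin n → ℝ) →ₗ[ℝ] ℝ).smulRight
        (LinearMap.proj q.1.1 : (Fin n → ℝ) →ₗ[ℝ] ℝ))

theorem pairForm_apply {n : ℕ} (w : IdxPair n → ℝ) (x y : Fin n → ℝ) :
    pairForm n w x y = ∑ q : IdxPair n, (x q.1.1 * y q.1.2 - x q.1.2 * y q.1.1) * w q := by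
  simp only [pairForm, LinearMap.sum_apply, LinearMap.smulRight_apply, LinearMap.proj_apply,
    LinearMap.smul_apply, LinearMap.sub_apply, smul_eq_mul]
  refine Finset.sum_congr rfl fun q _ => ?_
  ring

theorem compoundTwo_mulVec {n : ℕ} (A : Matrix (Fin n) (Fin n) ℝ) (w : IdxPair n → ℝ)
    (p : IdxPair n) : (compoundTwo A).mulVec w p = pairForm n w (A p.1.1) (A p.1.2) := by
  rw [pairForm_apply]
  rfl

theorem pairForm_self {n : ℕ} (w : IdxPair n → ℝ) (x : Fin n → ℝ) : pairForm n w x x = 0 := by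
  rw [pairForm_apply]
  exact Finset.sum_eq_zero fun q _ => by ring

theorem pairForm_swap {n : ℕ} (w : IdxPair n → ℝ) (x y : Fin n → ℝ) :
    pairForm n w x y = - pairForm n w y x := by
  rw [pairForm_apply, pairForm_apply, ← Finset.sum_neg_distrib]
  exact Finset.sum_congr rfl fun q _ => by ring

theorem pairForm_injective (n : ℕ) : Function.Injective (pairForm n) := by
  rw [injective_iff_map_eq_zero]
  intro w hw
  ext p
  have h := LinearMap.congr_fun (LinearMap.congr_fun hw (Pi.single p.1.1 1)) (Pi.single p.1.2 1)
  rw [pairForm_apply, Finset.sum_eq_single p] at h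
  · simpa [p.2.ne, p.2.ne'] using h
  · intro q _ hq
    have h1 : ¬ (q.1.1 = p.1.1 ∧ q.1.2 = p.1.2) := fun h => hq (Subtype.ext (Prod.ext h.1 h.2))
    have h2 : ¬ (q.1.2 = p.1.1 ∧ q.1.1 = p.1.2) := fun h => by
      have h3 := q.2
      rw [h.1, h.2] at h3
      exact lt_asymm h3 p.2
    simp only [Pi.single_apply, ← ite_and, ite_mul, one_mul, zero_mul, if_neg h1, if_neg h2, sub_self]
  · simp

theorem pairForm_eq_zero_of_rows {n : ℕ} {A : Matrix (Fin n) (Fin n) ℝ} (hA : A.det ≠ 0)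
    {w : IdxPair n → ℝ} (h : ∀ p : IdxPair n, pairForm n w (A p.1.1) (A p.1.2) = 0) : w = 0 := by
  have hli : LinearIndependent ℝ A.row :=
    Matrix.linearIndependent_rows_iff_isUnit.2 ((Matrix.isUnit_iff_isUnit_det _).2 hA.isUnit)
  rcases Nat.eq_zero_or_pos n with rfl | hn
  · ext p
    exact p.1.1.elim0
  have : Nonempty (Fin n) := ⟨⟨0, hn⟩⟩
  set bs := basisOfLinearIndependentOfCardEqFinrank hli (by simp) with hbs
  have hb : ∀ i, bs i = A i := fun i => by
    rw [hbs, coe_basisOfLinearIndependentOfCardEqFinrank]; rfl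
  refine pairForm_injective n ?_
  rw [map_zero]
  refine bs.ext fun i => bs.ext fun l => ?_
  rw [hb, hb]
  rcases lt_trichotomy i l with hil | hil | hil
  · exact h ⟨(i, l), hil⟩
  · rw [hil, pairForm_self]; rfl
  · rw [pairForm_swap, h ⟨(l, i), hil⟩]; simp

theorem det_compoundTwo_ne_zero {n : ℕ} {A : Matrix (Fin n) (Fin n) ℝ} (hA : A.det ≠ 0) :
    (compoundTwo A).det ≠ 0 := by
  intro h
  obtain ⟨w, hw, hw0⟩ := Matrix.exists_mulVec_eq_zero_iff.2 h
  refine hw (pairForm_eq_zero_of_rows hA fun p => ?_)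
  rw [← compoundTwo_mulVec, hw0]
  rfl

theorem eventually_forall_notMem_submodule {n : ℕ} {x : ℝ → Fin n → ℝ} {s0 : ℝ}
    (hgen : ∀ c : Fin n → ℝ, c ≠ 0 → ∀ᶠ s in nhdsWithin s0 {s0}ᶜ, ∑ i, c i * x s i ≠ 0)
    (T : Finset (Submodule ℝ (Fin n → ℝ))) (hT : ∀ W ∈ T, W ≠ ⊤) :
    ∀ᶠ s in nhdsWithin s0 {s0}ᶜ, ∀ W ∈ T, x s ∉ W := by
  rw [Filter.eventually_all_finset]
  intro W hW
  obtain ⟨f, hf, hWf⟩ := Submodule.exists_le_ker_of_lt_top W (hT W hW).lt_top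
  have h1 := hgen (fun i => f (Pi.single i 1)) (by
    intro h
    refine hf (LinearMap.ext fun y => ?_)
    rw [LinearMap.pi_apply_eq_sum_univ f y]
    refine Finset.sum_eq_zero fun i _ => ?_
    have h2 := congrFun h i
    simp only [Pi.zero_apply] at h2
    rw [show (fun j => if i = j then (1 : ℝ) else 0) = Pi.single i 1 from by
      ext j; simp [Pi.single_apply, eq_comm], h2, smul_zero])
  filter_upwards [h1] with s hs hsW
  apply hs
  have h2 : f (x s) = 0 := hWf hsW
  rw [LinearMap.pi_apply_eq_sum_univ f] at h2
  rw [← h2]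
  refine Finset.sum_congr rfl fun i _ => ?_
  rw [show (fun j => if i = j then (1 : ℝ) else 0) = Pi.single i 1 from by
      ext j; simp [Pi.single_apply, eq_comm], smul_eq_mul, mul_comm]

theorem linearIndependent_col_mul {R : Type*} [Fintype R] [DecidableEq R] {j : ℕ}
    {A : Matrix R R ℝ} (hA : A.det ≠ 0) {B : Matrix R (Fin j) ℝ} (hB : LinearIndependent ℝ B.col) :
    LinearIndependent ℝ (A * B).col := by
  have h : (A * B).col = Matrix.toLin' A ∘ B.col := by
    ext l i
    simp [Matrix.mul_apply, Matrix.mulVec, dotProduct]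
  rw [h]
  refine hB.map' _ (LinearMap.ker_eq_bot.2 ?_)
  have := Matrix.mulVec_injective_iff_isUnit.2 ((Matrix.isUnit_iff_isUnit_det _).2 hA.isUnit)
  exact this

theorem eventually_det_ne_zero {R : Type*} [Fintype R] [DecidableEq R] {A : ℝ → Matrix R R ℝ}
    {s0 : ℝ} (hA : ∀ i l, AnalyticAt ℝ (fun s => A s i l) s0) (hdet : (A s0).det ≠ 0) :
    ∀ᶠ s in nhds s0, (A s).det ≠ 0 := by
  have h1 : ContinuousAt A s0 := by
    exact continuousAt_pi.2 fun i => continuousAt_pi.2 fun l => (hA i l).continuousAt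
  have h2 : ContinuousAt (fun s => (A s).det) s0 :=
    (continuous_id.matrix_det.continuousAt (x := A s0)).comp h1
  exact h2.eventually_ne hdet

theorem sum_ite_eq_card {j : ℕ} (P : Fin j → Prop) [DecidablePred P] (x y : ℤ) :
    ∑ a, (if P a then x else y) = (x - y) * Nat.card {a // P a} + y * j := by
  rw [Finset.sum_ite, Nat.card_eq_fintype_card, Fintype.card_subtype]
  have := Finset.card_filter_add_card_filter_not (s := (Finset.univ : Finset (Fin j))) P
  simp only [Finset.card_univ, Fintype.card_fin] at this
  simp only [Finset.sum_const, nsmul_eq_mul]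
  have h2 : ((Finset.univ.filter fun a => ¬ P a).card : ℤ) =
    j - (Finset.univ.filter fun a => P a).card := by
    rw [eq_sub_iff_add_eq, add_comm]
    exact_mod_cast this
  rw [h2]
  ring

theorem exists_rows_frame {k : ℕ} {A : ℝ → Matrix (Fin (k + 1)) (Fin (k + 1)) ℝ} {s0 : ℝ}
    (hA : ∀ i l, AnalyticAt ℝ (fun s => A s i l) s0) (hdet : (A s0).det ≠ 0)
    (hgen : ∀ c : Fin (k + 1) → ℝ, c ≠ 0 →
      ∀ᶠ s in nhdsWithin s0 {s0}ᶜ, ∑ i, c i * A s 0 i ≠ 0)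
    {j : ℕ} (hj0 : 0 < j) (hj : j < k + 1) {B : Matrix (Fin (k + 1)) (Fin j) ℝ}
    (hB : LinearIndependent ℝ B.col) {r : ℝ} (hr : 0 < r) :
    ∃ s ∈ Metric.closedBall s0 r, ∃ I : Fin j → Fin (k + 1),
      0 < ∑ a, (if I a = 0 then (k : ℤ) else -1) ∧ ((A s * B).submatrix I id).det ≠ 0 := by
  have h1 := hgen (B.col ⟨0, hj0⟩) (hB.ne_zero _)
  have h2 := (eventually_det_ne_zero hA hdet).filter_mono (nhdsWithin_le_nhds (s := {s0}ᶜ))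
  have h3 : ∀ᶠ s in nhdsWithin s0 {s0}ᶜ, s ∈ Metric.closedBall s0 r :=
    nhdsWithin_le_nhds (Metric.closedBall_mem_nhds _ hr)
  obtain ⟨s, hs1, hs2, hs3⟩ := (h1.and (h2.and h3)).exists
  obtain ⟨I, hI, hc⟩ := exists_rows_det_ne_zero _ (linearIndependent_col_mul hs2 hB) {0}
  refine ⟨s, hs3, I, ?_, hI⟩
  rw [sum_ite_eq_card (fun a => I a = 0)]
  have h4 : (A s * B).row 0 ≠ 0 := by
    intro h
    apply hs1
    have := congrFun h ⟨0, hj0⟩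
    simp only [Matrix.row, Matrix.mul_apply, Pi.zero_apply] at this
    rw [← this]
    exact Finset.sum_congr rfl fun i _ => mul_comm _ _
  rw [Set.image_singleton, finrank_span_singleton h4] at hc
  have h5 : ((1 : ℕ) : ℤ) ≤ Nat.card {a // I a = 0} := by exact_mod_cast hc
  have h6 : (j : ℤ) < k + 1 := by exact_mod_cast hj
  have h7 : (0 : ℤ) ≤ k := by positivity
  push_cast at h5
  nlinarith

theorem finrank_contraction_le {n j : ℕ} {A : Matrix (Fin (n + 1)) (Fin (n + 1)) ℝ}
    (hA : A.det ≠ 0) (B : Matrix (IdxPair (n + 1)) (Fin j) ℝ) :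
    Module.finrank ℝ ((Submodule.span ℝ (Set.range fun l => pairForm (n + 1) (B.col l))).map
        (LinearMap.applyₗ (A 0))) ≤
      Module.finrank ℝ (Submodule.span ℝ ((compoundTwo A * B).row '' {p | p.1.1 = 0})) := by
  classical
  set X : Set (IdxPair (n + 1)) := {p | p.1.1 = 0}
  set Ψ : ((Fin (n + 1) → ℝ) →ₗ[ℝ] ℝ) →ₗ[ℝ] (X → ℝ) :=
    LinearMap.pi fun p => LinearMap.applyₗ (A p.1.1.2)
  set M := (compoundTwo A * B).submatrix (Subtype.val : X → _) id with hM
  have h1 : Module.finrank ℝ (Submodule.span ℝ ((compoundTwo A * B).row '' X)) = M.rank := by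
    rw [Matrix.rank_eq_finrank_span_row, Set.image_eq_range]
    rfl
  rw [h1, Matrix.rank_eq_finrank_span_cols, Submodule.map_span, ← Set.range_comp]
  have h2 : Set.range M.col = Ψ '' Set.range (LinearMap.applyₗ (A 0) ∘
      fun l => pairForm (n + 1) (B.col l)) := by
    rw [← Set.range_comp]
    congr 1
    ext l p
    have h3 : M.col l p = (compoundTwo A).mulVec (B.col l) p.1 := rfl
    rw [h3, compoundTwo_mulVec, show p.1.1.1 = 0 from p.2]
    rfl
  rw [h2, ← Submodule.map_span]
  refine le_of_eq ?_
  set Ξ : Submodule ℝ ((Fin (n + 1) → ℝ) →ₗ[ℝ] ℝ) := Submodule.span ℝ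
    (Set.range (LinearMap.applyₗ (A 0) ∘ fun l => pairForm (n + 1) (B.col l))) with hΞ
  have h4 : (Ξ ⊓ LinearMap.ker Ψ : Submodule ℝ ((Fin (n + 1) → ℝ) →ₗ[ℝ] ℝ)) = ⊥ := by
    rw [eq_bot_iff]
    rintro g ⟨hg1, hg2⟩
    have h5 : Ξ ≤ LinearMap.ker (LinearMap.applyₗ (R := ℝ) (M₂ := ℝ) (A 0)) := by
      rw [hΞ, Submodule.span_le]
      rintro _ ⟨l, rfl⟩
      exact pairForm_self _ _
    have hli : LinearIndependent ℝ A.row :=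
      Matrix.linearIndependent_rows_iff_isUnit.2 ((Matrix.isUnit_iff_isUnit_det _).2 hA.isUnit)
    set bs := basisOfLinearIndependentOfCardEqFinrank hli (by simp) with hbs
    have hb : ∀ i, bs i = A i := fun i => by
      rw [hbs, coe_basisOfLinearIndependentOfCardEqFinrank]; rfl
    refine (Submodule.mem_bot ℝ).2 (bs.ext fun i => ?_)
    rw [hb]
    rcases Fin.eq_zero_or_eq_succ i with rfl | ⟨a, rfl⟩
    · exact h5 hg1
    · exact congrFun (LinearMap.mem_ker.1 hg2) ⟨⟨(0, a.succ), Fin.succ_pos a⟩, rfl⟩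
  have h6 := finrank_eq_finrank_map_add Ψ Ξ
  rw [h4, finrank_bot, add_zero] at h6
  exact h6

theorem finrank_span_range_map {V V₂ ι : Type*} [AddCommGroup V] [Module ℝ V] [AddCommGroup V₂]
    [Module ℝ V₂] [Fintype ι] {f : V →ₗ[ℝ] V₂} (hf : Function.Injective f) {v : ι → V}
    (hv : LinearIndependent ℝ v) :
    Module.finrank ℝ (Submodule.span ℝ (Set.range fun l => f (v l))) = Fintype.card ι :=
  finrank_span_eq_card (hv.map' f (LinearMap.ker_eq_bot.2 hf))

theorem exists_rows_compoundTwo {k : ℕ} {A : ℝ → Matrix (Fin (k + 1)) (Fin (k + 1)) ℝ} {s0 : ℝ}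
    (hA : ∀ i l, AnalyticAt ℝ (fun s => A s i l) s0) (hdet : (A s0).det ≠ 0)
    (hgen : ∀ c : Fin (k + 1) → ℝ, c ≠ 0 →
      ∀ᶠ s in nhdsWithin s0 {s0}ᶜ, ∑ i, c i * A s 0 i ≠ 0)
    {j : ℕ} (hj0 : 0 < j) (hj : j < Fintype.card (IdxPair (k + 1)))
    {B : Matrix (IdxPair (k + 1)) (Fin j) ℝ}
    (hB : LinearIndependent ℝ B.col) {r : ℝ} (hr : 0 < r) :
    ∃ s ∈ Metric.closedBall s0 r, ∃ I : Fin j → IdxPair (k + 1),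
      0 < ∑ a, (if (I a).1.1 = 0 then (k : ℤ) - 1 else -2) ∧
        ((compoundTwo (A s) * B).submatrix I id).det ≠ 0 := by
  have h2 := (eventually_det_ne_zero hA hdet).filter_mono (nhdsWithin_le_nhds (s := {s0}ᶜ))
  have h3 : ∀ᶠ s in nhdsWithin s0 {s0}ᶜ, s ∈ Metric.closedBall s0 r :=
    nhdsWithin_le_nhds (Metric.closedBall_mem_nhds _ hr)
  set Θ := Submodule.span ℝ (Set.range fun l => pairForm (k + 1) (B.col l)) with hΘ
  have hΘj : Module.finrank ℝ Θ = j := by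
    have h4 := finrank_span_range_map
      (V₂ := (Fin (k + 1) → ℝ) →ₗ[ℝ] (Fin (k + 1) → ℝ) →ₗ[ℝ] ℝ) (pairForm_injective (k + 1)) hB
    rwa [Fintype.card_fin] at h4
  have halt : ∀ B' ∈ Θ, ∀ x, B' x x = 0 := by
    intro B' hB' x
    have h5 : Θ ≤ LinearMap.range (pairForm (k + 1)) := by
      rw [hΘ, Submodule.span_le]
      rintro _ ⟨l, rfl⟩
      exact LinearMap.mem_range_self _ _
    obtain ⟨w, hw⟩ := LinearMap.mem_range.1 (h5 hB')
    rw [← hw]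
    exact pairForm_self w x
  have hS : ∀ T : Finset (Submodule ℝ (Fin (k + 1) → ℝ)), (∀ W ∈ T, W ≠ ⊤) →
      ∃ x ∈ (fun s => A s 0) '' {s | (A s).det ≠ 0 ∧ s ∈ Metric.closedBall s0 r},
        ∀ W ∈ T, x ∉ W := by
    intro T hT
    have h1 := eventually_forall_notMem_submodule hgen T hT
    obtain ⟨s, hs1, hs2, hs3⟩ := (h1.and (h2.and h3)).exists
    exact ⟨A s 0, ⟨s, ⟨hs2, hs3⟩, rfl⟩, hs1⟩
  obtain ⟨x, hxS, hx⟩ := exists_generic_contraction (k + 1) ⊥ Θ _ (by simp) halt (by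
      intro B' _ x hx
      rw [(Submodule.mem_bot ℝ).1 hx, map_zero]) hS
  obtain ⟨s, ⟨hs1, hs2⟩, hsx⟩ := hxS
  rw [← hsx] at hx
  obtain ⟨I, hI, hc⟩ := exists_rows_det_ne_zero _
    (linearIndependent_col_mul (det_compoundTwo_ne_zero hs1) hB) {p | p.1.1 = 0}
  refine ⟨s, hs2, I, ?_, hI⟩
  have hle := (finrank_contraction_le hs1 B).trans hc
  rw [sum_ite_eq_card (fun a => (I a).1.1 = 0)]
  rw [hΘj] at hx
  change j = 0 ∨ (2 * j ≤ (k + 1) * Module.finrank ℝ (Θ.map (LinearMap.applyₗ (A s 0))) ∧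
    2 * j + (k + 1) ≤
      (k + 1 + 1) * Module.finrank ℝ (Θ.map (LinearMap.applyₗ (A s 0))) + 1) at hx
  change Module.finrank ℝ (Θ.map (LinearMap.applyₗ (A s 0))) ≤ Nat.card {a // (I a).1.1 = 0} at hle
  set i := Module.finrank ℝ (Θ.map (LinearMap.applyₗ (A s 0)))
  set c := Nat.card {a // (I a).1.1 = 0}
  have hcard := two_mul_card_idxPair (k + 1)
  simp only [Nat.add_sub_cancel] at hcard
  have h7 : 2 * j < (k + 1) * i := by
    rcases hx with hx | ⟨hx1, hx2⟩
    · omega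
    · refine lt_of_le_of_ne hx1 fun h => ?_
      have : k ≤ i := by nlinarith
      nlinarith
  have h8 : 2 * j < (k + 1) * c := h7.trans_le (Nat.mul_le_mul_left _ hle)
  have h9 : (2 * j : ℤ) < (k + 1) * c := by exact_mod_cast h8
  linarith

theorem exists_radius_frame_volume_le {k : ℕ} {A : ℝ → Matrix (Fin (k + 1)) (Fin (k + 1)) ℝ}
    {s0 : ℝ} (hA : ∀ i l, AnalyticAt ℝ (fun s => A s i l) s0) (hdet : (A s0).det ≠ 0)
    (hgen : ∀ c : Fin (k + 1) → ℝ, c ≠ 0 →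
      ∀ᶠ s in nhdsWithin s0 {s0}ᶜ, ∑ i, c i * A s 0 i ≠ 0) :
    ∃ r0 > 0, ∀ r > 0, r ≤ r0 → ∀ δ > 0, ∃ ε > 0, ∀ κ : Fin (k + 1) → ℝ, (∀ i, 0 < κ i) →
      ∏ i, κ i = 1 → ∀ᶠ N : ℕ in Filter.atTop,
        volume {x ∈ Metric.closedBall s0 r | ∃ w : Fin (k + 1) → ℤ, w ≠ 0 ∧
          ∀ i, |κ i * (N : ℝ) ^ (if i = 0 then (k : ℤ) else -1) *
            ∑ l, A x i l * (w l : ℝ)| ≤ ε} ≤ ENNReal.ofReal δ := by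
  refine exists_radius_curve_volume_le A s0 hA hdet (fun i => if i = 0 then (k : ℤ) else -1) ?_ ?_
  · simp [Fin.sum_univ_succ]
  · intro j hj0 hj B hB r hr
    rw [Fintype.card_fin] at hj
    exact exists_rows_frame hA hdet hgen hj0 hj hB hr

theorem exists_radius_compoundTwo_volume_le {k : ℕ}
    {A : ℝ → Matrix (Fin (k + 1)) (Fin (k + 1)) ℝ}
    {s0 : ℝ} (hA : ∀ i l, AnalyticAt ℝ (fun s => A s i l) s0) (hdet : (A s0).det ≠ 0)
    (hgen : ∀ c : Fin (k + 1) → ℝ, c ≠ 0 →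
      ∀ᶠ s in nhdsWithin s0 {s0}ᶜ, ∑ i, c i * A s 0 i ≠ 0) :
    ∃ r0 > 0, ∀ r > 0, r ≤ r0 → ∀ δ > 0, ∃ ε > 0, ∀ κ : IdxPair (k + 1) → ℝ, (∀ p, 0 < κ p) →
      ∏ p, κ p = 1 → ∀ᶠ N : ℕ in Filter.atTop,
        volume {x ∈ Metric.closedBall s0 r | ∃ w : IdxPair (k + 1) → ℤ, w ≠ 0 ∧
          ∀ p, |κ p * (N : ℝ) ^ (if p.1.1 = 0 then (k : ℤ) - 1 else -2) *
            ∑ l, compoundTwo (A x) p l * (w l : ℝ)| ≤ ε} ≤ ENNReal.ofReal δ := by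
  refine exists_radius_curve_volume_le (fun s => compoundTwo (A s)) s0 ?_
    (det_compoundTwo_ne_zero hdet) (fun p => if p.1.1 = 0 then (k : ℤ) - 1 else -2) ?_ ?_
  · intro p q
    exact ((hA _ _).mul (hA _ _)).sub ((hA _ _).mul (hA _ _))
  · rw [sum_idxPair (fun p => if p.1 = 0 then (k : ℤ) - 1 else -2), Fin.sum_univ_succ]
    have h : ∀ b : Fin k, ∑ a ∈ Finset.Iio b.succ, (if a = 0 then (k : ℤ) - 1 else -2) =
        (k + 1) - 2 * (b + 1) := by
      intro b
      have h1 : ∀ a : Fin (k + 1), (if a = 0 then (k : ℤ) - 1 else -2) =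
          (if a = 0 then (k : ℤ) + 1 else 0) + -2 := by
        intro a; split_ifs <;> ring
      simp_rw [h1]
      rw [Finset.sum_add_distrib, Finset.sum_ite_eq' (Finset.Iio b.succ) 0]
      simp
      ring
    simp_rw [h]
    have h0 : ∑ a ∈ Finset.Iio (0 : Fin (k + 1)), (if a = 0 then (k : ℤ) - 1 else -2) = 0 := by
      have : Finset.Iio (0 : Fin (k + 1)) = ∅ := by ext a; simp
      rw [this, Finset.sum_empty]
    rw [h0, Finset.sum_sub_distrib, ← Finset.mul_sum, Finset.sum_add_distrib]
    have h2 : (∑ b : Fin k, (b : ℤ)) * 2 = k * (k - 1) := by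
      have h3 := Finset.sum_range_id_mul_two k
      rw [← Fin.sum_univ_eq_sum_range fun i => i] at h3
      rcases k with _ | k
      · simp
      · have h4 : ((∑ b : Fin (k + 1), (b : ℕ) : ℕ) : ℤ) * 2 = (k + 1) * k := by
          exact_mod_cast h3
        push_cast at h4 ⊢
        linarith
    simp only [Finset.sum_add_distrib, Finset.sum_const, Finset.card_univ, Fintype.card_fin,
      nsmul_eq_mul]
    linarith
  · intro j hj0 hj B hB r hr
    exact exists_rows_compoundTwo hA hdet hgen hj0 hj hB hr

/-- Minkowski's theorem on linear forms, in its strict version. -/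
theorem exists_int_abs_mulVec_lt {ι : Type*} [Fintype ι] [DecidableEq ι] (P : Matrix ι ι ℝ)
    (hP : P.det ≠ 0) (τ : ι → ℝ) (hτ : ∀ i, 0 < τ i) (h : |P.det| < ∏ i, τ i) :
    ∃ m : ι → ℤ, m ≠ 0 ∧ ∀ i, |P.mulVec (fun l => (m l : ℝ)) i| < τ i := by
  classical
  let b := Pi.basisFun ℝ ι
  let s : Set (ι → ℝ) := Matrix.toLin' P ⁻¹' Set.pi Set.univ fun i => Set.Ioo (-τ i) (τ i)
  have hs : ∀ x, x ∈ s ↔ ∀ i, |P.mulVec x i| < τ i := fun x => by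
    simp [s, Set.mem_pi, abs_lt]
  have hvol : volume s = ENNReal.ofReal (|P.det|⁻¹ * ∏ i, (2 * τ i)) := by
    have h1 := Measure.addHaar_preimage_linearMap (volume : Measure (ι → ℝ))
      (f := Matrix.toLin' P) (by simpa using hP) (Set.pi Set.univ fun i => Set.Ioo (-τ i) (τ i))
    rw [show volume s = _ from h1, volume_pi_pi, LinearMap.det_toLin', abs_inv,
      ENNReal.ofReal_mul (by positivity), ENNReal.ofReal_prod_of_nonneg
        fun i _ => by have := hτ i; positivity]
    congr 2
    funext i
    rw [Real.volume_Ioo]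
    congr 1
    ring
  have hfund := ZSpan.isAddFundamentalDomain b (volume : Measure (ι → ℝ))
  have hlt : volume (ZSpan.fundamentalDomain b) * 2 ^ Module.finrank ℝ (ι → ℝ) < volume s := by
    rw [ZSpan.volume_fundamentalDomain, hvol]
    have h1 : (Matrix.of b : Matrix ι ι ℝ) = 1 := by
      ext i j
      simp [b, Matrix.one_apply, Pi.single_apply, eq_comm]
    rw [h1, Matrix.det_one, abs_one, ENNReal.ofReal_one, one_mul, Module.finrank_fintype_fun_eq_card,
      Finset.prod_mul_distrib, Finset.prod_const, Finset.card_univ]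
    have h2 : (2 : ENNReal) ^ Fintype.card ι = ENNReal.ofReal (2 ^ Fintype.card ι) := by
      rw [ENNReal.ofReal_pow (by norm_num)]; simp
    have hd : 0 < |P.det| := abs_pos.2 hP
    rw [h2, ENNReal.ofReal_lt_ofReal_iff_of_nonneg (by positivity), inv_mul_eq_div,
      lt_div_iff₀ hd]
    gcongr
  have hconv : Convex ℝ s :=
    (convex_pi fun i _ => convex_Ioo _ _).linear_preimage _
  have : Countable (Submodule.span ℤ (Set.range b)).toAddSubgroup := by
    change Countable (Submodule.span ℤ (Set.range b))
    infer_instance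
  obtain ⟨⟨x, hx⟩, hx0, hxs⟩ := exists_ne_zero_mem_lattice_of_measure_mul_two_pow_lt_measure
    (L := (Submodule.span ℤ (Set.range b)).toAddSubgroup)
    hfund (fun x hx => by
      rw [hs] at hx ⊢
      intro i
      rw [Matrix.mulVec_neg, Pi.neg_apply, abs_neg]
      exact hx i) hconv hlt
  have hx' : x ∈ Submodule.span ℤ (Set.range b) := hx
  rw [b.mem_span_iff_repr_mem ℤ] at hx'
  choose m hm using hx'
  have hmx : (fun l => (m l : ℝ)) = x := by
    funext l
    simpa [b] using hm l
  refine ⟨m, fun h0 => hx0 ?_, fun i => ?_⟩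
  · apply Subtype.ext
    change x = 0
    rw [← hmx, h0]
    funext l
    simp
  · rw [hmx]
    exact (hs x).1 hxs i

/-- A lattice of fixed covolume without short vectors is spanned over `ℝ` by vectors of bounded
length. -/
theorem exists_bound_span_short_eq_top {ι : Type*} [Fintype ι] [DecidableEq ι] {ε V : ℝ}
    (hε : 0 < ε) (hV : 0 < V) :
    ∃ C > 0, ∀ Y : Matrix ι ι ℝ, |Y.det| = V →
      (∀ m : ι → ℤ, m ≠ 0 → ∃ i, ε ≤ |Y.mulVec (fun l => (m l : ℝ)) i|) →
      Submodule.span ℝ {x : ι → ℝ | (∀ i, |x i| ≤ C) ∧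
        ∃ m : ι → ℤ, x = Y.mulVec fun l => (m l : ℝ)} = ⊤ := by
  let n : ℝ := Fintype.card ι
  let e : ℝ := ε / (n + 1)
  have hn : 0 ≤ n := Nat.cast_nonneg _
  have he : 0 < e := by positivity
  have hne : n * e < ε := by
    rw [mul_div_assoc', div_lt_iff₀ (by positivity)]
    nlinarith
  have hee : e ≤ ε := div_le_self hε.le (by linarith)
  let T : ℝ := 2 * V / e ^ (Fintype.card ι - 1)
  have hT : 0 < T := by positivity
  refine ⟨T + ε, by positivity, fun Y hY hshort => ?_⟩
  by_contra hspan
  obtain ⟨f, hf0, hf⟩ := Submodule.exists_le_ker_of_lt_top _ (lt_top_iff_ne_top.2 hspan)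
  let u : ι → ℝ := fun i => f (Pi.single i 1)
  have hfu : ∀ x, f x = ∑ i, u i * x i := fun x => by
    conv_lhs => rw [← Finset.univ_sum_single x, map_sum]
    refine Finset.sum_congr rfl fun i _ => ?_
    rw [show (Pi.single i (x i) : ι → ℝ) = x i • Pi.single i 1 by
      rw [← Pi.single_smul, smul_eq_mul, mul_one], map_smul, smul_eq_mul, mul_comm]
  have hu0 : ∃ i, u i ≠ 0 := by
    by_contra! h
    exact hf0 (LinearMap.ext fun x => by simp [hfu, h])
  obtain ⟨i0, hi0⟩ := hu0
  obtain ⟨i, -, hi⟩ := Finset.exists_max_image Finset.univ (fun i => |u i|) ⟨i0, Finset.mem_univ _⟩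
  have hui : 0 < |u i| := (abs_pos.2 hi0).trans_le (hi i0 (Finset.mem_univ _))
  let W : Matrix ι ι ℝ := Matrix.updateRow 1 i u
  have hW : W.det = u i := by
    rw [show W.det = _ from rfl, ← Matrix.cramer_transpose_apply, Matrix.transpose_one,
      Matrix.cramer_one]
    rfl
  have hWi : ∀ x, W.mulVec x i = f x := fun x => by
    simp [W, Matrix.mulVec, hfu, dotProduct, Matrix.updateRow_self]
  have hWj : ∀ x, ∀ j ≠ i, W.mulVec x j = x j := fun x j hj => by
    simp [W, Matrix.mulVec, dotProduct, Matrix.updateRow_ne hj, Matrix.one_apply]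
  have hdet : |(W * Y).det| = |u i| * V := by rw [Matrix.det_mul, abs_mul, hW, hY]
  obtain ⟨m, hm0, hm⟩ := exists_int_abs_mulVec_lt (W * Y)
    (by rw [← abs_pos, hdet]; positivity) (fun j => if j = i then |u i| * T else e)
    (fun j => by split_ifs <;> positivity)
    (by
      rw [hdet, ← Finset.mul_prod_erase _ _ (Finset.mem_univ i), if_pos rfl,
        Finset.prod_congr rfl (g := fun _ => e) fun j hj => if_neg (Finset.ne_of_mem_erase hj),
        Finset.prod_const, Finset.card_erase_of_mem (Finset.mem_univ i), Finset.card_univ,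
        mul_assoc, div_mul_cancel₀ _ (by positivity)]
      gcongr
      linarith)
  let x := Y.mulVec fun l => (m l : ℝ)
  have hx : ∀ j, |W.mulVec x j| < if j = i then |u i| * T else e := fun j => by
    simpa [x, Matrix.mulVec_mulVec] using hm j
  have hxi : |f x| < |u i| * T := by simpa [hWi] using hx i
  have hxj : ∀ j ≠ i, |x j| < e := fun j hj => by simpa [hWj x j hj, hj] using hx j
  have hrest : |∑ j ∈ Finset.univ.erase i, u j * x j| ≤ |u i| * (n * e) := by
    refine (Finset.abs_sum_le_sum_abs _ _).trans ?_
    calc ∑ j ∈ Finset.univ.erase i, |u j * x j| ≤ ∑ j ∈ Finset.univ.erase i, |u i| * e := by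
          refine Finset.sum_le_sum fun j hj => ?_
          rw [abs_mul]
          exact mul_le_mul (hi j (Finset.mem_univ _)) (hxj j (Finset.ne_of_mem_erase hj)).le
            (abs_nonneg _) (abs_nonneg _)
      _ ≤ ∑ _j : ι, |u i| * e :=
          Finset.sum_le_sum_of_subset_of_nonneg (Finset.erase_subset _ _)
            fun _ _ _ => by positivity
      _ = _ := by
          rw [Finset.sum_const, Finset.card_univ, nsmul_eq_mul]
          ring
  have hsplit : u i * x i = f x - ∑ j ∈ Finset.univ.erase i, u j * x j := by
    rw [hfu, ← Finset.add_sum_erase _ _ (Finset.mem_univ i)]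
    ring
  have hle : |u i| * |x i| ≤ |f x| + |u i| * (n * e) := by
    rw [← abs_mul, hsplit]
    exact (abs_sub _ _).trans (add_le_add le_rfl hrest)
  have hmem : x ∈ {x : ι → ℝ | (∀ i, |x i| ≤ T + ε) ∧
      ∃ m : ι → ℤ, x = Y.mulVec fun l => (m l : ℝ)} := by
    refine ⟨fun j => ?_, m, rfl⟩
    by_cases hj : j = i
    · subst hj
      refine le_of_mul_le_mul_left ?_ hui
      nlinarith
    · linarith [hxj j hj]
  have hfx : f x = 0 := hf (Submodule.subset_span hmem)
  obtain ⟨j, hj⟩ := hshort m hm0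
  by_cases hji : j = i
  · subst hji
    rw [hfx, abs_zero, zero_add] at hle
    have h1 : |x j| ≤ n * e := le_of_mul_le_mul_left hle hui
    exact absurd hj (not_le.2 (h1.trans_lt hne))
  · exact absurd hj (not_le.2 ((hxj j hji).trans_le hee))

theorem exists_int_matrix_bounded {ι : Type*} [Fintype ι] [DecidableEq ι] {ε V : ℝ}
    (hε : 0 < ε) (hV : 0 < V) :
    ∃ C > 0, ∀ Y : Matrix ι ι ℝ, |Y.det| = V →
      (∀ m : ι → ℤ, m ≠ 0 → ∃ i, ε ≤ |Y.mulVec (fun l => (m l : ℝ)) i|) →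
      ∃ X : Matrix ι ι ℤ, X.det ≠ 0 ∧ ∀ i j, |(Y * X.map (Int.cast : ℤ → ℝ)) i j| ≤ C := by
  obtain ⟨C, hC, h⟩ := exists_bound_span_short_eq_top (ι := ι) hε hV
  refine ⟨C, hC, fun Y hY hshort => ?_⟩
  let s : Set (ι → ℝ) := {x : ι → ℝ | (∀ i, |x i| ≤ C) ∧
        ∃ m : ι → ℤ, x = Y.mulVec fun l => (m l : ℝ)}
  have hs : Submodule.span ℝ s = ⊤ := h Y hY hshort
  obtain ⟨g, hg, -, hgl⟩ := Submodule.exists_fun_fin_finrank_span_eq ℝ s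
  have hcard : Module.finrank ℝ (Submodule.span ℝ s) = Fintype.card ι := by
    rw [hs, finrank_top, Module.finrank_fintype_fun_eq_card]
  let σ : ι ≃ Fin (Module.finrank ℝ (Submodule.span ℝ s)) :=
    Fintype.equivFinOfCardEq hcard.symm
  choose hgC m hm using hg
  have hYX : ∀ i j, (Y * (Matrix.of fun l j => m (σ j) l : Matrix ι ι ℤ).map (Int.cast : ℤ → ℝ)) i j
      = g (σ j) i := fun i j => by
    rw [hm (σ j)]
    rfl
  refine ⟨Matrix.of fun l j => m (σ j) l, fun h0 => ?_, fun i j => ?_⟩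
  · have h1 : LinearIndependent ℝ
        (Y * (Matrix.of fun l j => m (σ j) l : Matrix ι ι ℤ).map (Int.cast : ℤ → ℝ)).col := by
      have : (Y * (Matrix.of fun l j => m (σ j) l : Matrix ι ι ℤ).map (Int.cast : ℤ → ℝ)).col
          = g ∘ σ := by
        funext j i
        exact hYX i j
      rw [this]
      exact hgl.comp _ σ.injective
    rw [Matrix.linearIndependent_cols_iff_isUnit, Matrix.isUnit_iff_isUnit_det, Matrix.det_mul,
      isUnit_iff_ne_zero] at h1
    refine h1 ?_
    have : ((Matrix.of fun l j => m (σ j) l : Matrix ι ι ℤ).map (Int.cast : ℤ → ℝ)).det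
        = ((Matrix.of fun l j => m (σ j) l : Matrix ι ι ℤ).det : ℝ) :=
      (RingHom.map_det (Int.castRingHom ℝ) _).symm
    rw [this, h0]
    simp
  · rw [hYX]
    exact hgC _ i

/-- Integer matrices with equal nonzero determinant `d` that agree modulo a multiple of `d` differ
by a unimodular factor. -/
theorem exists_unimodular_mul_eq {ι : Type*} [Fintype ι] [DecidableEq ι] {M : ℕ}
    {X X₀ : Matrix ι ι ℤ} (hdet : X.det = X₀.det) (h0 : X₀.det ≠ 0) (hM : X₀.det ∣ (M : ℤ))
    (hmod : X.map (Int.cast : ℤ → ZMod M) = X₀.map Int.cast) :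
    ∃ γ : Matrix ι ι ℤ, γ.det = 1 ∧ γ * X₀ = X := by
  have h1 : ∀ i j, X₀.det ∣ (X * X₀.adjugate) i j := fun i j => by
    have h2 : X * X₀.adjugate = (X - X₀) * X₀.adjugate + X₀.det • (1 : Matrix ι ι ℤ) := by
      rw [Matrix.sub_mul, Matrix.mul_adjugate]
      abel
    rw [h2]
    refine dvd_add (Finset.dvd_sum fun l _ => Dvd.dvd.mul_right (hM.trans ?_) _)
      (Dvd.intro _ rfl)
    have h3 := congrFun (congrFun hmod i) l
    simp only [Matrix.map_apply] at h3
    exact (ZMod.intCast_eq_intCast_iff_dvd_sub _ _ _).1 h3.symm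
  choose γ hγ using h1
  have h2 : X * X₀.adjugate = X₀.det • Matrix.of γ := by
    ext i j
    simp [hγ]
  have h3 : Matrix.of γ * X₀ = X := by
    have h4 : X₀.det • (Matrix.of γ * X₀) = X₀.det • X := by
      rw [← Matrix.smul_mul, ← h2, Matrix.mul_assoc, Matrix.adjugate_mul, Matrix.mul_smul,
        Matrix.mul_one]
    ext i j
    have h5 := congrFun (congrFun h4 i) j
    simpa [h0] using h5
  refine ⟨Matrix.of γ, ?_, h3⟩
  have h4 := congrArg Matrix.det h3
  rw [Matrix.det_mul, hdet] at h4
  exact mul_right_cancel₀ h0 (h4.trans (one_mul _).symm)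

/-- Mahler's criterion: a lattice of fixed covolume without short vectors has a basis in a fixed
bounded set. -/
theorem exists_unimodular_mul_bounded {ι : Type*} [Fintype ι] [DecidableEq ι] {ε V : ℝ}
    (hε : 0 < ε) (hV : 0 < V) :
    ∃ C > 0, ∀ Y : Matrix ι ι ℝ, |Y.det| = V →
      (∀ m : ι → ℤ, m ≠ 0 → ∃ i, ε ≤ |Y.mulVec (fun l => (m l : ℝ)) i|) →
      ∃ γ : Matrix ι ι ℤ, γ.det = 1 ∧ ∀ i j, |(Y * γ.map (Int.cast : ℤ → ℝ)) i j| ≤ C := by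
  classical
  obtain ⟨C, hC, h⟩ := exists_int_matrix_bounded (ι := ι) hε hV
  let D : ℕ := ⌈(Nat.factorial (Fintype.card ι) • C ^ Fintype.card ι) / V⌉₊
  let M : ℕ := D.factorial
  have : NeZero M := ⟨Nat.factorial_ne_zero _⟩
  let cls := Finset.Icc (-(D : ℤ)) D × Matrix ι ι (ZMod M)
  let P : cls → Matrix ι ι ℤ → Prop := fun c X =>
    X.det ≠ 0 ∧ X.det = c.1.1 ∧ X.map (Int.cast : ℤ → ZMod M) = c.2
  let rep : cls → Matrix ι ι ℤ := fun c => if hc : ∃ X, P c X then hc.choose else 1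
  have hrep : ∀ c X, P c X → P c (rep c) := fun c X hX => by
    have hc : ∃ X, P c X := ⟨X, hX⟩
    simp only [rep, dif_pos hc]
    exact hc.choose_spec
  let inv : cls → Matrix ι ι ℝ := fun c => ((rep c).map (Int.cast : ℤ → ℝ))⁻¹
  let B : cls → ℝ := fun c => ∑ i, ∑ j, |inv c i j|
  have hB : ∀ c, 0 ≤ B c := fun c => by positivity
  refine ⟨C * ((∑ c, B c) + 1), mul_pos hC (by positivity), fun Y hY hshort => ?_⟩
  obtain ⟨X, hX0, hX⟩ := h Y hY hshort
  have hcast : ∀ Z : Matrix ι ι ℤ, (Z.map (Int.cast : ℤ → ℝ)).det = (Z.det : ℝ) := fun Z =>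
    (RingHom.map_det (Int.castRingHom ℝ) _).symm
  have hXD : |X.det| ≤ (D : ℤ) := by
    have h1 := Matrix.det_le (A := Y * X.map (Int.cast : ℤ → ℝ)) (abv := AbsoluteValue.abs) hX
    simp only [AbsoluteValue.abs_apply, Matrix.det_mul, abs_mul, hY, hcast] at h1
    have h2 : |(X.det : ℝ)| ≤ D := by
      refine le_trans ?_ (Nat.le_ceil _)
      rw [le_div_iff₀ hV]
      linarith
    exact_mod_cast h2
  let c : cls := (⟨X.det, Finset.mem_Icc.2 (abs_le.1 hXD)⟩, X.map Int.cast)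
  have hcX : P c X := ⟨hX0, rfl, rfl⟩
  obtain ⟨h1, h2, h3⟩ := hrep c X hcX
  obtain ⟨γ, hγ, hγX⟩ := exists_unimodular_mul_eq (M := M) (X := X) (X₀ := rep c) h2.symm h1
    (by
      rw [h2]
      refine Int.dvd_natCast.2 (Nat.dvd_factorial (Int.natAbs_pos.2 hX0) ?_)
      have : ((X.det.natAbs : ℕ) : ℤ) ≤ D := by rwa [Int.natCast_natAbs]
      exact_mod_cast this) h3.symm
  refine ⟨γ, hγ, fun i j => ?_⟩
  have hunit : IsUnit ((rep c).map (Int.cast : ℤ → ℝ)).det := by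
    rw [hcast, isUnit_iff_ne_zero]
    exact_mod_cast h1
  have h4 : Y * γ.map (Int.cast : ℤ → ℝ) = Y * X.map (Int.cast : ℤ → ℝ) * inv c := by
    have h5 : X.map (Int.cast : ℤ → ℝ) =
        γ.map (Int.cast : ℤ → ℝ) * (rep c).map (Int.cast : ℤ → ℝ) := by
      rw [← hγX]
      exact Matrix.map_mul (f := Int.castRingHom ℝ)
    rw [h5, Matrix.mul_assoc, Matrix.mul_assoc, Matrix.mul_nonsing_inv _ hunit, Matrix.mul_one]
  rw [h4]
  calc |(Y * X.map (Int.cast : ℤ → ℝ) * inv c) i j|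
      ≤ ∑ l, |(Y * X.map (Int.cast : ℤ → ℝ)) i l * inv c l j| := Finset.abs_sum_le_sum_abs _ _
    _ ≤ ∑ l, C * ∑ j', |inv c l j'| := by
        refine Finset.sum_le_sum fun l _ => ?_
        rw [abs_mul]
        exact mul_le_mul (hX i l) (Finset.single_le_sum (f := fun j' => |inv c l j'|)
          (fun _ _ => abs_nonneg _) (Finset.mem_univ j)) (abs_nonneg _) hC.le
    _ = C * B c := by rw [← Finset.mul_sum]
    _ ≤ C * ((∑ c, B c) + 1) := by
        refine mul_le_mul_of_nonneg_left ?_ hC.le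
        have := Finset.single_le_sum (f := B) (fun c _ => hB c) (Finset.mem_univ c)
        linarith

/-- The Haar probability measure on the torus. -/
noncomputable def torusHaar (d : Type*) [Fintype d] : Measure (UnitAddTorus d) :=
  Measure.pi fun _ => AddCircle.haarAddCircle

instance (d : Type*) [Fintype d] : IsProbabilityMeasure (torusHaar d) :=
  inferInstanceAs (IsProbabilityMeasure (Measure.pi _))

instance (d : Type*) [Fintype d] : (torusHaar d).IsOpenPosMeasure :=
  inferInstanceAs (Measure.pi _).IsOpenPosMeasure

theorem integral_mFourier_eq_zero {d : Type*} [Fintype d] {m : d → ℤ} (hm : m ≠ 0) :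
    ∫ x, UnitAddTorus.mFourier m x ∂torusHaar d = 0 := by
  simp only [UnitAddTorus.mFourier, ContinuousMap.coe_mk]
  rw [torusHaar, MeasureTheory.integral_fintype_prod_eq_prod]
  obtain ⟨i, hi⟩ := Function.ne_iff.mp hm
  refine Finset.prod_eq_zero (Finset.mem_univ i) ?_
  have h1 := (orthonormal_iff_ite.mp <| orthonormal_fourier (T := 1)) 0 (m i)
  rw [if_neg (show (0 : ℤ) ≠ m i from Ne.symm hi)] at h1
  simpa [ContinuousMap.inner_toLp] using h1

theorem mFourier_coe_apply {d : Type*} [Fintype d] (m : d → ℤ) (θ : d → ℝ) (ξ : ℝ) :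
    UnitAddTorus.mFourier m (fun i => ((ξ * θ i : ℝ) : UnitAddCircle)) =
      Complex.exp ((2 * Real.pi * (∑ i, m i * θ i : ℝ) * Complex.I) * ξ) := by
  simp only [UnitAddTorus.mFourier, ContinuousMap.coe_mk, fourier_coe_apply]
  rw [← Complex.exp_sum]
  congr 1
  push_cast
  rw [Finset.mul_sum, Finset.sum_mul, Finset.sum_mul]
  refine Finset.sum_congr rfl fun i _ => ?_
  ring

theorem tendsto_mean_mFourier {d : Type*} [Fintype d] {θ : d → ℝ}
    (hθ : ∀ m : d → ℤ, m ≠ 0 → ∑ i, m i * θ i ≠ 0) (m : d → ℤ) :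
    Filter.Tendsto (fun T : ℝ => (T : ℂ)⁻¹ * ∫ ξ in (0 : ℝ)..T,
      UnitAddTorus.mFourier m (fun i => ((ξ * θ i : ℝ) : UnitAddCircle))) Filter.atTop
      (nhds (∫ x, UnitAddTorus.mFourier m x ∂torusHaar d)) := by
  by_cases hm : m = 0
  · subst hm
    simp only [UnitAddTorus.mFourier_zero, ContinuousMap.one_apply, integral_const,
      intervalIntegral.integral_const, sub_zero]
    refine Filter.Tendsto.congr' ?_ tendsto_const_nhds
    filter_upwards [Filter.eventually_gt_atTop 0] with T hT
    have : (T : ℂ) ≠ 0 := by exact_mod_cast hT.ne'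
    simp [this]
  · let c : ℂ := 2 * Real.pi * (∑ i, m i * θ i : ℝ) * Complex.I
    have hc : c ≠ 0 := by
      have := hθ m hm
      simp only [c]
      refine mul_ne_zero (mul_ne_zero (mul_ne_zero two_ne_zero ?_) ?_) Complex.I_ne_zero
      · exact_mod_cast Real.pi_ne_zero
      · exact_mod_cast this
    have h0 := integral_mFourier_eq_zero hm
    rw [h0]
    simp only [mFourier_coe_apply]
    have h2 : ∀ T : ℝ, ‖(T : ℂ)⁻¹ * ∫ ξ in (0 : ℝ)..T, Complex.exp (c * ξ)‖ ≤ |T|⁻¹ * (2 / ‖c‖) := by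
      intro T
      rw [integral_exp_mul_complex hc, norm_mul, norm_inv, norm_div]
      simp only [Complex.norm_real, Real.norm_eq_abs]
      gcongr
      refine (norm_sub_le _ _).trans ?_
      have h3 : ∀ t : ℝ, ‖Complex.exp (c * t)‖ = 1 := fun t => by
        rw [Complex.norm_exp]
        simp [c]
      rw [h3, h3]
      norm_num
    refine squeeze_zero_norm h2 ?_
    rw [← zero_mul (2 / ‖c‖)]
    exact (Filter.Tendsto.comp tendsto_inv_atTop_zero Filter.tendsto_abs_atTop_atTop).mul_const _

theorem tendsto_mean_continuousMap {d : Type*} [Fintype d] {θ : d → ℝ}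
    (hθ : ∀ m : d → ℤ, m ≠ 0 → ∑ i, m i * θ i ≠ 0) (f : C(UnitAddTorus d, ℂ)) :
    Filter.Tendsto (fun T : ℝ => (T : ℂ)⁻¹ * ∫ ξ in (0 : ℝ)..T,
      f (fun i => ((ξ * θ i : ℝ) : UnitAddCircle))) Filter.atTop (nhds (∫ x, f x ∂torusHaar d)) := by
  have horb : Continuous fun ξ : ℝ => (fun i => ((ξ * θ i : ℝ) : UnitAddCircle) : UnitAddTorus d) :=
    continuous_pi fun i => (AddCircle.continuous_mk' 1).comp (continuous_id.mul continuous_const)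
  have hIntv : ∀ f : C(UnitAddTorus d, ℂ), ∀ T : ℝ, IntervalIntegrable
      (fun ξ : ℝ => f (fun i => ((ξ * θ i : ℝ) : UnitAddCircle))) volume 0 T := fun f T =>
    (f.continuous.comp horb).intervalIntegrable _ _
  have hIntv' : ∀ f : C(UnitAddTorus d, ℂ), Integrable f (torusHaar d) := fun f =>
    f.continuous.integrable_of_hasCompactSupport (HasCompactSupport.of_compactSpace _)
  have hspan : ∀ P ∈ Submodule.span ℂ (Set.range (UnitAddTorus.mFourier (d := d))),
      Filter.Tendsto (fun T : ℝ => (T : ℂ)⁻¹ * ∫ ξ in (0 : ℝ)..T,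
        P (fun i => ((ξ * θ i : ℝ) : UnitAddCircle))) Filter.atTop (nhds (∫ x, P x ∂torusHaar d)) := by
    intro P hP
    induction hP using Submodule.span_induction with
    | mem x hx =>
      obtain ⟨m, rfl⟩ := hx
      exact tendsto_mean_mFourier hθ m
    | zero => simp
    | add x y _ _ hx hy =>
      simp only [ContinuousMap.add_apply]
      rw [integral_add (hIntv' x) (hIntv' y)]
      refine (hx.add hy).congr fun T => ?_
      rw [intervalIntegral.integral_add (hIntv x T) (hIntv y T), mul_add]
    | smul a x _ hx =>
      simp only [ContinuousMap.smul_apply]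
      rw [integral_smul]
      refine (hx.const_smul a).congr fun T => ?_
      rw [intervalIntegral.integral_smul, smul_eq_mul, smul_eq_mul]
      ring
  rw [Metric.tendsto_nhds]
  intro ε hε
  have hf : f ∈ closure
      (Submodule.span ℂ (Set.range (UnitAddTorus.mFourier (d := d))) : Set C(UnitAddTorus d, ℂ)) := by
    rw [← Submodule.topologicalClosure_coe, UnitAddTorus.span_mFourier_closure_eq_top]
    trivial
  obtain ⟨P, hP, hfP⟩ := Metric.mem_closure_iff.1 hf (ε / 3) (by positivity)
  have hsub : ∀ x, ‖f x - P x‖ ≤ ε / 3 := fun x => by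
    rw [← dist_eq_norm]
    exact (ContinuousMap.dist_apply_le_dist x).trans hfP.le
  have h1 : dist (∫ x, P x ∂torusHaar d) (∫ x, f x ∂torusHaar d) ≤ ε / 3 := by
    rw [dist_comm, dist_eq_norm, ← integral_sub (hIntv' f) (hIntv' P)]
    refine (norm_integral_le_of_norm_le_const (Filter.Eventually.of_forall hsub)).trans ?_
    simp
  filter_upwards [Metric.tendsto_nhds.1 (hspan P hP) (ε / 3) (by positivity),
    Filter.eventually_gt_atTop 0] with T hT hT0
  have h2 : dist ((T : ℂ)⁻¹ * ∫ ξ in (0 : ℝ)..T, f (fun i => ((ξ * θ i : ℝ) : UnitAddCircle)))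
      ((T : ℂ)⁻¹ * ∫ ξ in (0 : ℝ)..T, P (fun i => ((ξ * θ i : ℝ) : UnitAddCircle))) ≤ ε / 3 := by
    rw [dist_eq_norm, ← mul_sub, ← intervalIntegral.integral_sub (hIntv f T) (hIntv P T), norm_mul,
      norm_inv, Complex.norm_real, Real.norm_eq_abs, abs_of_pos hT0, inv_mul_le_iff₀ hT0]
    refine (intervalIntegral.norm_integral_le_of_norm_le_const fun ξ _ => hsub _).trans ?_
    rw [sub_zero, abs_of_pos hT0, mul_comm]
  have h3 := dist_triangle4 ((T : ℂ)⁻¹ * ∫ ξ in (0 : ℝ)..T,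
      f (fun i => ((ξ * θ i : ℝ) : UnitAddCircle))) _ _ (∫ x, f x ∂torusHaar d) |>.trans_lt
    (add_lt_add_of_lt_of_le (add_lt_add_of_le_of_lt h2 hT) h1)
  linarith

/-- Kronecker's theorem in continuous time. -/
theorem exists_mul_near_mod_one {d : Type*} [Fintype d] {θ : d → ℝ}
    (hθ : ∀ m : d → ℤ, m ≠ 0 → ∑ i, m i * θ i ≠ 0) (τ : d → ℝ) {δ : ℝ} (hδ : 0 < δ) :
    ∃ ξ : ℝ, ∃ p : d → ℤ, ∀ i, |ξ * θ i - τ i - p i| < δ := by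
  let x0 : UnitAddTorus d := fun i => (τ i : UnitAddCircle)
  let g : UnitAddTorus d → ℝ := fun x => max 0 (δ - dist x x0)
  have hg : Continuous g := by fun_prop
  let f : C(UnitAddTorus d, ℂ) := ⟨fun x => (g x : ℂ), Complex.continuous_ofReal.comp hg⟩
  by_contra! hcon
  have hg0 : ∀ ξ : ℝ, g (fun i => ((ξ * θ i : ℝ) : UnitAddCircle)) = 0 := by
    intro ξ
    obtain ⟨i, hi⟩ := hcon ξ fun i => round (ξ * θ i - τ i)
    refine max_eq_left (sub_nonpos.2 (hi.trans ?_))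
    rw [← UnitAddCircle.norm_eq, AddCircle.coe_sub, ← dist_eq_norm]
    exact dist_le_pi_dist (fun i => ((ξ * θ i : ℝ) : UnitAddCircle)) x0 i
  have h1 := tendsto_mean_continuousMap hθ f
  have h2 : ∀ ξ : ℝ, f (fun i => ((ξ * θ i : ℝ) : UnitAddCircle)) = 0 := fun ξ => by
    change ((g _ : ℝ) : ℂ) = 0
    rw [hg0]
    simp
  simp only [h2, intervalIntegral.integral_zero, mul_zero] at h1
  have h3 : ∫ x, f x ∂torusHaar d = 0 := (tendsto_nhds_unique h1 tendsto_const_nhds)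
  have h4 : ∫ x, g x ∂torusHaar d = 0 := by
    have : ∫ x, f x ∂torusHaar d = ((∫ x, g x ∂torusHaar d : ℝ) : ℂ) := integral_ofReal
    rw [this] at h3
    exact_mod_cast h3
  have h5 : 0 < ∫ x, g x ∂torusHaar d :=
    hg.integral_pos_of_hasCompactSupport_nonneg_nonzero (HasCompactSupport.of_compactSpace _)
      (fun x => le_max_left _ _) (x := x0) (by simp [g, hδ.not_ge])
  exact h5.ne' h4

/-- The lattice `g ℤ^ι` meets the cube `[-μ, μ]^R` only in the image of `0`. -/
def AvoidsCube {R ι : Type*} [Fintype ι] (μ : ℝ) (g : Matrix R ι ℝ) : Prop :=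
  ∀ m : ι → ℤ, m ≠ 0 → ∃ i, μ < |g.mulVec (fun l => (m l : ℝ)) i|

theorem AvoidsCube.of_mul_unimodular {R ι : Type*} [Fintype ι] [DecidableEq ι] {μ : ℝ}
    {g : Matrix R ι ℝ} {γ : Matrix ι ι ℤ} (hγ : γ.det = 1)
    (h : AvoidsCube μ (g * γ.map (Int.cast : ℤ → ℝ))) : AvoidsCube μ g := by
  intro m hm
  have h1 : γ.mulVec (γ.adjugate.mulVec m) = m := by
    rw [Matrix.mulVec_mulVec, Matrix.mul_adjugate, hγ, one_smul, Matrix.one_mulVec]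
  obtain ⟨i, hi⟩ := h (γ.adjugate.mulVec m) fun h0 => hm (by rw [← h1, h0, Matrix.mulVec_zero])
  refine ⟨i, ?_⟩
  have h2 : (γ.map (Int.cast : ℤ → ℝ)).mulVec (fun l => ((γ.adjugate.mulVec m) l : ℝ)) =
      fun l => (m l : ℝ) := by
    funext l
    rw [← congrFun h1 l]
    simp [Matrix.mulVec, dotProduct]
  rwa [← Matrix.mulVec_mulVec, h2] at hi

theorem continuousAt_inv_of_det_ne_zero {ι : Type*} [Fintype ι] [DecidableEq ι] {g : Matrix ι ι ℝ}
    (hg : g.det ≠ 0) : ContinuousAt (fun g : Matrix ι ι ℝ => g⁻¹) g := by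
  have h1 : (fun g : Matrix ι ι ℝ => g⁻¹) = fun g => (g.det)⁻¹ • g.adjugate := by
    funext g
    rw [Matrix.inv_def, Ring.inverse_eq_inv']
  rw [h1]
  exact (continuous_id.matrix_det.continuousAt.inv₀ hg).smul
    continuous_id.matrix_adjugate.continuousAt

theorem eventually_avoidsCube {ι : Type*} [Fintype ι] [DecidableEq ι] {μ : ℝ}
    {g : Matrix ι ι ℝ} (hg : g.det ≠ 0) (h : AvoidsCube μ g) :
    ∀ᶠ g' in nhds g, AvoidsCube μ g' := by
  let f : Matrix ι ι ℝ → ℝ := fun g => ∑ l, ∑ i, |g⁻¹ l i| * |μ|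
  have hf : ContinuousAt f g := by
    refine tendsto_finsetSum _ fun l _ => tendsto_finsetSum _ fun i _ => ?_
    exact ((((continuous_apply_apply l i).continuousAt).comp
      (continuousAt_inv_of_det_ne_zero hg)).abs).mul_const _
  let K : ℤ := ⌈f g + 1⌉
  let Ms : Set (ι → ℤ) := {m | m ∈ Set.Icc (fun _ => -K) (fun _ => K) ∧ m ≠ 0}
  have hMs : Ms.Finite := (Set.finite_Icc _ _).subset fun m hm => hm.1
  have h1 : ∀ᶠ g' in nhds g, ∀ m ∈ Ms, ∃ i, μ < |g'.mulVec (fun l => (m l : ℝ)) i| := by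
    refine (Filter.eventually_all_finite hMs).2 fun m hm => ?_
    obtain ⟨i, hi⟩ := h m hm.2
    have hc : Continuous fun g' : Matrix ι ι ℝ => |g'.mulVec (fun l => (m l : ℝ)) i| :=
      ((continuous_apply i).comp (continuous_id.matrix_mulVec continuous_const)).abs
    filter_upwards [hc.continuousAt.eventually_const_lt hi] with g' hg'
    exact ⟨i, hg'⟩
  filter_upwards [h1, hf.eventually_lt_const (lt_add_one _),
    (continuous_id.matrix_det.continuousAt (x := g)).eventually_ne hg] with g' h2 h3 h4 m hm
  change g'.det ≠ 0 at h4
  by_contra! hcon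
  refine (h2 m ⟨?_, hm⟩).elim fun i hi => (hcon i).not_gt hi
  have h5 : g'⁻¹.mulVec (g'.mulVec fun l => (m l : ℝ)) = fun l => (m l : ℝ) := by
    rw [Matrix.mulVec_mulVec, Matrix.nonsing_inv_mul _ (isUnit_iff_ne_zero.2 h4),
      Matrix.one_mulVec]
  have h6 : ∀ l, |m l| ≤ K := fun l => by
    have h7 : |(m l : ℝ)| ≤ f g' := by
      rw [← congrFun h5 l]
      refine (Finset.abs_sum_le_sum_abs _ _).trans ?_
      refine le_trans (Finset.sum_le_sum fun i _ => ?_)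
        (Finset.single_le_sum (f := fun l => ∑ i, |g'⁻¹ l i| * |μ|)
          (fun _ _ => by positivity) (Finset.mem_univ l))
      rw [abs_mul]
      exact mul_le_mul_of_nonneg_left ((hcon i).trans (le_abs_self _)) (abs_nonneg _)
    have h8 : |(m l : ℝ)| ≤ K := (h7.trans h3.le).trans (Int.le_ceil _)
    exact_mod_cast h8
  exact ⟨fun l => (abs_le.1 (h6 l)).1, fun l => (abs_le.1 (h6 l)).2⟩

/-- The matrix with rows `(c, r)` and `(u a, L a)`. -/
def borderedMatrix {k : ℕ} (c : ℝ) (r u : Fin k → ℝ) (L : Matrix (Fin k) (Fin k) ℝ) :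
    Matrix (Fin (k + 1)) (Fin (k + 1)) ℝ :=
  Matrix.of (Fin.cons (Fin.cons c r) fun a => Fin.cons (u a) (L a))

section Bordered

variable {k : ℕ} (c : ℝ) (r u : Fin k → ℝ) (L : Matrix (Fin k) (Fin k) ℝ) (x : Fin (k + 1) → ℝ)

theorem borderedMatrix_mulVec_zero :
    (borderedMatrix c r u L).mulVec x 0 = c * x 0 + ∑ j, r j * x j.succ := by
  simp [borderedMatrix, Matrix.mulVec, dotProduct, Fin.sum_univ_succ]

theorem borderedMatrix_mulVec_succ (a : Fin k) :
    (borderedMatrix c r u L).mulVec x a.succ = u a * x 0 + ∑ j, L a j * x j.succ := by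
  simp [borderedMatrix, Matrix.mulVec, dotProduct, Fin.sum_univ_succ]

theorem det_borderedMatrix_zero : (borderedMatrix c r 0 L).det = c * L.det := by
  rw [Matrix.det_succ_column_zero, Fin.sum_univ_succ]
  have h1 : (borderedMatrix c r 0 L).submatrix (Fin.succAbove 0) Fin.succ = L := by
    ext a j
    simp [borderedMatrix]
  rw [h1]
  simp [borderedMatrix]

end Bordered

/-- Column operations preserving the coordinate flag bring an invertible matrix into row-permuted
lower unitriangular form. -/
theorem exists_flag_normal_form {k : ℕ} {L : Matrix (Fin k) (Fin k) ℝ} (hL : L.det ≠ 0) :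
    ∃ (C : Matrix (Fin k) (Fin k) ℝ) (π : Fin k → Fin k), (∀ i j, j < i → C i j = 0) ∧
      (∀ j, (L * C) (π j) j = 1) ∧ ∀ i j, i < j → (L * C) (π i) j = 0 := by
  have key : ∀ n, n ≤ k → ∃ (c : Fin k → Fin k → ℝ) (π : Fin k → Fin k),
      ∀ j : Fin k, j.1 < n → (∀ i, j < i → c j i = 0) ∧ L.mulVec (c j) (π j) = 1 ∧
        ∀ i, i < j → L.mulVec (c j) (π i) = 0 := by
    intro n
    induction n with
    | zero => exact fun _ => ⟨0, id, fun j hj => absurd hj (Nat.not_lt_zero _)⟩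
    | succ n ih =>
      intro hn
      obtain ⟨c, π, h⟩ := ih (by omega)
      let n' : Fin k := ⟨n, hn⟩
      let T : ({i : Fin k // i ≤ n'} → ℝ) →ₗ[ℝ] (Fin k → ℝ) :=
        { toFun := fun v i => if hi : i ≤ n' then v ⟨i, hi⟩ else 0
          map_add' := fun v w => by
            funext i
            by_cases hi : i ≤ n' <;> simp [hi]
          map_smul' := fun a v => by
            funext i
            by_cases hi : i ≤ n' <;> simp [hi] }
      have hTinj : Function.Injective T := fun v w hvw => by
        funext i
        have := congrFun hvw i.1
        simpa [T, i.2] using this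
      let S : ({i : Fin k // i ≤ n'} → ℝ) →ₗ[ℝ] ({i : Fin k // i < n'} → ℝ) :=
        LinearMap.pi fun i => (LinearMap.proj (π i.1)).comp ((Matrix.toLin' L).comp T)
      have hker : LinearMap.ker S ≠ ⊥ := by
        refine LinearMap.ker_ne_bot_of_finrank_lt ?_
        rw [Module.finrank_fintype_fun_eq_card, Module.finrank_fintype_fun_eq_card]
        refine Fintype.card_lt_of_injective_of_notMem (fun i => ⟨i.1, i.2.le⟩)
          (fun i j hij => Subtype.ext (by simpa using hij)) (b := ⟨n', le_rfl⟩) ?_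
        rintro ⟨i, hi⟩
        exact i.2.ne (by simpa using hi)
      obtain ⟨v, hv, hv0⟩ := (Submodule.ne_bot_iff _).1 hker
      have hLv : L.mulVec (T v) ≠ 0 := fun h0 => hv0 (hTinj (by
        rw [map_zero]
        exact Matrix.eq_zero_of_mulVec_eq_zero hL h0))
      obtain ⟨p, hp⟩ := Function.ne_iff.1 hLv
      simp only [Pi.zero_apply] at hp
      refine ⟨Function.update c n' ((L.mulVec (T v) p)⁻¹ • T v), Function.update π n' p,
        fun j hj => ?_⟩
      rcases (Nat.lt_succ_iff_lt_or_eq.1 hj) with hj' | hj'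
      · have hjn : j ≠ n' := fun h => by simp [h, n'] at hj'
        rw [Function.update_of_ne hjn, Function.update_of_ne hjn]
        refine ⟨(h j hj').1, (h j hj').2.1, fun i hi => ?_⟩
        have hin : i ≠ n' := fun h => by
          subst h
          exact absurd (Fin.lt_def.1 hi) (by simp [n']; omega)
        rw [Function.update_of_ne hin]
        exact (h j hj').2.2 i hi
      · have hjn : j = n' := Fin.ext hj'
        subst hjn
        rw [Function.update_self, Function.update_self]
        refine ⟨fun i hi => ?_, ?_, fun i hi => ?_⟩
        · simp [T, hi.not_ge]
        · rw [Matrix.mulVec_smul, Pi.smul_apply, smul_eq_mul, inv_mul_cancel₀ hp]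
        · rw [Function.update_of_ne hi.ne, Matrix.mulVec_smul, Pi.smul_apply]
          have := congrFun (LinearMap.mem_ker.1 hv) ⟨i, hi⟩
          simp only [S, LinearMap.pi_apply, LinearMap.comp_apply, Matrix.toLin'_apply,
            LinearMap.proj_apply, Pi.zero_apply] at this
          rw [this, smul_zero]
  obtain ⟨c, π, h⟩ := key k le_rfl
  exact ⟨Matrix.of fun i j => c j i, π, fun i j hij => (h j j.2).1 i hij, fun j => (h j j.2).2.1,
    fun i j hij => (h j j.2).2.2 i hij⟩

section HessenbergApproximation

variable {k : ℕ} {μ : ℝ}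

theorem avoidsCube_of_flag_normal_form {k : ℕ} {B : Matrix (Fin k) (Fin k) ℝ} {π : Fin k → Fin k}
    (hμ : μ < 1) (h1 : ∀ j, B (π j) j = 1) (h0 : ∀ i j, i < j → B (π i) j = 0) :
    AvoidsCube μ B := by
  intro m hm
  obtain ⟨j, hj, hmin⟩ : ∃ j, m j ≠ 0 ∧ ∀ i, i < j → m i = 0 := by
    obtain ⟨j0, hj0⟩ := Function.ne_iff.1 hm
    have hne : (Finset.univ.filter fun j => m j ≠ 0).Nonempty := ⟨j0, by simpa using hj0⟩
    refine ⟨Finset.min' _ hne, (Finset.mem_filter.1 (Finset.min'_mem _ hne)).2, fun i hi => ?_⟩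
    by_contra hmi
    exact hi.not_ge (Finset.min'_le _ i (Finset.mem_filter.2 ⟨Finset.mem_univ i, hmi⟩))
  refine ⟨π j, ?_⟩
  have h2 : B.mulVec (fun l => (m l : ℝ)) (π j) = m j := by
    rw [Matrix.mulVec, dotProduct, Finset.sum_eq_single j]
    · rw [h1, one_mul]
    · intro l _ hl
      rcases lt_or_gt_of_ne hl with hl | hl
      · rw [hmin l hl, Int.cast_zero, mul_zero]
      · rw [h0 j l hl, zero_mul]
    · exact fun h => absurd (Finset.mem_univ _) h
  rw [h2]
  have h3 : (1 : ℝ) ≤ |(m j : ℝ)| := by exact_mod_cast Int.one_le_abs hj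
  linarith

theorem abs_det_eq_one_of_flag_normal_form {k : ℕ} {B : Matrix (Fin k) (Fin k) ℝ}
    {π : Fin k → Fin k} (h1 : ∀ j, B (π j) j = 1) (h0 : ∀ i j, i < j → B (π i) j = 0) :
    |B.det| = 1 := by
  have hinj : Function.Injective π := by
    intro i j hij
    by_contra hne
    rcases lt_or_gt_of_ne hne with h | h
    · have := h0 i j h
      rw [hij, h1] at this
      exact one_ne_zero this
    · have := h0 j i h
      rw [← hij, h1] at this
      exact one_ne_zero this
  let e : Fin k ≃ Fin k := Equiv.ofBijective π (Finite.injective_iff_bijective.1 hinj)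
  have h2 : (B.submatrix e (Equiv.refl _)).det = 1 := by
    rw [Matrix.det_of_isLowerTriangular (B.submatrix e (Equiv.refl _)) fun i j hij => h0 i j hij]
    exact Finset.prod_eq_one fun i _ => h1 i
  rw [← Matrix.abs_det_submatrix_equiv_equiv e (Equiv.refl _) B, h2, abs_one]

/-- Integer approximation of `x • C` in upper Hessenberg form with unit subdiagonal. -/
noncomputable def hessenbergApprox (C : Matrix (Fin k) (Fin k) ℝ) (x : ℝ) :
    Matrix (Fin k) (Fin k) ℤ :=
  Matrix.of fun i j => if i ≤ j then ⌊x * C i j⌋ else if i.1 = j.1 + 1 then 1 else 0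

theorem tendsto_hessenbergApprox {C : Matrix (Fin k) (Fin k) ℝ} (hC : ∀ i j, j < i → C i j = 0) :
    Filter.Tendsto (fun x : ℝ => x⁻¹ • (hessenbergApprox C x).map (Int.cast : ℤ → ℝ))
      Filter.atTop (nhds C) := by
  refine tendsto_pi_nhds.2 fun i => tendsto_pi_nhds.2 fun j => ?_
  simp only [Matrix.smul_apply, Matrix.map_apply, hessenbergApprox, Matrix.of_apply, smul_eq_mul]
  by_cases hij : i ≤ j
  · simp only [if_pos hij]
    have h1 : Filter.Tendsto (fun x : ℝ => C i j - x⁻¹) Filter.atTop (nhds (C i j)) := by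
      simpa using (tendsto_const_nhds (x := C i j)).sub (tendsto_inv_atTop_zero (𝕜 := ℝ))
    refine tendsto_of_tendsto_of_tendsto_of_le_of_le' h1 tendsto_const_nhds ?_ ?_
    · filter_upwards [Filter.eventually_gt_atTop 0] with x hx
      have := Int.lt_floor_add_one (x * C i j)
      have h2 : x⁻¹ * (x * C i j) = C i j := by field_simp
      nlinarith [inv_pos.2 hx]
    · filter_upwards [Filter.eventually_gt_atTop 0] with x hx
      have := Int.floor_le (x * C i j)
      have h2 : x⁻¹ * (x * C i j) = C i j := by field_simp
      nlinarith [inv_pos.2 hx]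
  · simp only [if_neg hij]
    rw [hC i j (not_le.1 hij)]
    simpa using tendsto_inv_atTop_zero.mul_const
      (((if i.1 = j.1 + 1 then 1 else 0 : ℤ) : ℝ))

/-- For a Hessenberg matrix with unit subdiagonal, a real vector whose last coordinate and whose
image are integral is integral. -/
theorem exists_int_of_hessenberg {X : Matrix (Fin (k + 1)) (Fin (k + 1)) ℤ}
    (h1 : ∀ i j, i.1 = j.1 + 1 → X i j = 1) (h0 : ∀ i j, j.1 + 1 < i.1 → X i j = 0)
    {y : Fin (k + 1) → ℝ} {m : Fin (k + 1) → ℤ}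
    (hy : (X.map (Int.cast : ℤ → ℝ)).mulVec y = fun l => (m l : ℝ))
    {p : ℤ} (hp : y (Fin.last k) = p) : ∃ n : Fin (k + 1) → ℤ, y = fun l => (n l : ℝ) := by
  have key : ∀ d, ∀ i : Fin (k + 1), i.1 + d = k → ∃ n : ℤ, y i = n := by
    intro d
    induction d using Nat.strong_induction_on with
    | _ d ih =>
      intro i hi
      rcases Nat.eq_zero_or_pos d with rfl | hd
      · exact ⟨p, by rw [← hp]; congr 1; exact Fin.ext (by simpa using hi)⟩
      · let i' : Fin (k + 1) := ⟨i.1 + 1, by omega⟩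
        have h2 := congrFun hy i'
        simp only [Matrix.mulVec, dotProduct, Matrix.map_apply] at h2
        have h3 : ∀ j : Fin (k + 1), ∃ n : ℤ, j ≠ i → (X i' j : ℝ) * y j = n := by
          intro j
          rcases lt_trichotomy j.1 i.1 with h | h | h
          · exact ⟨0, fun _ => by rw [h0 i' j (by simp [i']; omega)]; simp⟩
          · exact ⟨0, fun hj => absurd (Fin.ext h) hj⟩
          · obtain ⟨n, hn⟩ := ih (k - j.1) (by omega) j (by omega)
            exact ⟨X i' j * n, fun _ => by rw [hn]; push_cast; ring⟩
        choose n hn using h3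
        rw [← Finset.add_sum_erase _ _ (Finset.mem_univ i), h1 i' i rfl, Int.cast_one, one_mul,
          Finset.sum_congr rfl fun j hj => hn j (Finset.ne_of_mem_erase hj)] at h2
        exact ⟨m i' - ∑ j ∈ Finset.univ.erase i, n j, by push_cast; linarith⟩
  choose n hn using fun i : Fin (k + 1) => key (k - i.1) i (by omega)
  exact ⟨n, funext hn⟩

theorem hessenbergApprox_subdiag (C : Matrix (Fin k) (Fin k) ℝ) (x : ℝ) (i j : Fin k)
    (h : i.1 = j.1 + 1) : hessenbergApprox C x i j = 1 := by
  have : ¬ i ≤ j := by rw [Fin.le_def]; omega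
  simp [hessenbergApprox, this, h]

theorem hessenbergApprox_below (C : Matrix (Fin k) (Fin k) ℝ) (x : ℝ) (i j : Fin k)
    (h : j.1 + 1 < i.1) : hessenbergApprox C x i j = 0 := by
  have h1 : ¬ i ≤ j := by rw [Fin.le_def]; omega
  have h2 : ¬ i.1 = j.1 + 1 := by omega
  simp [hessenbergApprox, h1, h2]

theorem avoidsCube_borderedMatrix_of_hessenberg {X : Matrix (Fin (k + 1)) (Fin (k + 1)) ℤ}
    (h1 : ∀ i j, i.1 = j.1 + 1 → X i j = 1) (h0 : ∀ i j, j.1 + 1 < i.1 → X i j = 0)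
    (hX : X.det ≠ 0) {L : Matrix (Fin (k + 1)) (Fin (k + 1)) ℝ} {c : ℝ} (hc : 0 < c)
    (hXc : μ * |(X.det : ℝ)| < c) (hL : AvoidsCube μ (L * X.map (Int.cast : ℤ → ℝ))) :
    AvoidsCube μ (borderedMatrix c
      (fun j => c * ((X.map (Int.cast : ℤ → ℝ))⁻¹ (Fin.last k) j)) 0 L) := by
  intro w hw
  by_contra! hcon
  set XR := X.map (Int.cast : ℤ → ℝ) with hXR
  have hdet : XR.det = X.det := by
    rw [hXR]; exact ((Int.castRingHom ℝ).map_det X).symm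
  have hdet0 : XR.det ≠ 0 := by rw [hdet]; exact_mod_cast hX
  let m : Fin (k + 1) → ℤ := fun j => w j.succ
  have hadj : XR.adjugate = X.adjugate.map (Int.cast : ℤ → ℝ) := by
    rw [hXR]; exact ((Int.castRingHom ℝ).map_adjugate X).symm
  let y : Fin (k + 1) → ℝ := XR⁻¹.mulVec fun l => (m l : ℝ)
  have hXy : XR.mulVec y = fun l => (m l : ℝ) := by
    simp only [y]
    rw [Matrix.mulVec_mulVec, Matrix.mul_nonsing_inv _ (isUnit_iff_ne_zero.2 hdet0),
      Matrix.one_mulVec]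
  have hrow := hcon 0
  rw [borderedMatrix_mulVec_zero] at hrow
  have h2 : c * (w 0 : ℝ) + ∑ j, c * XR⁻¹ (Fin.last k) j * (w j.succ : ℝ) =
      c * (w 0 + y (Fin.last k)) := by
    simp only [y, Matrix.mulVec, dotProduct, m, mul_add, Finset.mul_sum, mul_assoc]
  rw [h2, abs_mul, abs_of_pos hc] at hrow
  have h3 : (X.det : ℝ) * y (Fin.last k) = ((X.adjugate.mulVec m (Fin.last k) : ℤ) : ℝ) := by
    simp only [y]
    rw [Matrix.inv_def, Ring.inverse_eq_inv', hadj, ← hdet, Matrix.smul_mulVec, Pi.smul_apply,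
      smul_eq_mul, mul_inv_cancel_left₀ hdet0]
    simp [Matrix.mulVec, dotProduct]
  have h4 : X.det * w 0 + X.adjugate.mulVec m (Fin.last k) = 0 := by
    rw [← Int.abs_lt_one_iff]
    have h5 : |((X.det * w 0 + X.adjugate.mulVec m (Fin.last k) : ℤ) : ℝ)| < 1 := by
      rw [Int.cast_add, Int.cast_mul, ← h3, ← mul_add, abs_mul]
      have h6 : 0 < |(X.det : ℝ)| := abs_pos.2 (by exact_mod_cast hX)
      have h7 : c * (|(X.det : ℝ)| * |(w 0 : ℝ) + y (Fin.last k)|) < c * 1 := by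
        calc c * (|(X.det : ℝ)| * |(w 0 : ℝ) + y (Fin.last k)|)
            = |(X.det : ℝ)| * (c * |(w 0 : ℝ) + y (Fin.last k)|) := by ring
          _ ≤ |(X.det : ℝ)| * μ := mul_le_mul_of_nonneg_left hrow h6.le
          _ < c * 1 := by linarith
      exact lt_of_mul_lt_mul_left h7 hc.le
    exact_mod_cast h5
  have h8 : y (Fin.last k) = ((-w 0 : ℤ) : ℝ) := by
    have h9 : (X.det : ℝ) * w 0 + X.det * y (Fin.last k) = 0 := by
      rw [h3]; exact_mod_cast h4
    have h10 : (X.det : ℝ) ≠ 0 := by exact_mod_cast hX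
    have h11 : (w 0 : ℝ) + y (Fin.last k) = 0 := by
      refine (mul_eq_zero.1 (?_ : (X.det : ℝ) * _ = 0)).resolve_left h10
      rw [mul_add, h9]
    push_cast; linarith
  obtain ⟨n, hn⟩ := exists_int_of_hessenberg h1 h0 hXy h8
  have hn0 : n ≠ 0 := by
    rintro rfl
    have hy0 : y = 0 := by rw [hn]; ext; simp
    have hm0 : ∀ l, m l = 0 := fun l => by
      have := congrFun hXy l
      rw [hy0, Matrix.mulVec_zero, Pi.zero_apply] at this
      exact_mod_cast this.symm
    have hw0 : w 0 = 0 := by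
      rw [hy0] at h8
      have : ((-w 0 : ℤ) : ℝ) = 0 := h8.symm
      have : -w 0 = 0 := by exact_mod_cast this
      omega
    exact hw (funext fun i => Fin.cases hw0 hm0 i)
  obtain ⟨a, ha⟩ := hL n hn0
  rw [← Matrix.mulVec_mulVec, ← hn, hXy] at ha
  refine (hcon a.succ).not_gt ?_
  rw [borderedMatrix_mulVec_succ]
  simpa [Matrix.mulVec, dotProduct, m] using ha

end HessenbergApproximation

theorem continuous_borderedMatrix_row {k : ℕ} (c : ℝ) (u : Fin k → ℝ)
    (L : Matrix (Fin k) (Fin k) ℝ) : Continuous fun r => borderedMatrix c r u L := by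
  refine continuous_pi fun i => continuous_pi fun j => ?_
  refine Fin.cases ?_ (fun i => ?_) i
  · refine Fin.cases ?_ (fun j => ?_) j
    · simpa [borderedMatrix] using continuous_const
    · simpa [borderedMatrix] using continuous_apply j
  · simpa [borderedMatrix] using continuous_const

theorem AvoidsCube.of_add_int_mul {k : ℕ} {μ c : ℝ} {r : Fin k → ℝ}
    {L : Matrix (Fin k) (Fin k) ℝ} (p : Fin k → ℤ)
    (h : AvoidsCube μ (borderedMatrix c (fun j => r j - c * p j) 0 L)) :
    AvoidsCube μ (borderedMatrix c r 0 L) := by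
  intro w hw
  obtain ⟨i, hi⟩ := h (Fin.cons (w 0 + ∑ j, p j * w j.succ) fun j => w j.succ) fun h0 => hw (by
    have h1 : ∀ j : Fin k, w j.succ = 0 := fun j => by simpa using congrFun h0 j.succ
    have h2 := congrFun h0 0
    simp only [Fin.cons_zero, h1, mul_zero, Finset.sum_const_zero, add_zero, Pi.zero_apply] at h2
    exact funext fun i => Fin.cases h2 h1 i)
  refine ⟨i, hi.trans_eq ?_⟩
  congr 1
  refine Fin.cases ?_ (fun a => ?_) i
  · simp only [borderedMatrix_mulVec_zero, Fin.cons_zero, Fin.cons_succ]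
    push_cast
    simp only [mul_add, Finset.mul_sum, sub_mul, Finset.sum_sub_distrib, mul_assoc]
    ring
  · simp only [borderedMatrix_mulVec_succ, Fin.cons_succ, Pi.zero_apply, zero_mul]

/-- A unimodular lattice fibring over `L ℤ^k` with cyclic fibres can be moved off the cube by a
diagonal flow and a shear in a direction that is injective on `ℤ^k`. -/
theorem exists_avoidsCube_borderedMatrix {k : ℕ} (hk : 0 < k) {μ : ℝ} (hμ0 : 0 < μ) (hμ1 : μ < 1)
    {L : Matrix (Fin k) (Fin k) ℝ} {y : ℝ} (hy : 0 < y) (hLy : |L.det| * y = 1)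
    {θ : Fin k → ℝ} (hθ : ∀ m : Fin k → ℤ, m ≠ 0 → ∑ i, m i * θ i ≠ 0) (ρ : Fin k → ℝ) :
    ∃ x > 0, ∃ ξ : ℝ, AvoidsCube μ
      (borderedMatrix (x ^ k * y) (fun j => x ^ k * (y * ρ j + ξ * θ j)) 0 (x⁻¹ • L)) := by
  obtain ⟨k, rfl⟩ : ∃ k', k = k' + 1 := ⟨k - 1, by omega⟩
  have hL0 : L.det ≠ 0 := fun h => by simp [h] at hLy
  obtain ⟨C, π, hC, hB1, hB0⟩ := exists_flag_normal_form hL0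
  have hB := avoidsCube_of_flag_normal_form hμ1 hB1 hB0
  have hBdet := abs_det_eq_one_of_flag_normal_form hB1 hB0
  have hCdet : |C.det| = y := by
    rw [Matrix.det_mul, abs_mul] at hBdet
    have hl : |L.det| ≠ 0 := abs_ne_zero.2 hL0
    exact mul_left_cancel₀ hl (hBdet.trans hLy.symm)
  have hC0 : C.det ≠ 0 := fun h => by rw [h, abs_zero] at hCdet; exact hy.ne hCdet
  have hlim := tendsto_hessenbergApprox hC
  have e1 : ∀ᶠ x : ℝ in Filter.atTop,
      AvoidsCube μ (L * (x⁻¹ • (hessenbergApprox C x).map (Int.cast : ℤ → ℝ))) := by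
    have hc : Filter.Tendsto (fun x : ℝ => L * (x⁻¹ • (hessenbergApprox C x).map
        (Int.cast : ℤ → ℝ))) Filter.atTop (nhds (L * C)) :=
      ((continuous_const.matrix_mul continuous_id).tendsto C).comp hlim
    refine hc.eventually (eventually_avoidsCube ?_ hB)
    rw [Matrix.det_mul]
    exact mul_ne_zero hL0 hC0
  have hdetlim : Filter.Tendsto (fun x : ℝ => (x⁻¹ • (hessenbergApprox C x).map
      (Int.cast : ℤ → ℝ)).det) Filter.atTop (nhds C.det) :=
    (continuous_id.matrix_det.tendsto C).comp hlim
  have e2 := hdetlim.eventually_ne hC0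
  have e3 : ∀ᶠ x : ℝ in Filter.atTop,
      μ * |(x⁻¹ • (hessenbergApprox C x).map (Int.cast : ℤ → ℝ)).det| < y := by
    refine (hdetlim.abs.const_mul μ).eventually_lt_const ?_
    rw [hCdet]
    nlinarith
  obtain ⟨x, h1, h2, h3, hx⟩ := (e1.and (e2.and (e3.and (Filter.eventually_gt_atTop 0)))).exists
  let X := hessenbergApprox C x
  have hXdet : (x⁻¹ • X.map (Int.cast : ℤ → ℝ)).det = (x ^ (k + 1))⁻¹ * X.det := by
    rw [Matrix.det_smul, Fintype.card_fin, inv_pow]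
    congr 1
    exact ((Int.castRingHom ℝ).map_det X).symm
  have hxk : 0 < x ^ (k + 1) := pow_pos hx _
  rw [hXdet] at h2 h3
  have hX0 : X.det ≠ 0 := fun h => h2 (by rw [h]; simp)
  have hXc : μ * |(X.det : ℝ)| < x ^ (k + 1) * y := by
    rw [abs_mul, abs_of_pos (inv_pos.2 hxk)] at h3
    calc μ * |(X.det : ℝ)|
        = x ^ (k + 1) * (μ * ((x ^ (k + 1))⁻¹ * |(X.det : ℝ)|)) := by field_simp
      _ < x ^ (k + 1) * y := mul_lt_mul_of_pos_left h3 hxk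
  have hc : 0 < x ^ (k + 1) * y := mul_pos hxk hy
  have hav := avoidsCube_borderedMatrix_of_hessenberg (L := x⁻¹ • L)
    (hessenbergApprox_subdiag C x) (hessenbergApprox_below C x) hX0 hc hXc (by
      rw [Matrix.smul_mul, ← Matrix.mul_smul]; exact h1)
  set τ : Fin (k + 1) → ℝ := fun j => (X.map (Int.cast : ℤ → ℝ))⁻¹ (Fin.last k) j with hτ
  have hnear := (continuous_borderedMatrix_row (x ^ (k + 1) * y) 0 (x⁻¹ • L)).continuousAt.eventually
    (eventually_avoidsCube (by
      rw [det_borderedMatrix_zero, Matrix.det_smul]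
      exact mul_ne_zero hc.ne' (mul_ne_zero (pow_ne_zero _ (inv_ne_zero hx.ne')) hL0)) hav)
  obtain ⟨δ, hδ, hball⟩ := Metric.eventually_nhds_iff.1 hnear
  obtain ⟨ξ, p, hp⟩ := exists_mul_near_mod_one hθ (fun j => τ j - ρ j)
    (δ := δ / (x ^ (k + 1) * y)) (by positivity)
  refine ⟨x, hx, ξ * y, AvoidsCube.of_add_int_mul p (hball ?_)⟩
  refine (dist_pi_lt_iff hδ).2 fun j => ?_
  rw [Real.dist_eq]
  have h4 := hp j
  rw [lt_div_iff₀ hc] at h4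
  refine lt_of_eq_of_lt ?_ h4
  rw [← abs_of_pos hc, ← abs_mul, abs_of_pos hc]
  congr 1
  simp only [hτ, X]
  ring

section RankOneShear

variable {R : Type*} {j : ℕ}

/-- Subtract from each row `i` the multiple `ζ * z i` of the row `i0`. -/
def rowShear {C : Type*} (i0 : R) (N : Matrix R C ℝ) (z : R → ℝ) (ζ : ℝ) : Matrix R C ℝ :=
  Matrix.of fun i l => N i l - ζ * z i * N i0 l

theorem rowShear_zero {C : Type*} (i0 : R) (N : Matrix R C ℝ) (z : R → ℝ) :
    rowShear i0 N z 0 = N := by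
  ext i l
  simp [rowShear]

theorem rowShear_mul {C : Type*} [Fintype C] {C' : Type*} (i0 : R) (N : Matrix R C ℝ)
    (B : Matrix C C' ℝ) (z : R → ℝ) (ζ : ℝ) :
    rowShear i0 (N * B) z ζ = rowShear i0 N z ζ * B := by
  ext i l
  simp only [rowShear, Matrix.of_apply, Matrix.mul_apply, Finset.mul_sum,
    ← Finset.sum_sub_distrib]
  exact Finset.sum_congr rfl fun _ _ => by ring

/-- Column operations turning a nonzero row into a coordinate row. -/
theorem exists_det_ne_zero_row_mul_eq_single {v : Fin j → ℝ} (hv : v ≠ 0) :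
    ∃ (G : Matrix (Fin j) (Fin j) ℝ) (p : Fin j), G.det ≠ 0 ∧
      ∀ l, ∑ m, v m * G m l = if l = p then 1 else 0 := by
  obtain ⟨p, hp⟩ := Function.ne_iff.1 hv
  simp only [Pi.zero_apply] at hp
  refine ⟨(1 : Matrix (Fin j) (Fin j) ℝ).updateRow p
    (fun l => (if l = p then 1 else -v l) / v p), p, ?_, fun l => ?_⟩
  · have h1 := Matrix.cramer_transpose_apply (1 : Matrix (Fin j) (Fin j) ℝ)
      (fun l => (if l = p then 1 else -v l) / v p) p
    rw [← h1, Matrix.transpose_one, Matrix.cramer_one]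
    simpa using hp
  · rw [← Finset.add_sum_erase _ _ (Finset.mem_univ p), Matrix.updateRow_self,
      Finset.sum_congr rfl fun m hm => by
        rw [Matrix.updateRow_ne (Finset.ne_of_mem_erase hm), Matrix.one_apply, mul_ite, mul_one,
          mul_zero], Finset.sum_ite_eq', mul_div_cancel₀ _ hp]
    by_cases hl : l = p <;> simp [hl]

theorem det_rowShear_mul_det {i0 : R} {N : Matrix R (Fin j) ℝ} {G : Matrix (Fin j) (Fin j) ℝ}
    {p : Fin j} (hG : ∀ l, ∑ m, N i0 m * G m l = if l = p then 1 else 0) (z : R → ℝ) (ζ : ℝ)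
    (I : Fin j → R) :
    ((rowShear i0 N z ζ).submatrix I id).det * G.det = ((N * G).submatrix I id).det -
      ζ * (((N * G).updateCol p z).submatrix I id).det := by
  have h1 : ((rowShear i0 N z ζ).submatrix I id) * G =
      ((N * G).submatrix I id).updateCol p
        ((fun a => (N * G) (I a) p) + (-ζ) • fun a => z (I a)) := by
    have h0 : (rowShear i0 N z ζ).submatrix I id * G =
      (rowShear i0 N z ζ * G).submatrix I id := rfl
    rw [h0, ← rowShear_mul]
    ext a l
    simp only [rowShear, Matrix.submatrix_apply, Matrix.of_apply, id]
    rw [show (N * G) i0 l = _ from hG l]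
    by_cases hl : l = p
    · subst hl
      simp [Matrix.updateCol_self]
      ring
    · simp [hl]
  rw [← Matrix.det_mul, h1, Matrix.det_updateCol_add, Matrix.det_updateCol_smul]
  have h2 : ((N * G).submatrix I id).updateCol p (fun a => (N * G) (I a) p) =
      (N * G).submatrix I id := Matrix.updateCol_eq_self _ p
  have h3 : ((N * G).submatrix I id).updateCol p (fun a => z (I a)) =
      ((N * G).updateCol p z).submatrix I id := by
    ext a l
    by_cases hl : l = p
    · subst hl; simp
    · simp [Matrix.updateCol_ne hl]
  rw [h2, h3]
  ring

/-- Minors of a row shear depend affinely on the shear parameter. -/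
theorem det_rowShear_eq (i0 : R) (N : Matrix R (Fin j) ℝ) (z : R → ℝ) (I : Fin j → R) (ζ : ℝ) :
    ((rowShear i0 N z ζ).submatrix I id).det = (N.submatrix I id).det -
      ζ * ((N.submatrix I id).det - ((rowShear i0 N z 1).submatrix I id).det) := by
  by_cases hv : N i0 = 0
  · have h : ∀ ζ, rowShear i0 N z ζ = N := fun ζ => by
      ext i l
      simp [rowShear, hv]
    rw [h, h]
    ring
  · obtain ⟨G, p, hG0, hG⟩ := exists_det_ne_zero_row_mul_eq_single hv
    have h0 := det_rowShear_mul_det hG z 0 I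
    rw [rowShear_zero, zero_mul, sub_zero] at h0
    have h1 := det_rowShear_mul_det hG z 1 I
    have h2 := det_rowShear_mul_det hG z ζ I
    refine mul_right_cancel₀ hG0 ?_
    rw [sub_mul, mul_assoc, sub_mul, h2, h1, h0]
    ring

theorem det_rowShear_of_mem {i0 : R} (N : Matrix R (Fin j) ℝ) {z : R → ℝ} (hz : z i0 = 0) (ζ : ℝ)
    {I : Fin j → R} (hI : ∃ l, I l = i0) :
    ((rowShear i0 N z ζ).submatrix I id).det = (N.submatrix I id).det := by
  obtain ⟨l, hl⟩ := hI
  refine Matrix.det_eq_of_forall_row_eq_smul_add_const (fun a => -(ζ * z (I a))) l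
    (by simp [hl, hz]) fun a m => ?_
  simp [rowShear, hl]
  ring

theorem exists_det_rowShear_ne [Finite R] {i0 : R} {N : Matrix R (Fin j) ℝ} {z : R → ℝ}
    (hN : LinearIndependent ℝ N.col) (hz : ∀ c, N.mulVec c ≠ z) (hN0 : N i0 ≠ 0) :
    ∃ I : Fin j → R, (N.submatrix I id).det ≠ ((rowShear i0 N z 1).submatrix I id).det := by
  obtain ⟨G, p, hG0, hG⟩ := exists_det_ne_zero_row_mul_eq_single hN0
  have hGinv : IsUnit G.det := isUnit_iff_ne_zero.2 hG0
  have hinj : Function.Injective (N * G).mulVec := by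
    intro x y hxy
    rw [← Matrix.mulVec_mulVec, ← Matrix.mulVec_mulVec] at hxy
    have h1 := Matrix.mulVec_injective_iff.2 hN hxy
    exact Matrix.mulVec_injective_iff_isUnit.2 ((Matrix.isUnit_iff_isUnit_det G).2 hGinv) h1
  have hcol : LinearIndependent ℝ ((N * G).updateCol p z).col := by
    rw [← Matrix.mulVec_injective_iff]
    refine (injective_iff_map_eq_zero (Matrix.mulVecLin ((N * G).updateCol p z))).2 fun x hx => ?_
    have hx' : (N * G).mulVec (Function.update x p 0) + x p • z = 0 := by
      rw [← hx]
      ext i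
      simp only [Matrix.mulVecLin_apply, Matrix.mulVec, dotProduct, Pi.add_apply, Pi.smul_apply,
        smul_eq_mul]
      rw [← Finset.add_sum_erase _ _ (Finset.mem_univ p),
        ← Finset.add_sum_erase _ _ (Finset.mem_univ p), Matrix.updateCol_self,
        Function.update_self, mul_zero, zero_add, add_comm, mul_comm]
      congr 1
      refine Finset.sum_congr rfl fun l hl => ?_
      rw [Matrix.updateCol_ne (Finset.ne_of_mem_erase hl),
        Function.update_of_ne (Finset.ne_of_mem_erase hl)]
    have hxp : x p = 0 := by
      by_contra hxp
      refine hz (G.mulVec ((-(x p)⁻¹) • Function.update x p 0)) ?_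
      rw [Matrix.mulVec_mulVec, Matrix.mulVec_smul, eq_neg_of_add_eq_zero_left hx', smul_neg,
        neg_smul, neg_neg, smul_smul, inv_mul_cancel₀ hxp, one_smul]
    rw [hxp, zero_smul, add_zero] at hx'
    have h2 := hinj (hx'.trans (Matrix.mulVec_zero _).symm)
    ext l
    by_cases hl : l = p
    · rw [hl, hxp, Pi.zero_apply]
    · simpa [Function.update_of_ne hl] using congrFun h2 l
  obtain ⟨I, hI, -⟩ := exists_rows_det_ne_zero _ hcol ∅
  refine ⟨I, fun heq => hI ?_⟩
  have h0 := det_rowShear_mul_det hG z 0 I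
  rw [rowShear_zero, zero_mul, sub_zero] at h0
  have h1 := det_rowShear_mul_det hG z 1 I
  rw [← heq, h0] at h1
  linarith

end RankOneShear

/-- A nonzero real vector has a nonzero integral companion lying in every rational subspace whose
real span contains the vector. -/
theorem exists_int_vector_of_mem_span {ι : Type*} [Finite ι] {u : ι → ℝ} (hu : u ≠ 0) :
    ∃ u1 : ι → ℤ, u1 ≠ 0 ∧ ∀ (j : ℕ) (b : Fin j → ι → ℤ) (c : Fin j → ℝ),
      (intCols b).mulVec c = u → ∃ r : Fin j → ℝ, (intCols b).mulVec r = fun l => (u1 l : ℝ) := by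
  have := Fintype.ofFinite ι
  obtain ⟨l0, hl0⟩ := Function.ne_iff.1 hu
  simp only [Pi.zero_apply] at hl0
  obtain ⟨f, hf⟩ : ∃ f : Module.Dual ℚ ℝ, f (u l0) ≠ 0 := by
    by_contra! h
    exact hl0 ((Module.forall_dual_apply_eq_zero_iff ℚ _).1 h)
  obtain ⟨d, hd⟩ := IsLocalization.exist_integer_multiples_of_finset (nonZeroDivisors ℤ)
    (Finset.univ.image fun l => f (u l))
  choose u1 hu1 using fun l => hd (f (u l)) (Finset.mem_image_of_mem _ (Finset.mem_univ l))
  have hd0 : ((d : ℤ) : ℚ) ≠ 0 := by exact_mod_cast nonZeroDivisors.coe_ne_zero d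
  have hu1' : ∀ l, (u1 l : ℚ) = (d : ℤ) * f (u l) := fun l => by
    have := hu1 l
    simpa [Algebra.smul_def] using this
  refine ⟨u1, fun h => ?_, fun j b c hc => ⟨fun m => (((d : ℤ) * f (c m) : ℚ) : ℝ), ?_⟩⟩
  · have := hu1' l0
    rw [h] at this
    exact mul_ne_zero hd0 hf (by simpa using this.symm)
  · funext l
    have h1 : f (u l) = ∑ m, (b m l : ℚ) * f (c m) := by
      rw [← hc]
      simp only [Matrix.mulVec, dotProduct, intCols, Matrix.of_apply, map_sum]
      refine Finset.sum_congr rfl fun m _ => ?_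
      have : (b m l : ℝ) * c m = (b m l : ℚ) • c m := by
        rw [Rat.smul_def, Rat.cast_intCast]
      rw [this, map_smul, smul_eq_mul]
    have h2 : ((u1 l : ℚ) : ℝ) = ∑ m, (b m l : ℝ) * (((d : ℤ) * f (c m) : ℚ) : ℝ) := by
      rw [hu1' l, h1]
      push_cast
      rw [Finset.mul_sum]
      exact Finset.sum_congr rfl fun m _ => by ring
    rw [Rat.cast_intCast] at h2
    rw [h2]
    simp [Matrix.mulVec, dotProduct, intCols]

theorem exists_uniform_minor_bound_of_mem_span {ι : Type*} [Fintype ι] [DecidableEq ι]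
    {M : Matrix ι ι ℝ} (hM : M.det ≠ 0) {i0 : ι}
    (hM0 : ∀ m : ι → ℤ, m ≠ 0 → M.mulVec (fun l => (m l : ℝ)) i0 ≠ 0) {u : ι → ℝ} (hu : u ≠ 0)
    (j : ℕ) : ∃ δ > 0, ∀ b : Fin j → ι → ℤ, LinearIndependent ℤ b →
      (∃ c, (intCols b).mulVec c = u) →
      ∃ I : Fin j → ι, (∃ l, I l = i0) ∧ δ ≤ |((M * intCols b).submatrix I id).det| := by
  obtain ⟨u1, hu10, hu1⟩ := exists_int_vector_of_mem_span hu
  obtain ⟨c1, hc1, hminor⟩ := exists_uniform_minor_bound (R := ι) (j := j) {0} (fun _ => M)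
    (fun _ => True) fun B hB => by
      have h1 : LinearIndependent ℝ (M * B).col := by
        rw [← Matrix.mulVec_injective_iff] at hB ⊢
        intro x y hxy
        rw [← Matrix.mulVec_mulVec, ← Matrix.mulVec_mulVec] at hxy
        exact hB (Matrix.mulVec_injective_iff_isUnit.2
          ((Matrix.isUnit_iff_isUnit_det M).2 (isUnit_iff_ne_zero.2 hM)) hxy)
      obtain ⟨I, hI, -⟩ := exists_rows_det_ne_zero _ h1 ∅
      exact ⟨0, rfl, I, trivial, hI⟩
  set w : ι → ℝ := M.mulVec fun l => (u1 l : ℝ) with hw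
  have hw0 : 0 < |w i0| := abs_pos.2 (hM0 u1 hu10)
  have hW : 0 < 1 + ∑ i, |w i| := by positivity
  refine ⟨min c1 (c1 * |w i0| / ((j + 1) * (1 + ∑ i, |w i|))), by positivity,
    fun b hb hc => ?_⟩
  obtain ⟨c, hc⟩ := hc
  obtain ⟨r, hr⟩ := hu1 j b c hc
  obtain ⟨-, -, I, -, hI⟩ := hminor b hb
  by_cases hmem : ∃ l, I l = i0
  · exact ⟨I, hmem, (min_le_left _ _).trans hI⟩
  set N := M * intCols b with hN
  set A := N.submatrix I id with hA
  have hNr : N.mulVec r = w := by rw [hN, ← Matrix.mulVec_mulVec, hr]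
  have h2 : A.det * w i0 = ∑ l, w (I l) * (A.updateRow l (N i0)).det := by
    have h3 : A.transpose.mulVec (A.transpose.cramer (N i0)) = A.transpose.det • N i0 :=
        Matrix.mulVec_cramer _ _
    rw [Matrix.det_transpose, Matrix.mulVec_transpose] at h3
    have h4 : A.det * w i0 = dotProduct (A.det • N i0) r := by
      rw [smul_dotProduct, smul_eq_mul, ← hNr]
      rfl
    rw [h4, ← h3, ← Matrix.dotProduct_mulVec, dotProduct]
    refine Finset.sum_congr rfl fun l _ => ?_
    rw [Matrix.cramer_transpose_apply, mul_comm]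
    congr 1
    exact congrFun hNr (I l)
  by_contra! hcon
  have h5 : ∀ l, (A.updateRow l (N i0)) = N.submatrix (Function.update I l i0) id := fun l => by
    ext a m
    by_cases ha : a = l
    · subst ha; simp
    · simp [hA, Matrix.updateRow_ne ha, Function.update_of_ne ha]
  have h6 : |A.det * w i0| ≤ ∑ l : Fin j, (∑ i, |w i|) *
      (c1 * |w i0| / ((j + 1) * (1 + ∑ i, |w i|))) := by
    rw [h2]
    refine (Finset.abs_sum_le_sum_abs _ _).trans (Finset.sum_le_sum fun l _ => ?_)
    rw [abs_mul, h5]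
    exact mul_le_mul (Finset.single_le_sum (f := fun i => |w i|) (fun _ _ => abs_nonneg _)
      (Finset.mem_univ _)) ((hcon _ ⟨l, by simp⟩).le.trans (min_le_right _ _)) (abs_nonneg _)
      (Finset.sum_nonneg fun _ _ => abs_nonneg _)
  rw [Finset.sum_const, Finset.card_univ, Fintype.card_fin, nsmul_eq_mul, abs_mul] at h6
  have h7 : c1 * |w i0| ≤ |A.det| * |w i0| := mul_le_mul_of_nonneg_right hI hw0.le
  have h8 : (j : ℝ) * ((∑ i, |w i|) * (c1 * |w i0| / ((j + 1) * (1 + ∑ i, |w i|)))) <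
      c1 * |w i0| := by
    have h9 : 0 ≤ ∑ i, |w i| := Finset.sum_nonneg fun _ _ => abs_nonneg _
    rw [← mul_assoc, ← mul_div_assoc, div_lt_iff₀ (by positivity), mul_comm]
    refine mul_lt_mul_of_pos_left ?_ (by positivity)
    nlinarith [(Nat.cast_nonneg j : (0 : ℝ) ≤ j)]
  linarith

section WeightedShear

variable {ι : Type*} [Fintype ι]

/-- A row shear followed by a diagonal scaling with weights `e`. -/
def weightedShear (i0 : ι) (e : ι → ℝ) (M : Matrix ι ι ℝ) (z : ι → ℝ) (ζ : ℝ) : Matrix ι ι ℝ :=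
  Matrix.of fun i l => e i * rowShear i0 M z ζ i l

theorem det_weightedShear_mul (i0 : ι) (e : ι → ℝ) (M : Matrix ι ι ℝ) (z : ι → ℝ) (ζ : ℝ) {j : ℕ}
    (B : Matrix ι (Fin j) ℝ) (I : Fin j → ι) :
    ((weightedShear i0 e M z ζ * B).submatrix I id).det =
      (∏ l, e (I l)) * ((rowShear i0 (M * B) z ζ).submatrix I id).det := by
  rw [weightedShear, det_submatrix_scaled, rowShear_mul]

theorem mul_abs_det_le_minorSum_weightedShear (i0 : ι) {e : ι → ℝ} (he : ∀ i, 0 < e i)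
    (M : Matrix ι ι ℝ) (z : ι → ℝ) (ζ : ℝ) {j : ℕ} (B : Matrix ι (Fin j) ℝ) (I : Fin j → ι) :
    (∏ l, e (I l)) * |((rowShear i0 (M * B) z ζ).submatrix I id).det| ≤
      minorSum (weightedShear i0 e M z ζ * B) := by
  refine le_trans (le_of_eq ?_) (abs_det_le_minorSum _ I)
  rw [det_weightedShear_mul, abs_mul, abs_of_pos (Finset.prod_pos fun l _ => he (I l))]

theorem det_weightedShear [DecidableEq ι] {i0 : ι} (e : ι → ℝ) (M : Matrix ι ι ℝ) {z : ι → ℝ}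
    (hz : z i0 = 0) (ζ : ℝ) : (weightedShear i0 e M z ζ).det = (∏ i, e i) * M.det := by
  rw [weightedShear, Matrix.det_mul_column]
  congr 1
  refine Matrix.det_eq_of_forall_row_eq_smul_add_const (fun a => -(ζ * z a)) i0
    (by simp [hz]) fun a m => ?_
  simp [rowShear]
  ring

variable {M : ℕ → Matrix ι ι ℝ} {M' : Matrix ι ι ℝ} {z : ℕ → ι → ℝ} {z' : ι → ℝ} {τ : ℕ → ℝ}
  {e : ι → ℝ} {i0 : ι} {x1 x2 ρ : ℝ} {j : ℕ}

theorem tendsto_det_rowShear (hM : Filter.Tendsto M Filter.atTop (nhds M'))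
    (hz : Filter.Tendsto z Filter.atTop (nhds z')) (B : Matrix ι (Fin j) ℝ) (ζ : ℝ)
    (I : Fin j → ι) :
    Filter.Tendsto (fun t => ((rowShear i0 (M t * B) (z t) ζ).submatrix I id).det) Filter.atTop
      (nhds ((rowShear i0 (M' * B) z' ζ).submatrix I id).det) := by
  let F : Matrix ι ι ℝ × (ι → ℝ) → ℝ := fun p =>
      ((rowShear i0 (p.1 * B) p.2 ζ).submatrix I id).det
  have hc : Continuous F := by
    refine Continuous.matrix_det (continuous_matrix fun a l => ?_)
    have h1 : ∀ i, Continuous fun p : Matrix ι ι ℝ × (ι → ℝ) => (p.1 * B) i l := fun i =>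
      ((continuous_fst.matrix_mul continuous_const)).matrix_elem i l
    have h2 : Continuous fun p : Matrix ι ι ℝ × (ι → ℝ) => p.2 (I a) :=
      (continuous_apply _).comp continuous_snd
    exact (h1 _).sub ((continuous_const.mul h2).mul (h1 _))
  have h3 : Filter.Tendsto (fun t => F (M t, z t)) Filter.atTop (nhds (F (M', z'))) :=
    (hc.tendsto (M', z')).comp (hM.prodMk_nhds hz)
  exact h3

theorem eventually_le_minorSum_of_det_ne (he : ∀ i, 0 < e i)
    (hM : Filter.Tendsto M Filter.atTop (nhds M')) (hz : Filter.Tendsto z Filter.atTop (nhds z'))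
    (hτ : Filter.Tendsto (fun t => |τ t|) Filter.atTop Filter.atTop) (hx : x1 ≠ x2)
    {B : Matrix ι (Fin j) ℝ} {I : Fin j → ι}
    (hI : ((M' * B).submatrix I id).det ≠ ((rowShear i0 (M' * B) z' 1).submatrix I id).det) :
    ∀ᶠ t in Filter.atTop, ∃ x ∈ ({x1, x2} : Set ℝ),
      ρ ≤ minorSum (weightedShear i0 e (M t) (z t) (τ t * x) * B) := by
  have h0 := tendsto_det_rowShear (i0 := i0) hM hz B 0 I
  simp only [rowShear_zero] at h0
  have h0' := tendsto_det_rowShear (i0 := i0) hM hz B 1 I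
  have h1 : Filter.Tendsto (fun t => |((M t * B).submatrix I id).det -
      ((rowShear i0 (M t * B) (z t) 1).submatrix I id).det|) Filter.atTop
      (nhds |((M' * B).submatrix I id).det -
        ((rowShear i0 (M' * B) z' 1).submatrix I id).det|) := (h0.sub h0').abs
  have hc : 0 < |((M' * B).submatrix I id).det -
      ((rowShear i0 (M' * B) z' 1).submatrix I id).det| := abs_pos.2 (sub_ne_zero.2 hI)
  have hw : 0 < (∏ l, e (I l)) * |x1 - x2| :=
    mul_pos (Finset.prod_pos fun l _ => he (I l)) (abs_pos.2 (sub_ne_zero.2 hx))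
  have h2 : Filter.Tendsto (fun t => (∏ l, e (I l)) * |x1 - x2| * (|τ t| *
      |((M t * B).submatrix I id).det -
        ((rowShear i0 (M t * B) (z t) 1).submatrix I id).det|)) Filter.atTop Filter.atTop :=
    Filter.Tendsto.const_mul_atTop hw (hτ.atTop_mul_pos hc h1)
  filter_upwards [h2.eventually_ge_atTop (2 * ρ)] with t ht
  by_contra! hcon
  have hF : ∀ x ∈ ({x1, x2} : Set ℝ), (∏ l, e (I l)) *
      |((rowShear i0 (M t * B) (z t) (τ t * x)).submatrix I id).det| < ρ := fun x hx =>
    (mul_abs_det_le_minorSum_weightedShear i0 he _ _ _ B I).trans_lt (hcon x hx)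
  have hF1 := hF x1 (by simp)
  have hF2 := hF x2 (by simp)
  rw [det_rowShear_eq] at hF1 hF2
  set α := ((M t * B).submatrix I id).det
  set c := α - ((rowShear i0 (M t * B) (z t) 1).submatrix I id).det
  have h3 : |τ t| * |c| * |x1 - x2| ≤ |α - τ t * x1 * c| + |α - τ t * x2 * c| := by
    rw [← abs_mul, ← abs_mul]
    refine le_trans (le_of_eq ?_) (abs_sub (α - τ t * x2 * c) (α - τ t * x1 * c)
      |>.trans (le_of_eq (add_comm _ _)))
    congr 1
    ring
  have h4 : 0 < ∏ l, e (I l) := Finset.prod_pos fun l _ => he (I l)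
  nlinarith [mul_le_mul_of_nonneg_left h3 h4.le]

theorem eventually_le_minorSum_of_mem (he : ∀ i, 0 < e i)
    (hM : Filter.Tendsto M Filter.atTop (nhds M')) (hz0 : ∀ t, z t i0 = 0)
    {B : Matrix ι (Fin j) ℝ} {I : Fin j → ι} (hI : ∃ l, I l = i0)
    (hρ : ρ < (∏ l, e (I l)) * |((M' * B).submatrix I id).det|) :
    ∀ᶠ t in Filter.atTop, ∀ ζ, ρ ≤ minorSum (weightedShear i0 e (M t) (z t) ζ * B) := by
  have hz : Filter.Tendsto (fun _ : ℕ => (0 : ι → ℝ)) Filter.atTop (nhds 0) := tendsto_const_nhds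
  have h0 := tendsto_det_rowShear (i0 := i0) hM hz B 0 I
  simp only [rowShear_zero] at h0
  filter_upwards [(h0.abs.const_mul (∏ l, e (I l))).eventually_const_lt hρ] with t ht ζ
  refine ht.le.trans (le_trans (le_of_eq ?_)
    (mul_abs_det_le_minorSum_weightedShear i0 he (M t) (z t) ζ B I))
  rw [det_rowShear_of_mem _ (hz0 t) _ hI]

/-- Integral Plücker coordinates. -/
def intMinors {κ : Type*} {j : ℕ} (b : Fin j → κ → ℤ) : (Fin j → κ) → ℤ := fun c =>
  (Matrix.of fun i l => b l (c i)).det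

theorem det_submatrix_intCols {κ : Type*} (b : Fin j → κ → ℤ) (c : Fin j → κ) :
    ((intCols b).submatrix c id).det = (intMinors b c : ℝ) := by
  have := (Int.castRingHom ℝ).map_det (Matrix.of fun i l => b l (c i))
  rw [intMinors]
  rw [eq_intCast] at this
  rw [this]
  rfl

theorem minorSum_mul_intCols_congr (A : Matrix ι ι ℝ) {b b' : Fin j → ι → ℤ}
    (h : intMinors b = intMinors b') : minorSum (A * intCols b) = minorSum (A * intCols b') := by
  refine Finset.sum_congr rfl fun I _ => ?_
  rw [det_submatrix_mul_eq_sum, det_submatrix_mul_eq_sum]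
  simp only [det_submatrix_intCols, h]

theorem eventually_forall_le_minorSum [DecidableEq ι] (he : ∀ i, 0 < e i)
    (hM : Filter.Tendsto M Filter.atTop (nhds M')) (hM' : M'.det ≠ 0) (hx : x1 ≠ x2)
    (h : ∀ b : Fin j → ι → ℤ, LinearIndependent ℤ b → ∀ᶠ t in Filter.atTop,
      ∃ x ∈ ({x1, x2} : Set ℝ),
        ρ ≤ minorSum (weightedShear i0 e (M t) (z t) (τ t * x) * intCols b)) :
    ∀ᶠ t in Filter.atTop, ∀ b : Fin j → ι → ℤ, LinearIndependent ℤ b →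
      ∃ x ∈ ({x1, x2} : Set ℝ),
        ρ ≤ minorSum (weightedShear i0 e (M t) (z t) (τ t * x) * intCols b) := by
  let f : ℕ → (Fin j → ι) → ℝ := fun t c =>
    ∑ I : Fin j → ι, |∏ l, (M t)⁻¹ (c l) (I l)| *
      ((∏ l, e (I l))⁻¹ * (|ρ| * (|x1| + |x2|) / |x1 - x2|))
  have hf : ∀ c, Filter.Tendsto (fun t => f t c) Filter.atTop
      (nhds (∑ I : Fin j → ι, |∏ l, M'⁻¹ (c l) (I l)| *
        ((∏ l, e (I l))⁻¹ * (|ρ| * (|x1| + |x2|) / |x1 - x2|)))) := fun c => by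
    have h1 := (continuousAt_inv_of_det_ne_zero hM').tendsto.comp hM
    refine tendsto_finsetSum _ fun I _ => Filter.Tendsto.mul_const _ (Filter.Tendsto.abs ?_)
    refine tendsto_finsetProd _ fun l _ => ?_
    exact ((continuous_apply_apply (c l) (I l)).tendsto _).comp h1
  have hbd : ∃ K : ℤ, ∀ c, ∀ᶠ t in Filter.atTop, f t c ≤ K := by
    let g : (Fin j → ι) → ℝ := fun c => ∑ I : Fin j → ι, |∏ l, M'⁻¹ (c l) (I l)| *
        ((∏ l, e (I l))⁻¹ * (|ρ| * (|x1| + |x2|) / |x1 - x2|))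
    refine ⟨⌈∑ c, |g c| + 1⌉, fun c => ?_⟩
    have h2 : g c < (⌈∑ c, |g c| + 1⌉ : ℤ) :=
      calc g c ≤ |g c| := le_abs_self _
        _ ≤ ∑ c, |g c| := Finset.single_le_sum (f := fun c => |g c|) (fun _ _ => abs_nonneg _)
          (Finset.mem_univ c)
        _ < _ := (lt_add_one _).trans_le (Int.le_ceil _)
    exact ((hf c).eventually_lt_const h2).mono fun t ht => ht.le
  obtain ⟨K, hK⟩ := hbd
  let 𝔓 : Set ((Fin j → ι) → ℤ) := {P | P ∈ Set.Icc (fun _ => -K) (fun _ => K) ∧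
    ∃ b : Fin j → ι → ℤ, LinearIndependent ℤ b ∧ intMinors b = P}
  have h𝔓 : 𝔓.Finite := (Set.finite_Icc _ _).subset fun _ hP => hP.1
  have h3 : ∀ᶠ t in Filter.atTop, ∀ P ∈ 𝔓, ∀ b : Fin j → ι → ℤ, intMinors b = P →
      ∃ x ∈ ({x1, x2} : Set ℝ),
        ρ ≤ minorSum (weightedShear i0 e (M t) (z t) (τ t * x) * intCols b) := by
    refine (Filter.eventually_all_finite h𝔓).2 ?_
    rintro P ⟨-, b0, hb0, hP⟩
    filter_upwards [h b0 hb0] with t ⟨x, hx, hρ⟩ b hb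
    exact ⟨x, hx, hρ.trans_eq (minorSum_mul_intCols_congr _ (hP.trans hb.symm))⟩
  have hdet : ∀ᶠ t in Filter.atTop, (M t).det ≠ 0 :=
    ((continuous_id.matrix_det.tendsto M').comp hM).eventually_ne hM'
  filter_upwards [h3, Filter.eventually_all.2 hK, hdet] with t h3 hK hdet b hb
  by_contra! hcon
  refine (h3 (intMinors b) ⟨?_, b, hb, rfl⟩ b rfl).elim fun x hx => (hcon x hx.1).not_ge hx.2
  have h4 : ∀ I : Fin j → ι, |((M t * intCols b).submatrix I id).det| ≤
      (∏ l, e (I l))⁻¹ * (|ρ| * (|x1| + |x2|) / |x1 - x2|) := fun I => by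
    have hF : ∀ x ∈ ({x1, x2} : Set ℝ), (∏ l, e (I l)) *
        |((rowShear i0 (M t * intCols b) (z t) (τ t * x)).submatrix I id).det| ≤ |ρ| :=
      fun x hx => ((mul_abs_det_le_minorSum_weightedShear i0 he _ _ _ _ I).trans
        (hcon x hx).le).trans (le_abs_self _)
    have hF1 := hF x1 (by simp)
    have hF2 := hF x2 (by simp)
    rw [det_rowShear_eq] at hF1 hF2
    set α := ((M t * intCols b).submatrix I id).det
    set c := α - ((rowShear i0 (M t * intCols b) (z t) 1).submatrix I id).det
    have hw : 0 < ∏ l, e (I l) := Finset.prod_pos fun l _ => he (I l)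
    have hx12 : 0 < |x1 - x2| := abs_pos.2 (sub_ne_zero.2 hx)
    rw [inv_mul_eq_div, le_div_iff₀ hw, le_div_iff₀ hx12]
    calc |α| * (∏ l, e (I l)) * |x1 - x2|
        = (∏ l, e (I l)) * |x1 * (α - τ t * x2 * c) - x2 * (α - τ t * x1 * c)| := by
          rw [mul_comm |α|, mul_assoc, ← abs_mul]
          congr 2
          ring
      _ ≤ (∏ l, e (I l)) * (|x1| * |α - τ t * x2 * c| + |x2| * |α - τ t * x1 * c|) := by
          refine mul_le_mul_of_nonneg_left ((abs_sub _ _).trans_eq ?_) hw.le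
          rw [abs_mul, abs_mul]
      _ = |x1| * ((∏ l, e (I l)) * |α - τ t * x2 * c|) +
          |x2| * ((∏ l, e (I l)) * |α - τ t * x1 * c|) := by ring
      _ ≤ |x1| * |ρ| + |x2| * |ρ| := by gcongr
      _ = |ρ| * (|x1| + |x2|) := by ring
  have h5 : ∀ c, |intMinors b c| ≤ K := fun c => by
    have h6 : (intMinors b c : ℝ) = ∑ I : Fin j → ι, (∏ l, (M t)⁻¹ (c l) (I l)) *
        ((M t * intCols b).submatrix I id).det := by
      rw [← det_submatrix_mul_eq_sum, Matrix.nonsing_inv_mul_cancel_left _ _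
        (isUnit_iff_ne_zero.2 hdet), det_submatrix_intCols]
    have h7 : |(intMinors b c : ℝ)| ≤ K := by
      rw [h6]
      refine ((Finset.abs_sum_le_sum_abs _ _).trans (Finset.sum_le_sum fun I _ => ?_)).trans (hK c)
      rw [abs_mul]
      exact mul_le_mul_of_nonneg_left (h4 I) (abs_nonneg _)
    exact_mod_cast h7
  exact ⟨fun c => (abs_le.1 (h5 c)).1, fun c => (abs_le.1 (h5 c)).2⟩

end WeightedShear

theorem linearIndependent_col_mul_intCols {ι : Type*} [Fintype ι] [DecidableEq ι]
    {M : Matrix ι ι ℝ} (hM : M.det ≠ 0) {j : ℕ} {b : Fin j → ι → ℤ}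
    (hb : LinearIndependent ℤ b) : LinearIndependent ℝ (M * intCols b).col := by
  rw [← Matrix.mulVec_injective_iff]
  obtain ⟨I, hI⟩ := exists_rows_intCols_det_ne_zero hb
  intro x y hxy
  rw [← Matrix.mulVec_mulVec, ← Matrix.mulVec_mulVec] at hxy
  have h1 := Matrix.mulVec_injective_iff_isUnit.2
    ((Matrix.isUnit_iff_isUnit_det M).2 (isUnit_iff_ne_zero.2 hM)) hxy
  refine Matrix.mulVec_injective_iff_isUnit.2
    ((Matrix.isUnit_iff_isUnit_det _).2 (isUnit_iff_ne_zero.2 hI)) ?_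
  funext l
  exact congrFun h1 (I l)

/-- The weights `κD * S ^ (k - 1)` on the row `i0` and `κZ / S` on the other rows. -/
noncomputable def fiberWeight {k : ℕ} (i0 : Fin k) (κZ κD S : ℝ) (i : Fin k) : ℝ :=
  if i = i0 then κD * S ^ (k - 1) else κZ * S⁻¹

section FiberWeight

variable {k : ℕ} {i0 : Fin k} {κZ κD S : ℝ}

theorem fiberWeight_pos (hZ : 0 < κZ) (hD : 0 < κD) (hS : 0 < S) (i : Fin k) :
    0 < fiberWeight i0 κZ κD S i := by
  unfold fiberWeight
  split_ifs <;> positivity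

theorem prod_fiberWeight_of_mem {j : ℕ} {I : Fin (j + 1) → Fin k} (hI : Function.Injective I)
    {l0 : Fin (j + 1)} (hl0 : I l0 = i0) :
    ∏ l, fiberWeight i0 κZ κD S (I l) = κD * S ^ (k - 1) * (κZ * S⁻¹) ^ j := by
  rw [← Finset.mul_prod_erase _ _ (Finset.mem_univ l0), Finset.prod_congr rfl fun l hl => by
    rw [fiberWeight, if_neg fun h => Finset.ne_of_mem_erase hl (hI (h.trans hl0.symm))],
    Finset.prod_const, Finset.card_erase_of_mem (Finset.mem_univ _), Finset.card_univ,
    Fintype.card_fin, Nat.add_sub_cancel, fiberWeight, if_pos hl0]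

theorem prod_fiberWeight (hκ : κZ ^ (k - 1) * κD = 1) (hS : S ≠ 0) :
    ∏ i, fiberWeight i0 κZ κD S i = 1 := by
  obtain ⟨k, rfl⟩ : ∃ k', k = k' + 1 := ⟨k - 1, by have := i0.2; omega⟩
  have := prod_fiberWeight_of_mem (i0 := i0) (κZ := κZ) (κD := κD) (S := S)
    Function.injective_id (l0 := i0) rfl
  simp only [id] at this
  rw [this, ← hκ]
  simp only [Nat.add_sub_cancel]
  rw [mul_pow, inv_pow]
  field_simp

end FiberWeight

theorem eventually_eventually_le_minorSum {k : ℕ} {i0 : Fin k}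
    {M : ℕ → Matrix (Fin k) (Fin k) ℝ} {M' : Matrix (Fin k) (Fin k) ℝ} {z : ℕ → Fin k → ℝ}
    {z' : Fin k → ℝ} {τ : ℕ → ℝ} (hM : Filter.Tendsto M Filter.atTop (nhds M'))
    (hz : Filter.Tendsto z Filter.atTop (nhds z')) (hz0 : ∀ t, z t i0 = 0)
    (hz' : k = 1 ∨ z' ≠ 0) {V : ℝ} (hV : 0 < V) (hdet : ∀ t, |(M t).det| = V)
    (hM0 : ∀ m : Fin k → ℤ, m ≠ 0 → M'.mulVec (fun l => (m l : ℝ)) i0 ≠ 0)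
    (hτ : Filter.Tendsto (fun t => |τ t|) Filter.atTop Filter.atTop) {κZ κD : ℝ}
    (hZ : 0 < κZ) (hD : 0 < κD) (hκ : κZ ^ (k - 1) * κD = 1) {x1 x2 : ℝ} (hx : x1 ≠ x2) :
    ∀ᶠ S in Filter.atTop, ∀ᶠ t in Filter.atTop, ∀ (j : ℕ) (b : Fin (j + 1) → Fin k → ℤ),
      LinearIndependent ℤ b → ∃ x ∈ ({x1, x2} : Set ℝ),
        V ≤ minorSum (weightedShear i0 (fiberWeight i0 κZ κD S) (M t) (z t) (S ^ k * τ t * x) *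
          intCols b) := by
  have hM'V : |M'.det| = V := by
    have h1 := ((continuous_id.matrix_det.tendsto M').comp hM).abs
    refine tendsto_nhds_unique h1 ?_
    simp [hdet]
  have hM' : M'.det ≠ 0 := fun h => by rw [h, abs_zero] at hM'V; exact hV.ne hM'V
  have key : ∀ j ∈ Finset.range k, ∀ᶠ S in Filter.atTop, ∀ᶠ t in Filter.atTop,
      ∀ b : Fin (j + 1) → Fin k → ℤ, LinearIndependent ℤ b → ∃ x ∈ ({x1, x2} : Set ℝ),
        V ≤ minorSum (weightedShear i0 (fiberWeight i0 κZ κD S) (M t) (z t) (S ^ k * τ t * x) *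
          intCols b) := by
    intro j hj
    rcases (Nat.succ_le_of_lt (Finset.mem_range.1 hj)).eq_or_lt with hjk | hjk
    · filter_upwards [Filter.eventually_gt_atTop 0] with S hS
      refine Filter.Eventually.of_forall fun t b hb => ⟨x1, by simp, ?_⟩
      refine le_trans (le_of_eq ?_) (abs_det_le_minorSum_intCols hb (by simpa using hjk) _)
      rw [det_weightedShear _ _ (hz0 t), prod_fiberWeight hκ hS.ne', one_mul, hdet]
    have hz'0 : z' ≠ 0 := hz'.resolve_left (by omega)
    have hu : M'⁻¹.mulVec z' ≠ 0 := fun h => hz'0 (by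
      have := congrArg M'.mulVec h
      rwa [Matrix.mulVec_mulVec, Matrix.mul_nonsing_inv _ (isUnit_iff_ne_zero.2 hM'),
        Matrix.one_mulVec, Matrix.mulVec_zero] at this)
    obtain ⟨δ, hδ, hmem⟩ := exists_uniform_minor_bound_of_mem_span hM' hM0 hu (j + 1)
    have hlarge : ∀ᶠ S : ℝ in Filter.atTop, V < κD * κZ ^ j * δ * S :=
      (Filter.Tendsto.const_mul_atTop (by positivity) Filter.tendsto_id).eventually_gt_atTop V
    filter_upwards [Filter.eventually_ge_atTop 1, hlarge] with S hS1 hSV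
    have hS0 : 0 < S := zero_lt_one.trans_le hS1
    have he := fiberWeight_pos (i0 := i0) hZ hD hS0
    have hτ' : Filter.Tendsto (fun t => |S ^ k * τ t|) Filter.atTop Filter.atTop := by
      simp only [abs_mul]
      exact Filter.Tendsto.const_mul_atTop (abs_pos.2 (pow_ne_zero _ hS0.ne')) hτ
    refine eventually_forall_le_minorSum he hM hM' hx fun b hb => ?_
    by_cases hc : ∃ c, (intCols b).mulVec c = M'⁻¹.mulVec z'
    · obtain ⟨I, ⟨l0, hl0⟩, hI⟩ := hmem b hb hc
      have hinj : Function.Injective I := by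
        intro p q hpq
        by_contra hne
        refine (hδ.trans_le hI).ne' ?_
        rw [Matrix.det_zero_of_row_eq hne (by ext l; simp [hpq]), abs_zero]
      have h1 : V < (∏ l, fiberWeight i0 κZ κD S (I l)) *
          |((M' * intCols b).submatrix I id).det| := by
        refine hSV.trans_le (le_trans ?_ (mul_le_mul_of_nonneg_left hI
          (Finset.prod_nonneg fun l _ => (he _).le)))
        rw [prod_fiberWeight_of_mem hinj hl0]
        have h2 : S ≤ S ^ (k - 1) * S⁻¹ ^ j := by
          obtain ⟨d, hd⟩ : ∃ d, k - 1 = j + 1 + d := ⟨k - 1 - (j + 1), by simp at hjk; omega⟩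
          have h3 : S ^ (k - 1) * S⁻¹ ^ j = S * S ^ d := by
            rw [hd, pow_add, pow_add, inv_pow]
            field_simp
          rw [h3]
          exact le_mul_of_one_le_right hS0.le (one_le_pow₀ hS1)
        calc κD * κZ ^ j * δ * S ≤ κD * κZ ^ j * δ * (S ^ (k - 1) * S⁻¹ ^ j) := by gcongr
          _ = κD * S ^ (k - 1) * (κZ * S⁻¹) ^ j * δ := by rw [mul_pow]; ring
      filter_upwards [eventually_le_minorSum_of_mem he hM hz0 ⟨l0, hl0⟩ h1] with t ht
      exact ⟨x1, by simp, ht _⟩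
    · obtain ⟨I, hI⟩ := exists_det_rowShear_ne (i0 := i0) (N := M' * intCols b) (z := z')
        (linearIndependent_col_mul_intCols hM' hb) (fun c hcz => hc ⟨c, by
          rw [← hcz, ← Matrix.mulVec_mulVec, Matrix.mulVec_mulVec,
            Matrix.nonsing_inv_mul _ (isUnit_iff_ne_zero.2 hM'), Matrix.one_mulVec]⟩)
        fun h0 => hM0 (b 0) (hb.ne_zero 0) (congrFun h0 0)
      exact eventually_le_minorSum_of_det_ne he hM hz hτ' hx hI
  have h1 := (Filter.eventually_all_finset (Finset.range k)).2 key
  filter_upwards [h1] with S hS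
  filter_upwards [(Filter.eventually_all_finset (Finset.range k)).2 hS] with t ht j b hb
  refine ht j (Finset.mem_range.2 ?_) b hb
  have := hb.fintype_card_le_finrank
  simpa using this

theorem weightedShear_mulVec {ι : Type*} [Fintype ι] (i0 : ι) (e : ι → ℝ) (M : Matrix ι ι ℝ)
    (z : ι → ℝ) (ζ : ℝ) (w : ι → ℝ) (i : ι) :
    (weightedShear i0 e M z ζ).mulVec w i = e i * (rowShear i0 M z ζ).mulVec w i := by
  simp [weightedShear, Matrix.mulVec, dotProduct, Finset.mul_sum, mul_assoc]

theorem fiberWeight_eq_mul {k : ℕ} (i0 : Fin k) (κZ κD S : ℝ) (i : Fin k) :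
    fiberWeight i0 κZ κD S i = (if i = i0 then κD else κZ) * fiberWeight i0 1 1 S i := by
  unfold fiberWeight
  split_ifs <;> ring

theorem exists_mem_sdiff_of_volume_le {J : Set ℝ} {v : ℝ} (hv : 0 < v)
    (hJ : volume J = ENNReal.ofReal v) (B : ℕ → Set ℝ)
    (n : ℕ) (hB : ∀ i < n, volume (B i) ≤ ENNReal.ofReal (v * (1 / 2) ^ (i + 2))) :
    ∃ x ∈ J, ∀ i < n, x ∉ B i := by
  by_contra! h
  have h1 : J ⊆ ⋃ i ∈ Finset.range n, B i := fun x hx => by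
    obtain ⟨i, hi, hxi⟩ := h x hx
    simp only [Set.mem_iUnion, Finset.mem_range]
    exact ⟨i, hi, hxi⟩
  have h2 : ENNReal.ofReal v ≤ ENNReal.ofReal (v / 2) := by
    calc ENNReal.ofReal v = volume J := hJ.symm
      _ ≤ volume (⋃ i ∈ Finset.range n, B i) := measure_mono h1
      _ ≤ ∑ i ∈ Finset.range n, volume (B i) := measure_biUnion_finset_le _ _
      _ ≤ ∑ i ∈ Finset.range n, ENNReal.ofReal (v * (1 / 2) ^ (i + 2)) :=
        Finset.sum_le_sum fun i hi => hB i (Finset.mem_range.1 hi)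
      _ = ENNReal.ofReal (∑ i ∈ Finset.range n, v * (1 / 2) ^ (i + 2)) :=
        (ENNReal.ofReal_sum_of_nonneg fun i _ => by positivity).symm
      _ ≤ ENNReal.ofReal (v / 2) := by
        refine ENNReal.ofReal_le_ofReal ?_
        have h3 : ∑ i ∈ Finset.range n, v * (1 / 2 : ℝ) ^ (i + 2)
            = v / 4 * ∑ i ∈ Finset.range n, (1 / 2 : ℝ) ^ i := by
          rw [Finset.mul_sum]
          exact Finset.sum_congr rfl fun i _ => by ring
        have h4 : ∑ i ∈ Finset.range n, (1 / 2 : ℝ) ^ i ≤ 2 := sum_geometric_two_le n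
        rw [h3]
        nlinarith
  rw [ENNReal.ofReal_le_ofReal_iff (by positivity)] at h2
  linarith

theorem exists_eventually_forall_lt_abs_mulVec {k : ℕ} {i0 : Fin k}
    {M : ℕ → Matrix (Fin k) (Fin k) ℝ} {M' : Matrix (Fin k) (Fin k) ℝ} {z : ℕ → Fin k → ℝ}
    {z' : Fin k → ℝ} {τ : ℕ → ℝ} (hM : Filter.Tendsto M Filter.atTop (nhds M'))
    (hz : Filter.Tendsto z Filter.atTop (nhds z')) (hz0 : ∀ t, z t i0 = 0)
    (hz' : k = 1 ∨ z' ≠ 0) {V : ℝ} (hV : 0 < V) (hdet : ∀ t, |(M t).det| = V)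
    (hM0 : ∀ m : Fin k → ℤ, m ≠ 0 → M'.mulVec (fun l => (m l : ℝ)) i0 ≠ 0)
    (hτ : Filter.Tendsto (fun t => |τ t|) Filter.atTop Filter.atTop) :
    ∃ η : ℕ → ℝ, (∀ R, 0 < η R) ∧ ∀ n : ℕ, ∀ᶠ S in Filter.atTop, ∀ᶠ t in Filter.atTop,
      ∃ x ∈ Set.Icc (1 / 2 : ℝ) (3 / 2), ∀ R < n, ∀ w : Fin k → ℤ, w ≠ 0 →
        (∀ i ≠ i0, |(weightedShear i0 (fiberWeight i0 1 1 S) (M t) (z t)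
          (S ^ k * τ t * x)).mulVec (fun l => (w l : ℝ)) i| ≤ R + 1) →
        η R < |(weightedShear i0 (fiberWeight i0 1 1 S) (M t) (z t)
          (S ^ k * τ t * x)).mulVec (fun l => (w l : ℝ)) i0| := by
  obtain ⟨r0, hr0, -, hKM⟩ := exists_radius_volume_short_vectors_le (Fin k) (Fin k)
    (![fun _ => 1, fun x => x] : Fin 2 → ℝ → ℝ) 1 (by
      intro p
      fin_cases p
      · exact analyticAt_const
      · exact analyticAt_id)
  set r := min r0 (1 / 2) with hr
  have hrpos : 0 < r := lt_min hr0 (by norm_num)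
  have hr2 : r ≤ 1 / 2 := min_le_right _ _
  choose ε hε hKM using fun R : ℕ => hKM r hrpos (min_le_left _ _)
    (2 * r * (1 / 2) ^ (R + 2)) (by positivity) V hV
  set κZ : ℕ → ℝ := fun R => ε R / (R + 1) with hκZ
  have hZ : ∀ R, 0 < κZ R := fun R => div_pos (hε R) (by positivity)
  set κD : ℕ → ℝ := fun R => (κZ R ^ (k - 1))⁻¹ with hκD
  have hD : ∀ R, 0 < κD R := fun R => inv_pos.2 (pow_pos (hZ R) _)
  refine ⟨fun R => ε R / κD R, fun R => div_pos (hε R) (hD R), fun n => ?_⟩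
  have h1 := (Filter.eventually_all_finset (Finset.range n)).2 fun R _ =>
    eventually_eventually_le_minorSum hM hz hz0 hz' hV hdet hM0 hτ (hZ R) (hD R)
      (mul_inv_cancel₀ (pow_pos (hZ R) (k - 1)).ne') (x1 := 1) (x2 := 1 + r) (by linarith)
  filter_upwards [h1] with S hS
  filter_upwards [(Filter.eventually_all_finset (Finset.range n)).2 hS] with t ht
  set H : ℕ → ℝ → Matrix (Fin k) (Fin k) ℝ := fun R x =>
    weightedShear i0 (fiberWeight i0 (κZ R) (κD R) S) (M t) (z t) (S ^ k * τ t * x) with hH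
  obtain ⟨x, hx, hxn⟩ := exists_mem_sdiff_of_volume_le (J := Metric.closedBall (1 : ℝ) r)
    (v := 2 * r) (by positivity) (Real.volume_closedBall 1 r)
    (fun R => {x ∈ Metric.closedBall (1 : ℝ) r | ∃ w : Fin k → ℤ, w ≠ 0 ∧
      ∀ i, |∑ l, H R x i l * (w l : ℝ)| ≤ ε R}) n (by
      intro R hR
      refine hKM R (H R) ?_ fun j b hb => ?_
      · intro i l
        have : (fun x => H R x i l) =
            (fiberWeight i0 (κZ R) (κD R) S i * M t i l) • (fun _ => (1 : ℝ)) +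
            (-fiberWeight i0 (κZ R) (κD R) S i * (S ^ k * τ t) * z t i * M t i0 l) •
              (fun x : ℝ => x) := by
          funext x
          simp only [hH, weightedShear, rowShear, Matrix.of_apply, Pi.add_apply, Pi.smul_apply,
            smul_eq_mul]
          ring
        rw [this]
        exact Submodule.add_mem _ (Submodule.smul_mem _ _ (Submodule.subset_span ⟨0, rfl⟩))
          (Submodule.smul_mem _ _ (Submodule.subset_span ⟨1, rfl⟩))
      · obtain ⟨x, hx, h⟩ := ht R (Finset.mem_range.2 hR) j b hb
        refine ⟨x, ?_, h⟩
        rcases hx with rfl | rfl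
        · exact Metric.mem_closedBall_self hrpos.le
        · simp [Metric.mem_closedBall, abs_of_pos hrpos])
  refine ⟨x, ?_, fun R hR w hw hwi => ?_⟩
  · rw [Metric.mem_closedBall, Real.dist_eq, abs_le] at hx
    exact ⟨by linarith, by linarith⟩
  by_contra! hcon
  refine hxn R hR ⟨hx, w, hw, fun i => ?_⟩
  have h2 : ∑ l, H R x i l * (w l : ℝ) = (if i = i0 then κD R else κZ R) *
      (weightedShear i0 (fiberWeight i0 1 1 S) (M t) (z t)
          (S ^ k * τ t * x)).mulVec (fun l => (w l : ℝ)) i := by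
    rw [weightedShear_mulVec, ← mul_assoc, ← fiberWeight_eq_mul, ← weightedShear_mulVec]
    rfl
  rw [h2, abs_mul]
  split_ifs with hi
  · subst hi
    rw [abs_of_pos (hD R)]
    exact (le_div_iff₀' (hD R)).1 hcon
  · rw [abs_of_pos (hZ R)]
    calc κZ R * _ ≤ κZ R * (R + 1) := mul_le_mul_of_nonneg_left (hwi i hi) (hZ R).le
      _ = ε R := div_mul_cancel₀ _ (by positivity)

section Trapped

variable {k : ℕ}

theorem borderedMatrix_mul_borderedMatrix (c c' : ℝ) (r r' u : Fin k → ℝ)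
    (L L' : Matrix (Fin k) (Fin k) ℝ) :
    borderedMatrix c r u L * borderedMatrix c' r' 0 L' =
      borderedMatrix (c * c') (fun j => c * r' j + ∑ l, r l * L' l j) (fun i => u i * c')
        (Matrix.of fun i j => u i * r' j + (L * L') i j) := by
  ext i j
  refine Fin.cases ?_ (fun i => ?_) i <;> refine Fin.cases ?_ (fun j => ?_) j <;>
  simp [borderedMatrix, Matrix.mul_apply, Fin.sum_univ_succ]

theorem det_borderedMatrix_add_vecMulVec (c : ℝ) (ρ u : Fin k → ℝ)
    (L : Matrix (Fin k) (Fin k) ℝ) :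
    (borderedMatrix c (fun j => c * ρ j) u (L + Matrix.vecMulVec u ρ)).det = c * L.det := by
  have h1 : borderedMatrix c (fun j => c * ρ j) u (L + Matrix.vecMulVec u ρ) =
      borderedMatrix c 0 u L * borderedMatrix 1 ρ 0 1 := by
    rw [borderedMatrix_mul_borderedMatrix]
    congr 1
    · simp
    · simp
    · simp
    · ext i j
      simp [Matrix.vecMulVec_apply, add_comm]
  have h2 : (borderedMatrix c 0 u L).transpose = borderedMatrix c u 0 L.transpose := by
    ext i j
    refine Fin.cases ?_ (fun i => ?_) i <;> refine Fin.cases ?_ (fun j => ?_) j <;>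
    simp [borderedMatrix]
  rw [h1, Matrix.det_mul, det_borderedMatrix_zero, ← Matrix.det_transpose (borderedMatrix c 0 u L),
    h2, det_borderedMatrix_zero]
  simp

/-- In frame coordinates `(b, v)`, the map `(b, v) ↦ (x ^ k (b + ξ v i0), x⁻¹ E v)`. -/
noncomputable def flowMatrix (i0 : Fin k) (E : Matrix (Fin k) (Fin k) ℝ) (x ξ : ℝ) :
    Matrix (Fin (k + 1)) (Fin (k + 1)) ℝ :=
  borderedMatrix (x ^ k) (Pi.single i0 (x ^ k * ξ)) 0 (x⁻¹ • E)

/-- No point of the orbit of `Δ` under the flow avoids the cube. -/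
def IsTrapped (μ : ℝ) (i0 : Fin k) (E : Matrix (Fin k) (Fin k) ℝ)
    (Δ : Matrix (Fin (k + 1)) (Fin (k + 1)) ℝ) : Prop :=
  ∀ x > 0, ∀ ξ, ¬ AvoidsCube μ (flowMatrix i0 E x ξ * Δ)

theorem flowMatrix_mul_borderedMatrix (i0 : Fin k) (E : Matrix (Fin k) (Fin k) ℝ) (x ξ c : ℝ)
    (r u : Fin k → ℝ) (L : Matrix (Fin k) (Fin k) ℝ) :
    flowMatrix i0 E x ξ * borderedMatrix c r u L =
      borderedMatrix (x ^ k * (c + ξ * u i0)) (fun j => x ^ k * (r j + ξ * L i0 j))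
        (fun i => x⁻¹ * E.mulVec u i) (x⁻¹ • (E * L)) := by
  ext i j
  refine Fin.cases ?_ (fun i => ?_) i <;> refine Fin.cases ?_ (fun j => ?_) j <;>
  simp [flowMatrix, borderedMatrix, Matrix.mul_apply, Fin.sum_univ_succ, Pi.single_apply,
    Matrix.mulVec, dotProduct, Finset.mul_sum] <;> ring_nf

theorem det_flowMatrix (i0 : Fin k) (E : Matrix (Fin k) (Fin k) ℝ) {x : ℝ} (hx : x ≠ 0) (ξ : ℝ) :
    (flowMatrix i0 E x ξ).det = E.det := by
  rw [flowMatrix, det_borderedMatrix_zero, Matrix.det_smul, Fintype.card_fin, inv_pow,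
    mul_inv_cancel_left₀ (pow_ne_zero _ hx)]

theorem flowMatrix_mul_flowMatrix (i0 : Fin k) (E : Matrix (Fin k) (Fin k) ℝ) {x S : ℝ}
    (hS : S ≠ 0) (ξ ξ' : ℝ) :
    flowMatrix i0 E x ξ * flowMatrix i0 1 S ξ' =
      flowMatrix i0 E (x * S) (ξ' + ξ * (S ^ (k + 1))⁻¹) := by
  rw [flowMatrix, flowMatrix, flowMatrix, ← flowMatrix, flowMatrix_mul_borderedMatrix]
  congr 1
  · simp [mul_pow]
  · funext j
    by_cases hj : j = i0
    · subst hj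
      simp
      field_simp
      ring
    · simp [hj, Matrix.one_apply_ne' hj]
  · funext i
    simp
  · rw [mul_inv, Matrix.mul_smul, Matrix.mul_one, smul_smul]

theorem IsTrapped.flowMatrix_mul_unimodular {μ : ℝ} {i0 : Fin k} {E : Matrix (Fin k) (Fin k) ℝ}
    {Δ : Matrix (Fin (k + 1)) (Fin (k + 1)) ℝ} (h : IsTrapped μ i0 E Δ) {S : ℝ} (hS : 0 < S)
    (ξ : ℝ) {γ : Matrix (Fin (k + 1)) (Fin (k + 1)) ℤ} (hγ : γ.det = 1) :
    IsTrapped μ i0 E (flowMatrix i0 1 S ξ * Δ * γ.map (Int.cast : ℤ → ℝ)) := by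
  intro x hx ξ' hcon
  rw [← Matrix.mul_assoc] at hcon
  have := hcon.of_mul_unimodular hγ
  rw [← Matrix.mul_assoc, flowMatrix_mul_flowMatrix i0 E hS.ne'] at this
  exact h _ (mul_pos hx hS) _ this

theorem not_isTrapped_of_tendsto (hk : 0 < k) {μ : ℝ} (hμ0 : 0 < μ) (hμ1 : μ < 1) {i0 : Fin k}
    {E L : Matrix (Fin k) (Fin k) ℝ} {y : ℝ} (hy : 0 < y) (hdet : |E.det| * |L.det| * y = 1)
    (hL : ∀ m : Fin k → ℤ, m ≠ 0 → L.mulVec (fun l => (m l : ℝ)) i0 ≠ 0) {ρ : Fin k → ℝ}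
    {Δ : ℕ → Matrix (Fin (k + 1)) (Fin (k + 1)) ℝ}
    (hΔ : Filter.Tendsto Δ Filter.atTop (nhds (borderedMatrix y (fun j => y * ρ j) 0 L))) :
    ¬ ∀ n, IsTrapped μ i0 E (Δ n) := by
  intro h
  obtain ⟨x, hx, ξ, hav⟩ := exists_avoidsCube_borderedMatrix hk hμ0 hμ1 (L := E * L) hy
    (by rw [Matrix.det_mul, abs_mul, hdet]) (θ := L i0) (fun m hm => by
      have := hL m hm
      simpa [Matrix.mulVec, dotProduct, mul_comm] using this) ρ
  have h1 : flowMatrix i0 E x ξ * borderedMatrix y (fun j => y * ρ j) 0 L =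
      borderedMatrix (x ^ k * y) (fun j => x ^ k * (y * ρ j + ξ * L i0 j)) 0
        (x⁻¹ • (E * L)) := by
    rw [flowMatrix_mul_borderedMatrix]
    congr 1
    · simp
    · funext i
      simp
  rw [← h1] at hav
  have h2 : (flowMatrix i0 E x ξ * borderedMatrix y (fun j => y * ρ j) 0 L).det ≠ 0 := by
    rw [Matrix.det_mul, det_flowMatrix i0 E hx.ne', det_borderedMatrix_zero]
    intro h0
    have h4 : E.det = 0 ∨ L.det = 0 := by simpa [hy.ne'] using h0
    rcases h4 with h4 | h4 <;> simp [h4] at hdet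
  have h3 := (((continuous_const (y := flowMatrix i0 E x ξ)).matrix_mul continuous_id).tendsto
    (borderedMatrix y (fun j => y * ρ j) 0 L)).comp hΔ
  obtain ⟨n, hn⟩ := (h3.eventually (eventually_avoidsCube h2 hav)).exists
  exact h n x hx ξ hn

/-- Multiply row `0` by `T` and row `i0.succ` by `T⁻¹`. -/
noncomputable def dilate (i0 : Fin k) (T : ℝ) (A : Matrix (Fin (k + 1)) (Fin (k + 1)) ℝ) :
    Matrix (Fin (k + 1)) (Fin (k + 1)) ℝ :=
  borderedMatrix (T * A 0 0) (fun j => T * A 0 j.succ)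
    (fun i => (if i = i0 then T⁻¹ else 1) * A i.succ 0)
    (Matrix.of fun i j => (if i = i0 then T⁻¹ else 1) * A i.succ j.succ)

theorem dilate_apply_zero (i0 : Fin k) (T : ℝ) (A : Matrix (Fin (k + 1)) (Fin (k + 1)) ℝ)
    (j : Fin (k + 1)) : dilate i0 T A 0 j = T * A 0 j := by
  refine Fin.cases ?_ (fun j => ?_) j <;> simp [dilate, borderedMatrix]

theorem dilate_apply_succ (i0 : Fin k) (T : ℝ) (A : Matrix (Fin (k + 1)) (Fin (k + 1)) ℝ)
    (i : Fin k) (j : Fin (k + 1)) :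
    dilate i0 T A i.succ j = (if i = i0 then T⁻¹ else 1) * A i.succ j := by
  refine Fin.cases ?_ (fun j => ?_) j <;> simp [dilate, borderedMatrix]

theorem dilate_mul (i0 : Fin k) (T : ℝ) (A B : Matrix (Fin (k + 1)) (Fin (k + 1)) ℝ) :
    dilate i0 T (A * B) = dilate i0 T A * B := by
  ext i j
  refine Fin.cases ?_ (fun i => ?_) i
  · simp [dilate_apply_zero, Matrix.mul_apply, Finset.mul_sum, mul_assoc]
  · simp only [dilate_apply_succ, Matrix.mul_apply, Finset.mul_sum, mul_assoc]

theorem det_dilate (i0 : Fin k) {T : ℝ} (hT : T ≠ 0)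
    (A : Matrix (Fin (k + 1)) (Fin (k + 1)) ℝ) : (dilate i0 T A).det = A.det := by
  have h1 : dilate i0 T A = Matrix.of fun i j =>
      (Fin.cons T (fun i => if i = i0 then T⁻¹ else 1) : Fin (k + 1) → ℝ) i * A i j := by
    ext i j
    refine Fin.cases ?_ (fun i => ?_) i
    · simp [dilate_apply_zero]
    · simp [dilate_apply_succ]
  rw [h1, Matrix.det_mul_column, Fin.prod_univ_succ]
  simp [Finset.prod_ite_eq', hT]

/-- The quotient of `A` by its column `0`, with row `i0` the determinant against row `0`. -/
noncomputable def quotientMatrix (i0 : Fin k) (A : Matrix (Fin (k + 1)) (Fin (k + 1)) ℝ) :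
    Matrix (Fin k) (Fin k) ℝ :=
  Matrix.of fun i j =>
    if i = i0 then A 0 j.succ * A i0.succ 0 - A i0.succ j.succ * A 0 0
    else A i.succ j.succ - A i0.succ j.succ / A i0.succ 0 * A i.succ 0

/-- The entries of column `0` outside rows `0` and `i0.succ`. -/
def quotientVec (i0 : Fin k) (A : Matrix (Fin (k + 1)) (Fin (k + 1)) ℝ) (i : Fin k) : ℝ :=
  if i = i0 then 0 else A i.succ 0

/-- The fibre matrix over the base lattice point `x⁻¹`. -/
noncomputable def fiberMatrix (i0 : Fin k) (A : Matrix (Fin (k + 1)) (Fin (k + 1)) ℝ)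
    (S T x : ℝ) : Matrix (Fin k) (Fin k) ℝ :=
  weightedShear i0 (fiberWeight i0 1 1 S) (quotientMatrix i0 A) (quotientVec i0 A)
    (S ^ k * (T / A i0.succ 0) * x)

/-- The first column of the flowed lattice outside row `0`. -/
noncomputable def fiberVec (i0 : Fin k) (A : Matrix (Fin (k + 1)) (Fin (k + 1)) ℝ)
    (S T : ℝ) (i : Fin k) : ℝ :=
  S⁻¹ * ((if i = i0 then T⁻¹ else 1) * A i.succ 0)

theorem exists_unimodular_flow_dilate_eq (i0 : Fin k)
    {A : Matrix (Fin (k + 1)) (Fin (k + 1)) ℝ} (ha : A i0.succ 0 ≠ 0) {S T x : ℝ} (hS : 0 < S)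
    (hT : 0 < T) (hx : x ≠ 0) {γ : Matrix (Fin k) (Fin k) ℤ} (hγ : γ.det = 1) :
    ∃ (ξ : ℝ) (γ' : Matrix (Fin (k + 1)) (Fin (k + 1)) ℤ) (ρ : Fin k → ℝ), γ'.det = 1 ∧
      (∀ j, ρ j ∈ Set.Icc (0 : ℝ) 1) ∧
      flowMatrix i0 1 S ξ * dilate i0 T A * γ'.map (Int.cast : ℤ → ℝ) =
        borderedMatrix x⁻¹ (fun j => x⁻¹ * ρ j) (fiberVec i0 A S T)
          (Matrix.of (fun i j => (if i = i0 then -x else 1) *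
            (fiberMatrix i0 A S T x * γ.map (Int.cast : ℤ → ℝ)) i j) +
            Matrix.vecMulVec (fiberVec i0 A S T) ρ) := by
  obtain ⟨k, rfl⟩ : ∃ k', k = k' + 1 := ⟨k - 1, by have := i0.2; omega⟩
  set a0 := A i0.succ 0 with ha0
  set ξ := (x⁻¹ * (S ^ (k + 1))⁻¹ - T * A 0 0) * T / a0 with hξ
  set r : Fin (k + 1) → ℝ := fun l => S ^ (k + 1) * (T * A 0 l.succ + ξ * (T⁻¹ * A i0.succ l.succ))
    with hr
  set r' : Fin (k + 1) → ℝ := fun j => ∑ l, r l * (γ l j : ℝ) with hr'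
  set p : Fin (k + 1) → ℤ := fun j => ⌊x * r' j⌋ with hp
  set γ' : Matrix (Fin (k + 1 + 1)) (Fin (k + 1 + 1)) ℤ :=
    Matrix.of (Fin.cons (Fin.cons 1 fun j => -p j) fun i => Fin.cons 0 (γ i)) with hγ'
  have hγ'cast : γ'.map (Int.cast : ℤ → ℝ) =
      borderedMatrix 1 (fun j => -(p j : ℝ)) 0 (γ.map (Int.cast : ℤ → ℝ)) := by
    ext i j
    refine Fin.cases ?_ (fun i => ?_) i <;> refine Fin.cases ?_ (fun j => ?_) j <;>
    simp [γ', borderedMatrix]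
  have hdet : γ'.det = 1 := by
    have h1 : ((γ'.det : ℤ) : ℝ) = 1 := by
      have h2 : ((γ.det : ℤ) : ℝ) = (γ.map (Int.cast : ℤ → ℝ)).det :=
        (Int.castRingHom ℝ).map_det γ
      have h3 : ((γ'.det : ℤ) : ℝ) = (γ'.map (Int.cast : ℤ → ℝ)).det :=
        (Int.castRingHom ℝ).map_det γ'
      rw [h3, hγ'cast, det_borderedMatrix_zero, ← h2, hγ]
      simp
    exact_mod_cast h1
  have hr'eq : ∀ j, x * r' j = ∑ l, (A i0.succ l.succ / a0 + x * (S ^ (k + 1) * (T / a0)) *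
      (A 0 l.succ * a0 - A i0.succ l.succ * A 0 0)) * (γ l j : ℝ) := by
    intro j
    rw [hr', Finset.mul_sum]
    refine Finset.sum_congr rfl fun l _ => ?_
    rw [← mul_assoc]
    congr 1
    simp only [hr, hξ]
    field_simp
    ring
  refine ⟨ξ, γ', fun j => Int.fract (x * r' j), hdet,
    fun j => ⟨Int.fract_nonneg _, (Int.fract_lt_one _).le⟩, ?_⟩
  rw [dilate, flowMatrix_mul_borderedMatrix, hγ'cast, borderedMatrix_mul_borderedMatrix]
  have hc : S ^ (k + 1) * (T * A 0 0 + ξ * (T⁻¹ * A i0.succ 0)) = x⁻¹ := by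
    rw [hξ, ← ha0]
    field_simp
    ring
  have hu : ∀ i, S⁻¹ * (1 : Matrix (Fin (k + 1)) (Fin (k + 1)) ℝ).mulVec
      (fun i => (if i = i0 then T⁻¹ else 1) * A i.succ 0) i = fiberVec i0 A S T i := by
    intro i
    rw [Matrix.one_mulVec]
    rfl
  have hfr : ∀ j, Int.fract (x * r' j) = x * r' j - p j := fun j => rfl
  simp only [if_true, hc, hu, Matrix.of_apply]
  congr 1
  · simp
  · funext j
    rw [hfr, mul_sub, inv_mul_cancel_left₀ hx]
    simp only [Matrix.map_apply]
    rw [hr']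
    ring
  · simp
  · ext i j
    simp only [Matrix.of_apply, Matrix.add_apply, Matrix.vecMulVec_apply, hfr]
    rw [mul_sub, mul_neg, add_comm, sub_eq_add_neg, ← add_assoc]
    congr 1
    rw [hr'eq, Matrix.mul_apply, Matrix.mul_apply, Finset.mul_sum, Finset.mul_sum,
      ← Finset.sum_add_distrib]
    refine Finset.sum_congr rfl fun l _ => ?_
    simp only [Matrix.one_mul, Matrix.smul_apply, Matrix.of_apply, Matrix.map_apply, smul_eq_mul,
      fiberMatrix, weightedShear, rowShear, quotientMatrix, quotientVec, fiberVec, fiberWeight,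
      Nat.add_sub_cancel, if_true, ← ha0]
    split_ifs with hi
    · subst hi
      rw [← ha0]
      field_simp
      ring
    · field_simp
      ring

theorem abs_det_quotientMatrix (i0 : Fin k) {A : Matrix (Fin (k + 1)) (Fin (k + 1)) ℝ}
    (ha : A i0.succ 0 ≠ 0) : |(quotientMatrix i0 A).det| = |A.det| := by
  obtain ⟨ξ, γ', ρ, hγ', -, h⟩ := exists_unimodular_flow_dilate_eq i0 ha (S := 1) (T := 1) (x := 1)
    one_pos one_pos one_ne_zero (γ := 1) Matrix.det_one
  have h1 := congrArg (fun B => |Matrix.det B|) h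
  have h3 : (γ'.map (Int.cast : ℤ → ℝ)).det = 1 := by
    have h2 : ((γ'.det : ℤ) : ℝ) = (γ'.map (Int.cast : ℤ → ℝ)).det :=
      (Int.castRingHom ℝ).map_det γ'
    rw [← h2, hγ', Int.cast_one]
  beta_reduce at h1
  rw [det_borderedMatrix_add_vecMulVec, Matrix.det_mul, Matrix.det_mul,
    det_flowMatrix i0 _ one_ne_zero, det_dilate i0 one_ne_zero, h3, Matrix.det_mul_column,
    Matrix.map_one _ Int.cast_zero Int.cast_one, Matrix.mul_one, fiberMatrix,
    det_weightedShear _ _ (by simp [quotientVec]), prod_fiberWeight (by simp) one_ne_zero] at h1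
  simpa [Finset.prod_ite_eq', abs_mul] using h1.symm

end Trapped

theorem tendsto_borderedMatrix {α : Type*} {l : Filter α} {k : ℕ} {c : α → ℝ} {c' : ℝ}
    {r u : α → Fin k → ℝ} {r' u' : Fin k → ℝ} {L : α → Matrix (Fin k) (Fin k) ℝ}
    {L' : Matrix (Fin k) (Fin k) ℝ} (hc : Filter.Tendsto c l (nhds c'))
    (hr : Filter.Tendsto r l (nhds r')) (hu : Filter.Tendsto u l (nhds u'))
    (hL : Filter.Tendsto L l (nhds L')) :
    Filter.Tendsto (fun n => borderedMatrix (c n) (r n) (u n) (L n)) l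
      (nhds (borderedMatrix c' r' u' L')) := by
  refine tendsto_pi_nhds.2 fun i => tendsto_pi_nhds.2 fun j => ?_
  refine Fin.cases ?_ (fun i => ?_) i <;> refine Fin.cases ?_ (fun j => ?_) j
  · simpa [borderedMatrix] using hc
  · simpa [borderedMatrix] using (tendsto_pi_nhds.1 hr) j
  · simpa [borderedMatrix] using (tendsto_pi_nhds.1 hu) i
  · simpa [borderedMatrix] using (tendsto_pi_nhds.1 ((tendsto_pi_nhds.1 hL) i)) j

theorem tendsto_quotientMatrix {k : ℕ} (i0 : Fin k)
    {A : ℕ → Matrix (Fin (k + 1)) (Fin (k + 1)) ℝ} {A' : Matrix (Fin (k + 1)) (Fin (k + 1)) ℝ}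
    (hA : Filter.Tendsto A Filter.atTop (nhds A')) (ha : A' i0.succ 0 ≠ 0) :
    Filter.Tendsto (fun t => quotientMatrix i0 (A t)) Filter.atTop
      (nhds (quotientMatrix i0 A')) := by
  have h : ∀ i j, Filter.Tendsto (fun t => A t i j) Filter.atTop (nhds (A' i j)) := fun i j =>
    (tendsto_pi_nhds.1 ((tendsto_pi_nhds.1 hA) i)) j
  refine tendsto_pi_nhds.2 fun i => tendsto_pi_nhds.2 fun j => ?_
  by_cases hi : i = i0
  · simp only [quotientMatrix, Matrix.of_apply, hi, if_true]
    exact ((h _ _).mul (h _ _)).sub ((h _ _).mul (h _ _))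
  · simp only [quotientMatrix, Matrix.of_apply, hi, if_false]
    exact (h _ _).sub (((h _ _).div (h _ _) ha).mul (h _ _))

theorem tendsto_quotientVec {k : ℕ} (i0 : Fin k)
    {A : ℕ → Matrix (Fin (k + 1)) (Fin (k + 1)) ℝ} {A' : Matrix (Fin (k + 1)) (Fin (k + 1)) ℝ}
    (hA : Filter.Tendsto A Filter.atTop (nhds A')) :
    Filter.Tendsto (fun t => quotientVec i0 (A t)) Filter.atTop (nhds (quotientVec i0 A')) := by
  refine tendsto_pi_nhds.2 fun i => ?_
  unfold quotientVec
  split_ifs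
  · exact tendsto_const_nhds
  · exact (tendsto_pi_nhds.1 ((tendsto_pi_nhds.1 hA) i.succ)) 0

theorem abs_det_fiberMatrix {k : ℕ} (i0 : Fin k) {A : Matrix (Fin (k + 1)) (Fin (k + 1)) ℝ}
    (ha : A i0.succ 0 ≠ 0) {S : ℝ} (hS : S ≠ 0) (T x : ℝ) :
    |(fiberMatrix i0 A S T x).det| = |A.det| := by
  rw [fiberMatrix, det_weightedShear _ _ (by simp [quotientVec]), prod_fiberWeight (by simp) hS,
    one_mul, abs_det_quotientMatrix i0 ha]

theorem det_map_intCast_eq_one {ι : Type*} [Fintype ι] [DecidableEq ι] {γ : Matrix ι ι ℤ}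
    (hγ : γ.det = 1) : (γ.map (Int.cast : ℤ → ℝ)).det = 1 := by
  have h2 : ((γ.det : ℤ) : ℝ) = (γ.map (Int.cast : ℤ → ℝ)).det := (Int.castRingHom ℝ).map_det γ
  rw [← h2, hγ, Int.cast_one]

theorem map_intCast_mulVec {ι : Type*} [Fintype ι] (γ : Matrix ι ι ℤ) (m : ι → ℤ) :
    (γ.map (Int.cast : ℤ → ℝ)).mulVec (fun l => (m l : ℝ)) = fun l => ((γ.mulVec m l : ℤ) : ℝ) := by
  funext i
  simp [Matrix.mulVec, dotProduct]

theorem mulVec_ne_zero_of_det_eq_one {ι : Type*} [Fintype ι] [DecidableEq ι] {γ : Matrix ι ι ℤ}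
    (hγ : γ.det = 1) {m : ι → ℤ} (hm : m ≠ 0) : γ.mulVec m ≠ 0 := by
  intro h
  exact hm (Matrix.eq_zero_of_mulVec_eq_zero (by rw [hγ]; exact one_ne_zero) h)

theorem false_of_isTrapped_dilate_aux {k : ℕ} (hk : 0 < k) {μ : ℝ} (hμ0 : 0 < μ) (hμ1 : μ < 1)
    {i0 : Fin k} {E : Matrix (Fin k) (Fin k) ℝ} {A : ℕ → Matrix (Fin (k + 1)) (Fin (k + 1)) ℝ}
    {A' : Matrix (Fin (k + 1)) (Fin (k + 1)) ℝ} (hA : Filter.Tendsto A Filter.atTop (nhds A'))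
    {V : ℝ} (hV : 0 < V) (hdet : ∀ t, |(A t).det| = V) (hEV : |E.det| * V = 1) {T : ℕ → ℝ}
    (hT : Filter.Tendsto T Filter.atTop Filter.atTop) (hT1 : ∀ t, 1 ≤ T t)
    (htr : ∀ t, IsTrapped μ i0 E (dilate i0 (T t) (A t))) (ha : ∀ t, A t i0.succ 0 ≠ 0)
    (ha' : A' i0.succ 0 ≠ 0) (hz' : k = 1 ∨ quotientVec i0 A' ≠ 0)
    (hD : ∀ m : Fin k → ℤ, m ≠ 0 →
      (quotientMatrix i0 A').mulVec (fun l => (m l : ℝ)) i0 ≠ 0) : False := by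
  have hAe : ∀ i j, Filter.Tendsto (fun t => A t i j) Filter.atTop (nhds (A' i j)) := fun i j =>
    (tendsto_pi_nhds.1 ((tendsto_pi_nhds.1 hA) i)) j
  have hτ : Filter.Tendsto (fun t => |T t / A t i0.succ 0|) Filter.atTop Filter.atTop := by
    simp only [div_eq_mul_inv, abs_mul, abs_inv]
    refine Filter.Tendsto.atTop_mul_pos (inv_pos.2 (abs_pos.2 ha'))
      (Filter.tendsto_abs_atTop_atTop.comp hT) ?_
    exact ((hAe _ _).abs).inv₀ (abs_ne_zero.2 ha')
  obtain ⟨η, hη, hspread⟩ := exists_eventually_forall_lt_abs_mulVec (tendsto_quotientMatrix i0 hA ha')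
    (tendsto_quotientVec i0 hA) (fun t => by simp [quotientVec]) hz' hV
    (fun t => (abs_det_quotientMatrix i0 (ha t)).trans (hdet t)) hD hτ
  have hε : 0 < min 1 (η 0) := lt_min one_pos (hη 0)
  obtain ⟨C, hC, hred⟩ := exists_unimodular_mul_bounded (ι := Fin k) hε hV
  have step : ∀ n : ℕ, ∃ (S : ℝ) (t : ℕ) (x : ℝ) (γ : Matrix (Fin k) (Fin k) ℤ),
      (n : ℝ) + 1 ≤ S ∧ n ≤ t ∧ x ∈ Set.Icc (1 / 2 : ℝ) (3 / 2) ∧ γ.det = 1 ∧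
      (∀ i j, |(fiberMatrix i0 (A t) S (T t) x * γ.map (Int.cast : ℤ → ℝ)) i j| ≤ C) ∧
      ∀ R < n + 1, ∀ w : Fin k → ℤ, w ≠ 0 →
        (∀ i ≠ i0, |(fiberMatrix i0 (A t) S (T t) x).mulVec (fun l => (w l : ℝ)) i| ≤ R + 1) →
        η R < |(fiberMatrix i0 (A t) S (T t) x).mulVec (fun l => (w l : ℝ)) i0| := by
    intro n
    obtain ⟨S, hS, hSn⟩ := ((hspread (n + 1)).and (Filter.eventually_ge_atTop ((n : ℝ) + 1))).exists
    obtain ⟨t, ⟨x, hx, hw⟩, htn⟩ := (hS.and (Filter.eventually_ge_atTop n)).exists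
    have hS0 : S ≠ 0 := (lt_of_lt_of_le (by positivity) hSn).ne'
    obtain ⟨γ, hγ, hγC⟩ := hred (fiberMatrix i0 (A t) S (T t) x)
      ((abs_det_fiberMatrix i0 (ha t) hS0 _ _).trans (hdet t)) (fun m hm => by
        by_contra! hcon
        have h1 := hw 0 (Nat.succ_pos n) m hm fun i _ => by
          have := (hcon i).le.trans (min_le_left _ _)
          simpa [fiberMatrix] using this
        exact absurd ((hcon i0).trans_le (min_le_right _ _)) (not_lt.2 h1.le))
    exact ⟨S, t, x, γ, hSn, htn, hx, hγ, hγC, hw⟩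
  choose S t x γ hSn htn hx hγ hγC hw using step
  have hS0 : ∀ n, 0 < S n := fun n => lt_of_lt_of_le (by positivity) (hSn n)
  have hx0 : ∀ n, 0 < x n := fun n => lt_of_lt_of_le (by norm_num) (hx n).1
  choose ξ γ' ρ hγ' hρ heq using fun n => exists_unimodular_flow_dilate_eq i0 (ha (t n)) (hS0 n)
    (one_pos.trans_le (hT1 (t n))) (hx0 n).ne' (hγ n)
  set G : ℕ → Matrix (Fin k) (Fin k) ℝ := fun n =>
    fiberMatrix i0 (A (t n)) (S n) (T (t n)) (x n) * (γ n).map (Int.cast : ℤ → ℝ) with hG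
  have hK : IsCompact ((Set.Icc (1 / 2 : ℝ) (3 / 2)) ×ˢ ((Set.Icc (0 : Fin k → ℝ) 1) ×ˢ
      (Set.Icc (fun _ _ => -C : Fin k → Fin k → ℝ) (fun _ _ => C)))) :=
    isCompact_Icc.prod (isCompact_Icc.prod isCompact_Icc)
  obtain ⟨⟨x', ρ', G'⟩, ⟨hx', -, -⟩, φ, hφ, hlim⟩ := hK.tendsto_subseq
    (x := (fun n => (x n, ρ n, G n) : ℕ → ℝ × (Fin k → ℝ) × (Fin k → Fin k → ℝ))) (fun n => ⟨hx n,
      ⟨fun j => (hρ n j).1, fun j => (hρ n j).2⟩,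
      ⟨fun i j => (abs_le.1 (hγC n i j)).1, fun i j => (abs_le.1 (hγC n i j)).2⟩⟩)
  have hxl : Filter.Tendsto (fun n => x (φ n)) Filter.atTop (nhds x') :=
    (continuous_fst.tendsto _).comp hlim
  have hρl : Filter.Tendsto (fun n => ρ (φ n)) Filter.atTop (nhds ρ') :=
    ((continuous_fst.comp continuous_snd).tendsto _).comp hlim
  have hGl : Filter.Tendsto (fun n => G (φ n)) Filter.atTop (nhds (G' : Matrix (Fin k) (Fin k) ℝ)) :=
    ((continuous_snd.comp continuous_snd).tendsto _).comp hlim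
  have hx'0 : 0 < x' := lt_of_lt_of_le (by norm_num) hx'.1
  have htt : Filter.Tendsto t Filter.atTop Filter.atTop :=
    Filter.tendsto_atTop_mono htn Filter.tendsto_id
  have hul : Filter.Tendsto (fun n => fiberVec i0 (A (t (φ n))) (S (φ n)) (T (t (φ n))))
      Filter.atTop (nhds 0) := by
    have hul : Filter.Tendsto (fun n => fiberVec i0 (A (t n)) (S n) (T (t n)))
        Filter.atTop (nhds 0) := by
      refine tendsto_pi_nhds.2 fun i => ?_
      have hSl : Filter.Tendsto (fun n => (S n)⁻¹) Filter.atTop (nhds 0) :=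
        tendsto_inv_atTop_zero.comp (Filter.tendsto_atTop_mono (fun n => by
          have := hSn n
          show (n : ℝ) ≤ S n
          linarith) tendsto_natCast_atTop_atTop)
      have h1 := hSl.mul ((hAe i.succ 0).comp htt).abs
      rw [zero_mul] at h1
      refine squeeze_zero_norm (fun n => ?_) h1
      rw [Real.norm_eq_abs, fiberVec, abs_mul, abs_of_pos (inv_pos.2 (hS0 n)), abs_mul]
      refine mul_le_mul_of_nonneg_left (mul_le_of_le_one_left (abs_nonneg _) ?_)
        (inv_pos.2 (hS0 n)).le
      split_ifs
      · rw [abs_of_pos (inv_pos.2 (one_pos.trans_le (hT1 _)))]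
        exact inv_le_one_of_one_le₀ (hT1 _)
      · simp
    exact hul.comp hφ.tendsto_atTop
  set L : ℝ → Matrix (Fin k) (Fin k) ℝ → Matrix (Fin k) (Fin k) ℝ := fun x G =>
    Matrix.of fun i j => (if i = i0 then -x else 1) * G i j with hLdef
  have hLl : Filter.Tendsto (fun n => L (x (φ n)) (G (φ n))) Filter.atTop (nhds (L x' G')) := by
    refine tendsto_pi_nhds.2 fun i => tendsto_pi_nhds.2 fun j => ?_
    have h2 := (tendsto_pi_nhds.1 ((tendsto_pi_nhds.1 hGl) i)) j
    simp only [hLdef, Matrix.of_apply]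
    split_ifs
    · exact hxl.neg.mul h2
    · exact h2.const_mul _
  have hGdet : ∀ n, |(G n).det| = V := fun n => by
    rw [hG, Matrix.det_mul, det_map_intCast_eq_one (hγ n), mul_one,
      abs_det_fiberMatrix i0 (ha _) (hS0 n).ne', hdet]
  have hG'det : |Matrix.det (G' : Matrix (Fin k) (Fin k) ℝ)| = V := by
    have h1 := ((continuous_id.matrix_det.tendsto (G' : Matrix (Fin k) (Fin k) ℝ)).comp hGl).abs
    refine tendsto_nhds_unique h1 ?_
    simp [hGdet]
  have hu0 : Matrix.vecMulVec (0 : Fin k → ℝ) ρ' = 0 := by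
    ext i j
    simp [Matrix.vecMulVec_apply]
  have hvl : Filter.Tendsto (fun n => Matrix.vecMulVec
      (fiberVec i0 (A (t (φ n))) (S (φ n)) (T (t (φ n)))) (ρ (φ n))) Filter.atTop (nhds 0) := by
    rw [← hu0]
    refine tendsto_pi_nhds.2 fun i => tendsto_pi_nhds.2 fun j => ?_
    exact ((tendsto_pi_nhds.1 hul) i).mul ((tendsto_pi_nhds.1 hρl) j)
  have hxil := hxl.inv₀ hx'0.ne'
  have hBl := tendsto_borderedMatrix hxil
    (tendsto_pi_nhds.2 fun j => hxil.mul ((tendsto_pi_nhds.1 hρl) j)) hul (hLl.add hvl)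
  rw [add_zero] at hBl
  refine not_isTrapped_of_tendsto (i0 := i0) (E := E) hk hμ0 hμ1 (inv_pos.2 hx'0) ?_ ?_ hBl
    fun n => ?_
  · have h1 : (L x' G').det = -x' * Matrix.det (G' : Matrix (Fin k) (Fin k) ℝ) := by
      refine (Matrix.det_mul_column (fun i => if i = i0 then -x' else 1)
        (G' : Matrix (Fin k) (Fin k) ℝ)).trans ?_
      simp [Finset.prod_ite_eq']
    rw [h1, abs_mul, hG'det, abs_neg, abs_of_pos hx'0]
    field_simp
    linarith
  · intro m hm
    have h1 : (L x' G').mulVec (fun l => (m l : ℝ)) i0 =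
        -x' * Matrix.mulVec (G' : Matrix (Fin k) (Fin k) ℝ) (fun l => (m l : ℝ)) i0 := by
      simp [hLdef, Matrix.mulVec, dotProduct, Finset.mul_sum, mul_assoc]
    rw [h1]
    refine mul_ne_zero (neg_ne_zero.2 hx'0.ne') ?_
    set R : ℕ := ⌈C * ∑ l, |(m l : ℝ)|⌉₊ with hR
    have h2 : Filter.Tendsto (fun n => |(G (φ n)).mulVec (fun l => (m l : ℝ)) i0|) Filter.atTop
        (nhds |Matrix.mulVec (G' : Matrix (Fin k) (Fin k) ℝ) (fun l => (m l : ℝ)) i0|) := by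
      refine Filter.Tendsto.abs ?_
      simp only [Matrix.mulVec, dotProduct]
      refine tendsto_finsetSum _ fun l _ => ?_
      exact ((tendsto_pi_nhds.1 ((tendsto_pi_nhds.1 hGl) i0)) l).mul_const _
    have h3 : ∀ᶠ n in Filter.atTop, η R ≤ |(G (φ n)).mulVec (fun l => (m l : ℝ)) i0| := by
      filter_upwards [Filter.eventually_ge_atTop R] with n hn
      have h4 : ∀ i, (G (φ n)).mulVec (fun l => (m l : ℝ)) i =
          (fiberMatrix i0 (A (t (φ n))) (S (φ n)) (T (t (φ n))) (x (φ n))).mulVec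
            (fun l => (((γ (φ n)).mulVec m l : ℤ) : ℝ)) i := fun i => by
        rw [hG, ← Matrix.mulVec_mulVec, map_intCast_mulVec]
      rw [h4]
      refine (hw (φ n) R (Nat.lt_succ_of_le (hn.trans (hφ.id_le n))) _
        (mulVec_ne_zero_of_det_eq_one (hγ _) hm) fun i _ => ?_).le
      rw [← h4]
      have h5 : |(G (φ n)).mulVec (fun l => (m l : ℝ)) i| ≤ C * ∑ l, |(m l : ℝ)| := by
        rw [Matrix.mulVec, dotProduct, Finset.mul_sum]
        refine (Finset.abs_sum_le_sum_abs _ _).trans (Finset.sum_le_sum fun l _ => ?_)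
        rw [abs_mul]
        exact mul_le_mul_of_nonneg_right (hγC _ i l) (abs_nonneg _)
      have h6 : C * ∑ l, |(m l : ℝ)| ≤ R := Nat.le_ceil _
      linarith
    have h7 := ge_of_tendsto h2 h3
    exact abs_pos.1 ((hη R).trans_le h7)
  · rw [← heq]
    exact (htr (t (φ n))).flowMatrix_mul_unimodular (hS0 _) _ (hγ' _)

theorem exists_nat_sum_mul_pow_ne_zero {n : ℕ} {f g : Fin n → ℝ} (hf : f ≠ 0) (hg : g ≠ 0) :
    ∃ N : ℕ, ∑ j, f j * (N : ℝ) ^ (j : ℕ) ≠ 0 ∧ ∑ j, g j * (N : ℝ) ^ (j : ℕ) ≠ 0 := by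
  have key : ∀ f : Fin n → ℝ, f ≠ 0 →
      (∑ j, Polynomial.C (f j) * Polynomial.X ^ (j : ℕ) : Polynomial ℝ) ≠ 0 := by
    intro f hf h
    refine hf (funext fun i => ?_)
    have := congrArg (fun p => Polynomial.coeff p (i : ℕ)) h
    simpa [Polynomial.finsetSum_coeff, Polynomial.coeff_C_mul, Polynomial.coeff_X_pow,
      Fin.val_inj] using this
  have h1 := mul_ne_zero (key f hf) (key g hg)
  obtain ⟨x, ⟨N, rfl⟩, hN⟩ := (Set.infinite_range_of_injective
    (Nat.cast_injective (R := ℝ))).exists_notMem_finset (Polynomial.roots _).toFinset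
  rw [Multiset.mem_toFinset, Polynomial.mem_roots h1, Polynomial.IsRoot.def,
    Polynomial.eval_mul, mul_eq_zero, not_or] at hN
  refine ⟨N, ?_⟩
  simpa [Polynomial.eval_finsetSum] using hN

theorem exists_unimodular_col_zero {n : ℕ} (N : ℕ) :
    ∃ γ : Matrix (Fin (n + 1)) (Fin (n + 1)) ℤ, γ.det = 1 ∧ ∀ j, γ j 0 = (N : ℤ) ^ (j : ℕ) := by
  refine ⟨(1 : Matrix (Fin (n + 1)) (Fin (n + 1)) ℤ).updateCol 0 fun j => (N : ℤ) ^ (j : ℕ), ?_,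
    fun j => by simp⟩
  rw [← Matrix.cramer_apply]
  simp [Matrix.cramer_one]

/-- A sequence of lattices with determinant forms that degenerate under dilation cannot be
trapped, provided the limiting alternating form of rows `0` and `i0.succ` has no integral
isotropic plane. -/
theorem false_of_isTrapped_dilate {k : ℕ} (hk : 0 < k) {μ : ℝ} (hμ0 : 0 < μ) (hμ1 : μ < 1)
    {i0 : Fin k} {E : Matrix (Fin k) (Fin k) ℝ} {A : ℕ → Matrix (Fin (k + 1)) (Fin (k + 1)) ℝ}
    {A' : Matrix (Fin (k + 1)) (Fin (k + 1)) ℝ} (hA : Filter.Tendsto A Filter.atTop (nhds A'))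
    {V : ℝ} (hV : 0 < V) (hdet : ∀ t, |(A t).det| = V) (hEV : |E.det| * V = 1) {T : ℕ → ℝ}
    (hT : Filter.Tendsto T Filter.atTop Filter.atTop)
    (htr : ∀ t, IsTrapped μ i0 E (dilate i0 (T t) (A t)))
    (hD : ∀ x v : Fin (k + 1) → ℤ, (∀ s t : ℤ, s • x + t • v = 0 → s = 0 ∧ t = 0) →
      A'.mulVec (fun l => (x l : ℝ)) 0 * A'.mulVec (fun l => (v l : ℝ)) i0.succ -
        A'.mulVec (fun l => (x l : ℝ)) i0.succ * A'.mulVec (fun l => (v l : ℝ)) 0 ≠ 0) : False := by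
  have hA'det : A'.det ≠ 0 := by
    intro h
    have h1 := ((continuous_id.matrix_det.tendsto A').comp hA).abs
    have h2 : |A'.det| = V := tendsto_nhds_unique h1 (by simp [hdet])
    rw [h, abs_zero] at h2
    exact hV.ne h2
  have hrow : ∀ i, A' i ≠ 0 := fun i h =>
    hA'det (Matrix.det_eq_zero_of_row_eq_zero i fun j => congrFun h j)
  obtain ⟨i1, hi1⟩ : ∃ i1 : Fin k, k = 1 ∨ i1 ≠ i0 := by
    by_cases h : k = 1
    · exact ⟨i0, Or.inl h⟩
    · have : Nontrivial (Fin k) := Fin.nontrivial_iff_two_le.2 (by omega)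
      obtain ⟨i1, hi1⟩ := exists_ne i0
      exact ⟨i1, Or.inr hi1⟩
  obtain ⟨N, hN0, hN1⟩ := exists_nat_sum_mul_pow_ne_zero (hrow i0.succ) (hrow i1.succ)
  obtain ⟨γ, hγ, hγN⟩ := exists_unimodular_col_zero (n := k) N
  have hcol : ∀ i, (A' * γ.map (Int.cast : ℤ → ℝ)) i 0 = ∑ j, A' i j * (N : ℝ) ^ (j : ℕ) := by
    intro i
    simp [Matrix.mul_apply, hγN]
  have hAl : Filter.Tendsto (fun t => A t * γ.map (Int.cast : ℤ → ℝ)) Filter.atTop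
      (nhds (A' * γ.map (Int.cast : ℤ → ℝ))) :=
    ((continuous_id.matrix_mul
      (continuous_const (y := γ.map (Int.cast : ℤ → ℝ)))).tendsto A').comp hA
  have ha' : (A' * γ.map (Int.cast : ℤ → ℝ)) i0.succ 0 ≠ 0 := by rw [hcol]; exact hN0
  obtain ⟨t0, ht0⟩ := Filter.eventually_atTop.1
    ((((tendsto_pi_nhds.1 ((tendsto_pi_nhds.1 hAl) i0.succ)) 0).eventually_ne ha').and
      (hT.eventually_ge_atTop 1))
  refine false_of_isTrapped_dilate_aux (i0 := i0) (E := E) (V := V) hk hμ0 hμ1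
    (hAl.comp (Filter.tendsto_add_atTop_nat t0)) hV (fun t => ?_) hEV
    (hT.comp (Filter.tendsto_add_atTop_nat t0)) (fun t => (ht0 _ (Nat.le_add_left _ _)).2)
    (fun t => ?_) (fun t => (ht0 _ (Nat.le_add_left _ _)).1) ha' ?_ ?_
  · simp only [Function.comp_apply]
    rw [Matrix.det_mul, det_map_intCast_eq_one hγ, mul_one, hdet]
  · simp only [Function.comp_apply]
    intro x hx ξ hcon
    rw [dilate_mul, ← Matrix.mul_assoc] at hcon
    exact htr _ x hx ξ (hcon.of_mul_unimodular hγ)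
  · refine hi1.imp_right fun h h0 => hN1 ?_
    have := congrFun h0 i1
    rwa [quotientVec, if_neg h, hcol] at this
  · intro m hm
    have h1 := hD (γ.mulVec (Fin.cons 0 m)) (γ.mulVec (Pi.single 0 1)) fun s t hst => by
      rw [← Matrix.mulVec_smul, ← Matrix.mulVec_smul, ← Matrix.mulVec_add] at hst
      have h2 := Matrix.eq_zero_of_mulVec_eq_zero (by rw [hγ]; exact one_ne_zero) hst
      have h3 : t = 0 := by simpa using congrFun h2 0
      refine ⟨?_, h3⟩
      obtain ⟨j, hj⟩ := Function.ne_iff.1 hm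
      have h4 := congrFun h2 j.succ
      have h5 : s = 0 ∨ m j = 0 := by simpa [Pi.single_apply] using h4
      exact h5.resolve_right (by simpa using hj)
    rw [← map_intCast_mulVec, ← map_intCast_mulVec, Matrix.mulVec_mulVec,
      Matrix.mulVec_mulVec] at h1
    set B := A' * γ.map (Int.cast : ℤ → ℝ) with hB
    have h5 : ∀ i, B.mulVec (fun l => (((Fin.cons 0 m : Fin (k + 1) → ℤ) l : ℤ) : ℝ)) i =
        ∑ j : Fin k, B i j.succ * (m j : ℝ) := fun i => by
      simp [Matrix.mulVec, dotProduct, Fin.sum_univ_succ]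
    have h6 : ∀ i, B.mulVec (fun l => (((Pi.single 0 1 : Fin (k + 1) → ℤ) l : ℤ) : ℝ)) i = B i 0 :=
      fun i => by
      simp [Matrix.mulVec, dotProduct, Fin.sum_univ_succ]
    rw [h5, h5, h6, h6] at h1
    convert h1 using 1
    simp only [quotientMatrix, Matrix.mulVec, dotProduct, Matrix.of_apply, if_true, Finset.sum_mul]
    rw [← Finset.sum_sub_distrib]
    exact Finset.sum_congr rfl fun j _ => by ring

section Curve

variable {k : ℕ}

/-- The lattice of the linear form `q ↦ φ s ⬝ q - p` at scale `x`, in the coordinates `(p, q)`. -/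
noncomputable def curveLattice (φ : ℝ → Fin k → ℝ) (x s : ℝ) :
    Matrix (Fin (k + 1)) (Fin (k + 1)) ℝ :=
  borderedMatrix (-x ^ k) (fun j => x ^ k * φ s j) 0 (x⁻¹ • (1 : Matrix (Fin k) (Fin k) ℝ))

/-- The identity matrix with row `i0` replaced by `φ' s`. -/
noncomputable def tangentMatrix (φ : ℝ → Fin k → ℝ) (i0 : Fin k) (s : ℝ) :
    Matrix (Fin k) (Fin k) ℝ :=
  (1 : Matrix (Fin k) (Fin k) ℝ).updateRow i0 (deriv φ s)

/-- The frame of linear forms `φ s ⬝ q - p`, `φ' s ⬝ q` and `q i` for `i ≠ i0`. -/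
noncomputable def curveFrame (φ : ℝ → Fin k → ℝ) (i0 : Fin k) (s : ℝ) :
    Matrix (Fin (k + 1)) (Fin (k + 1)) ℝ :=
  borderedMatrix (-1) (φ s) 0 (tangentMatrix φ i0 s)

theorem det_tangentMatrix (φ : ℝ → Fin k → ℝ) (i0 : Fin k) (s : ℝ) :
    (tangentMatrix φ i0 s).det = deriv φ s i0 := by
  rw [tangentMatrix, Matrix.det_eq_sum_mul_adjugate_row _ i0, Finset.sum_eq_single i0]
  · have h1 : (Pi.single i0 1 : Fin k → ℝ) = (1 : Matrix (Fin k) (Fin k) ℝ) i0 := by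
      funext j; simp [Matrix.one_apply, Pi.single_apply, eq_comm]
    simp only [Matrix.adjugate_apply, Matrix.updateRow_idem, Matrix.updateRow_self]
    rw [h1, Matrix.updateRow_eq_self, Matrix.det_one, mul_one]
  · intro j _ hj
    simp only [Matrix.adjugate_apply, Matrix.updateRow_idem]
    rw [Matrix.det_eq_zero_of_column_eq_zero i0, mul_zero]
    intro i
    by_cases hi : i = i0
    · subst hi; simp [hj.symm]
    · simp [hi, Matrix.updateRow_ne]
  · simp

theorem det_curveFrame (φ : ℝ → Fin k → ℝ) (i0 : Fin k) (s : ℝ) :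
    (curveFrame φ i0 s).det = -deriv φ s i0 := by
  rw [curveFrame, det_borderedMatrix_zero, det_tangentMatrix, neg_one_mul]

theorem not_exists_of_avoidsCube {φ : ℝ → Fin k → ℝ} {μ s : ℝ} {N : ℕ} (hN : 0 < N)
    (h : AvoidsCube μ (curveLattice φ N s)) :
    ¬ ∃ (q : Fin k → ℤ) (p : ℤ), (∃ i, q i ≠ 0) ∧
      (∀ i, |(q i : ℝ)| ≤ μ * N) ∧
      |∑ i, (q i : ℝ) * φ s i - (p : ℝ)| ≤ μ / (N : ℝ) ^ k := by
  rintro ⟨q, p, ⟨j, hj⟩, hq, hp⟩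
  have hN' : (0 : ℝ) < N := by exact_mod_cast hN
  obtain ⟨i, hi⟩ := h (Fin.cons p q) fun h0 => hj (by simpa using congrFun h0 j.succ)
  refine hi.not_ge ?_
  refine Fin.cases ?_ (fun i => ?_) i
  · rw [curveLattice, borderedMatrix_mulVec_zero]
    have h1 : -(N : ℝ) ^ k * (((Fin.cons p q : Fin (k + 1) → ℤ) 0 : ℤ) : ℝ) +
        ∑ j, (N : ℝ) ^ k * φ s j * (((Fin.cons p q : Fin (k + 1) → ℤ) j.succ : ℤ) : ℝ) =
        (N : ℝ) ^ k * (∑ i, (q i : ℝ) * φ s i - (p : ℝ)) := by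
      simp only [Fin.cons_zero, Fin.cons_succ, mul_sub, Finset.mul_sum]
      rw [Finset.sum_congr rfl fun j _ =>
        (show (N : ℝ) ^ k * φ s j * (q j : ℝ) = (N : ℝ) ^ k * ((q j : ℝ) * φ s j) by ring)]
      ring
    rw [h1, abs_mul, abs_of_pos (by positivity), mul_comm]
    exact (le_div_iff₀ (by positivity)).1 hp
  · rw [curveLattice, borderedMatrix_mulVec_succ]
    simp only [Pi.zero_apply, zero_mul, zero_add, Fin.cons_succ, Matrix.smul_apply, smul_eq_mul]
    rw [Finset.sum_eq_single i (fun j _ hj => by simp [Matrix.one_apply_ne hj.symm]) (by simp)]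
    rw [Matrix.one_apply_eq, mul_one, abs_mul, abs_of_pos (inv_pos.2 hN'), inv_mul_le_iff₀ hN',
      mul_comm]
    exact hq i

/-- The change of frame carrying scale `X` at `s0` to scale `x` at `s0 + h`. -/
noncomputable def transition (φ : ℝ → Fin k → ℝ) (i0 : Fin k) (s0 x X h : ℝ) :
    Matrix (Fin (k + 1)) (Fin (k + 1)) ℝ :=
  borderedMatrix ((x / X) ^ k)
    (Pi.single i0 ((x / X) ^ k * (h * X ^ (k + 1))) +
      (X * x ^ k) • (Matrix.vecMul (φ (s0 + h) - φ s0 - h • deriv φ s0)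
        (tangentMatrix φ i0 s0)⁻¹)) 0
    ((x / X)⁻¹ • (tangentMatrix φ i0 s0)⁻¹)

theorem transition_mul {φ : ℝ → Fin k → ℝ} {i0 : Fin k} {s0 x X : ℝ} (hX : X ≠ 0)
    (hs0 : deriv φ s0 i0 ≠ 0) (h : ℝ) :
    transition φ i0 s0 x X h * (flowMatrix i0 1 X 0 * curveFrame φ i0 s0) =
      curveLattice φ x (s0 + h) := by
  have hu : IsUnit (tangentMatrix φ i0 s0).det := by
    rw [det_tangentMatrix]; exact isUnit_iff_ne_zero.2 hs0
  rw [curveFrame, flowMatrix_mul_borderedMatrix, transition]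
  simp only [Matrix.mulVec_zero, Pi.zero_apply, mul_zero, zero_mul, add_zero, Matrix.one_mul]
  change borderedMatrix _ _ 0 _ * borderedMatrix _ _ 0 _ = _
  rw [borderedMatrix_mul_borderedMatrix, curveLattice]
  congr 1
  · rw [div_pow, div_mul_eq_mul_div, div_eq_iff (pow_ne_zero _ hX)]; ring
  · funext j
    have h1 : ∀ l, (X⁻¹ • tangentMatrix φ i0 s0) l j = X⁻¹ * tangentMatrix φ i0 s0 l j :=
      fun l => rfl
    have h2 : ∑ l, Matrix.vecMul (φ (s0 + h) - φ s0 - h • deriv φ s0)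
        (tangentMatrix φ i0 s0)⁻¹ l * tangentMatrix φ i0 s0 l j =
        φ (s0 + h) j - φ s0 j - h * deriv φ s0 j := by
      change Matrix.vecMul (Matrix.vecMul (φ (s0 + h) - φ s0 - h • deriv φ s0)
        (tangentMatrix φ i0 s0)⁻¹) (tangentMatrix φ i0 s0) j = _
      rw [Matrix.vecMul_vecMul, Matrix.nonsing_inv_mul _ hu, Matrix.vecMul_one]
      simp
    have h3 : tangentMatrix φ i0 s0 i0 j = deriv φ s0 j := by simp [tangentMatrix]
    simp only [h1, Pi.add_apply, Pi.smul_apply, smul_eq_mul, add_mul, Finset.sum_add_distrib]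
    have h4 : ∀ l, X * x ^ k * Matrix.vecMul (φ (s0 + h) - φ s0 - h • deriv φ s0)
        (tangentMatrix φ i0 s0)⁻¹ l * (X⁻¹ * tangentMatrix φ i0 s0 l j) =
        x ^ k * (Matrix.vecMul (φ (s0 + h) - φ s0 - h • deriv φ s0)
        (tangentMatrix φ i0 s0)⁻¹ l * tangentMatrix φ i0 s0 l j) := fun l => by
      field_simp
    rw [Finset.sum_congr rfl fun l _ => h4 l, ← Finset.mul_sum, h2,
      Finset.sum_eq_single i0 (fun l _ hl => by simp [hl]) (by simp), h3, Pi.single_eq_same]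
    have h5 : (x / X) ^ k * X ^ k = x ^ k := by rw [← mul_pow, div_mul_cancel₀ _ hX]
    have h6 : X ^ (k + 1) * X⁻¹ = X ^ k := by rw [pow_succ, mul_inv_cancel_right₀ hX]
    linear_combination (φ s0 j + h * deriv φ s0 j) * h5 + (x / X) ^ k * h * deriv φ s0 j * h6
  · funext i; simp
  · ext i j
    simp only [Pi.zero_apply, zero_mul, zero_add, Matrix.smul_mul, Matrix.mul_smul,
      Matrix.of_apply, Matrix.nonsing_inv_mul _ hu, smul_smul]
    rw [inv_div, ← mul_div_assoc, inv_mul_cancel₀ hX, one_div]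

end Curve

theorem eventually_exists_mem_of_density {F : Set ℝ} {s0 : ℝ}
    (hd : Filter.Tendsto (fun r => volume (F ∩ Metric.closedBall s0 r) /
      volume (Metric.closedBall s0 r)) (nhdsWithin 0 (Set.Ioi 0)) (nhds 1))
    {r : ℕ → ℝ} (hr0 : ∀ᶠ j in Filter.atTop, 0 < r j)
    (hr : Filter.Tendsto r Filter.atTop (nhds 0)) (ξ : ℝ) {η : ℝ} (hη : 0 < η) :
    ∀ᶠ j in Filter.atTop, ∃ ξ' ∈ Metric.closedBall ξ η, s0 + r j * ξ' ∈ F := by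
  have hpos : 0 < |ξ| + η := by positivity
  have h1 : Filter.Tendsto (fun j => r j * (|ξ| + η)) Filter.atTop
      (nhdsWithin 0 (Set.Ioi 0)) := by
    refine tendsto_nhdsWithin_iff.2 ⟨by simpa using hr.mul_const (|ξ| + η), ?_⟩
    filter_upwards [hr0] with j hj using mul_pos hj hpos
  have h2 : ENNReal.ofReal (|ξ| / (|ξ| + η)) < 1 := by
    rw [ENNReal.ofReal_lt_one, div_lt_one hpos]
    linarith
  filter_upwards [(hd.comp h1).eventually_const_lt h2, hr0] with j hj hrj
  by_contra! hcon
  refine hj.not_ge ?_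
  have hρ : 0 < r j * (|ξ| + η) := mul_pos hrj hpos
  have hsub : F ∩ Metric.closedBall s0 (r j * (|ξ| + η)) ⊆
      Metric.closedBall s0 (r j * (|ξ| + η)) \ Metric.closedBall (s0 + r j * ξ) (r j * η) := by
    rintro s ⟨hsF, hs⟩
    refine ⟨hs, fun hs' => hcon ((s - s0) / r j) ?_ ?_⟩
    · rw [Metric.mem_closedBall, Real.dist_eq] at hs' ⊢
      have h3 : (s - s0) / r j - ξ = (s - (s0 + r j * ξ)) / r j := by field_simp; ring
      rw [h3, abs_div, abs_of_pos hrj, div_le_iff₀ hrj, mul_comm η]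
      exact hs'
    · rw [mul_div_cancel₀ _ hrj.ne']
      simpa using hsF
  have hin : Metric.closedBall (s0 + r j * ξ) (r j * η) ⊆
      Metric.closedBall s0 (r j * (|ξ| + η)) := by
    refine Metric.closedBall_subset_closedBall' ?_
    rw [Real.dist_eq, add_sub_cancel_left, abs_mul, abs_of_pos hrj]
    linarith
  have h4 := (measure_mono hsub).trans_eq (measure_sdiff hin
    Metric.isClosed_closedBall.measurableSet.nullMeasurableSet
    (measure_closedBall_lt_top (μ := volume)).ne)
  rw [Real.volume_closedBall, Real.volume_closedBall, ← ENNReal.ofReal_sub _ (by positivity)] at h4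
  change volume (F ∩ Metric.closedBall s0 (r j * (|ξ| + η))) /
    volume (Metric.closedBall s0 (r j * (|ξ| + η))) ≤ _
  refine (ENNReal.div_le_div_right h4 _).trans ?_
  rw [Real.volume_closedBall, ← ENNReal.ofReal_div_of_pos (by positivity)]
  refine ENNReal.ofReal_le_ofReal (le_of_eq ?_)
  field_simp
  ring

section Curve

variable {k : ℕ}

theorem tendsto_transition {φ : ℝ → Fin k → ℝ} {i0 : Fin k} {s0 : ℝ}
    (hφ : DifferentiableAt ℝ φ s0) {u X : ℕ → ℝ} {x : ℝ} (hx : 0 < x)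
    (hX : Filter.Tendsto X Filter.atTop Filter.atTop)
    (hu : Filter.Tendsto (fun j => u j / X j) Filter.atTop (nhds x)) (ξ : ℝ) :
    Filter.Tendsto (fun p : ℕ × ℝ =>
        transition φ i0 s0 (u p.1) (X p.1) (((X p.1) ^ (k + 1))⁻¹ * p.2))
      (Filter.atTop ×ˢ nhds ξ)
      (nhds (flowMatrix i0 (tangentMatrix φ i0 s0)⁻¹ x ξ)) := by
  have hu' : Filter.Tendsto (fun p : ℕ × ℝ => u p.1 / X p.1) (Filter.atTop ×ˢ nhds ξ) (nhds x) :=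
    hu.comp Filter.tendsto_fst
  have hξ : Filter.Tendsto (fun p : ℕ × ℝ => p.2) (Filter.atTop ×ˢ nhds ξ) (nhds ξ) :=
    Filter.tendsto_snd
  have hX0 : ∀ᶠ p : ℕ × ℝ in Filter.atTop ×ˢ nhds ξ, X p.1 ≠ 0 :=
    (Filter.tendsto_fst (f := Filter.atTop) (g := nhds ξ)).eventually
      (hX.eventually_ne_atTop 0)
  have hh : Filter.Tendsto (fun p : ℕ × ℝ => s0 + ((X p.1) ^ (k + 1))⁻¹ * p.2)
      (Filter.atTop ×ˢ nhds ξ) (nhds s0) := by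
    have h1 : Filter.Tendsto (fun p : ℕ × ℝ => ((X p.1) ^ (k + 1))⁻¹)
        (Filter.atTop ×ˢ nhds ξ) (nhds 0) :=
      (((Filter.tendsto_pow_atTop (Nat.succ_ne_zero k)).comp hX).inv_tendsto_atTop).comp
        Filter.tendsto_fst
    simpa using (h1.mul hξ).const_add s0
  have hsl : Filter.Tendsto (fun p : ℕ × ℝ =>
      dslope φ s0 (s0 + ((X p.1) ^ (k + 1))⁻¹ * p.2) - deriv φ s0)
      (Filter.atTop ×ˢ nhds ξ) (nhds 0) := by
    have h1 := (continuousAt_dslope_same.2 hφ).tendsto.comp hh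
    rw [dslope_same] at h1
    simpa using h1.sub_const (deriv φ s0)
  refine tendsto_borderedMatrix (hu'.pow k) ?_ tendsto_const_nhds ?_
  · have h1 : Filter.Tendsto (fun p : ℕ × ℝ =>
        (Pi.single i0 ((u p.1 / X p.1) ^ k * p.2) : Fin k → ℝ) +
          ((u p.1 / X p.1) ^ k * p.2) • Matrix.vecMul
            (dslope φ s0 (s0 + ((X p.1) ^ (k + 1))⁻¹ * p.2) - deriv φ s0)
            (tangentMatrix φ i0 s0)⁻¹) (Filter.atTop ×ˢ nhds ξ)
        (nhds (Pi.single i0 (x ^ k * ξ) +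
          (x ^ k * ξ) • Matrix.vecMul 0 (tangentMatrix φ i0 s0)⁻¹)) := by
      have h2 := (hu'.pow k).mul hξ
      refine Filter.Tendsto.add ?_ (h2.smul ?_)
      · exact ((continuous_single i0).tendsto _).comp h2
      · exact ((continuous_id.matrix_vecMul continuous_const).tendsto _).comp hsl
    rw [Matrix.zero_vecMul, smul_zero, add_zero] at h1
    refine h1.congr' ?_
    filter_upwards [hX0] with p hp
    have h3 := sub_smul_dslope φ s0 (s0 + ((X p.1) ^ (k + 1))⁻¹ * p.2)
    rw [add_sub_cancel_left] at h3
    rw [← h3, ← smul_sub, Matrix.smul_vecMul, smul_smul]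
    have h4 : ((X p.1) ^ (k + 1))⁻¹ * p.2 * X p.1 ^ (k + 1) = p.2 := by field_simp
    have h5 : X p.1 * u p.1 ^ k * (((X p.1) ^ (k + 1))⁻¹ * p.2) = (u p.1 / X p.1) ^ k * p.2 := by
      rw [div_pow]; field_simp; ring
    rw [h4, h5]
  · exact (hu'.inv₀ hx.ne').smul_const _

theorem isTrapped_of_density {φ : ℝ → Fin k → ℝ} {i0 : Fin k} {s0 : ℝ}
    (hφ : DifferentiableAt ℝ φ s0) (hs0 : deriv φ s0 i0 ≠ 0) {F : Set ℝ}
    (hd : Filter.Tendsto (fun r => volume (F ∩ Metric.closedBall s0 r) /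
      volume (Metric.closedBall s0 r)) (nhdsWithin 0 (Set.Ioi 0)) (nhds 1))
    {μ : ℝ} {M : ℕ} (hF : ∀ s ∈ F, ∀ N : ℕ, M < N → ¬ AvoidsCube μ (curveLattice φ N s))
    {X : ℕ → ℝ} (hX : Filter.Tendsto X Filter.atTop Filter.atTop)
    {γ : ℕ → Matrix (Fin (k + 1)) (Fin (k + 1)) ℤ} (hγ : ∀ j, (γ j).det = 1)
    {Δ : Matrix (Fin (k + 1)) (Fin (k + 1)) ℝ} (hΔ : Δ.det ≠ 0)
    (h : Filter.Tendsto (fun j => flowMatrix i0 1 (X j) 0 * curveFrame φ i0 s0 *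
      (γ j).map (Int.cast : ℤ → ℝ)) Filter.atTop (nhds Δ)) :
    IsTrapped μ i0 (tangentMatrix φ i0 s0)⁻¹ Δ := by
  intro x hx ξ hcon
  have hB : (tangentMatrix φ i0 s0).det ≠ 0 := by rwa [det_tangentMatrix]
  have hdet : (flowMatrix i0 (tangentMatrix φ i0 s0)⁻¹ x ξ * Δ).det ≠ 0 := by
    rw [Matrix.det_mul, det_flowMatrix _ _ hx.ne', Matrix.det_nonsing_inv, Ring.inverse_eq_inv']
    exact mul_ne_zero (inv_ne_zero hB) hΔ
  have hN : Filter.Tendsto (fun j => ⌊x * X j⌋₊) Filter.atTop Filter.atTop :=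
    tendsto_nat_floor_atTop.comp (hX.const_mul_atTop hx)
  have hu : Filter.Tendsto (fun j => ((⌊x * X j⌋₊ : ℕ) : ℝ) / X j) Filter.atTop (nhds x) :=
    (tendsto_nat_floor_mul_div_atTop hx.le).comp hX
  have h1 := ((continuous_fst.matrix_mul continuous_snd).tendsto
    (flowMatrix i0 (tangentMatrix φ i0 s0)⁻¹ x ξ, Δ)).comp
    ((tendsto_transition (i0 := i0) hφ hx hX hu ξ).prodMk_nhds
      (h.comp (Filter.tendsto_fst (g := nhds ξ))))
  have h2 := h1.eventually (eventually_avoidsCube hdet hcon)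
  obtain ⟨pa, hpa, pb, hpb, hp⟩ := Filter.eventually_prod_iff.1 h2
  obtain ⟨η, hη, hball⟩ := Metric.nhds_basis_closedBall.eventually_iff.1 hpb
  have hr : Filter.Tendsto (fun j => ((X j) ^ (k + 1))⁻¹) Filter.atTop (nhds 0) :=
    ((Filter.tendsto_pow_atTop (Nat.succ_ne_zero k)).comp hX).inv_tendsto_atTop
  have hX0 := hX.eventually_gt_atTop 0
  have h3 := eventually_exists_mem_of_density hd (r := fun j => ((X j) ^ (k + 1))⁻¹)
    (by filter_upwards [hX0] with j hj; positivity) hr ξ hη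
  obtain ⟨j, hj1, ⟨ξ', hξ', hmem⟩, hj3, hj4⟩ :=
    (hpa.and (h3.and (hX0.and (hN.eventually_gt_atTop M)))).exists
  have h4 := hp hj1 (hball hξ')
  simp only [Function.comp_apply] at h4
  rw [← Matrix.mul_assoc, transition_mul hj3.ne' hs0] at h4
  exact hF _ hmem _ hj4 (h4.of_mul_unimodular (hγ j))

end Curve

section Pairs

theorem sum_idxPair_add_swap {M : Type*} [AddCommMonoid M] {n : ℕ} (f : Fin n → Fin n → M) :
    ∑ p : IdxPair n, (f p.1.1 p.1.2 + f p.1.2 p.1.1) + ∑ i, f i i = ∑ i, ∑ j, f i j := by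
  have h1 : ∀ i j, f i j = (if i < j then f i j else 0) + (if j < i then f i j else 0) +
      (if i = j then f i j else 0) := by
    intro i j
    rcases lt_trichotomy i j with h | h | h
    · simp [h, h.ne, h.le.not_gt]
    · simp [h]
    · simp [h, h.ne', h.le.not_gt]
  have h2 : ∀ g : Fin n → Fin n → M,
      ∑ p : IdxPair n, g p.1.1 p.1.2 = ∑ i, ∑ j, if i < j then g i j else 0 := by
    intro g
    rw [← Finset.sum_subtype (Finset.univ.filter fun p : Fin n × Fin n => p.1 < p.2) (by simp)
      (fun p => g p.1 p.2), Finset.sum_filter, Fintype.sum_prod_type]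
  have h3 : ∑ i, ∑ j, f i j = ∑ i, ∑ j, ((if i < j then f i j else 0) +
      (if j < i then f i j else 0) + (if i = j then f i j else 0)) :=
    Finset.sum_congr rfl fun i _ => Finset.sum_congr rfl fun j _ => h1 i j
  rw [h3, Finset.sum_add_distrib, h2, h2 fun i j => f j i]
  simp only [Finset.sum_add_distrib]
  rw [Finset.sum_comm (f := fun i j => if j < i then f i j else 0)]
  simp

theorem prod_idxPair_mul {n : ℕ} {κ : Fin n → ℝ} (hκ : ∀ i, 0 < κ i) (h : ∏ i, κ i = 1) :
    ∏ p : IdxPair n, κ p.1.1 * κ p.1.2 = 1 := by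
  refine Real.eq_one_of_pos_of_log_eq_zero (Finset.prod_pos fun p _ => mul_pos (hκ _) (hκ _)) ?_
  have h0 : ∑ i, Real.log (κ i) = 0 := by
    rw [← Real.log_prod fun i _ => (hκ i).ne', h, Real.log_one]
  have h1 := sum_idxPair_add_swap fun (i _ : Fin n) => Real.log (κ i)
  rw [h0, add_zero] at h1
  rw [Real.log_prod fun p _ => (mul_pos (hκ _) (hκ _)).ne',
    Finset.sum_congr rfl fun p _ => Real.log_mul (hκ _).ne' (hκ _).ne', h1]
  simp [← Finset.mul_sum, h0]

/-- The `2 × 2` minor of rows `a`, `b` of `Y (x v)`. -/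
def rowMinor {ι : Type*} [Fintype ι] {R : Type*} (Y : Matrix R ι ℝ) (x v : ι → ℤ) (a b : R) : ℝ :=
  Y.mulVec (fun l => (x l : ℝ)) a * Y.mulVec (fun l => (v l : ℝ)) b -
    Y.mulVec (fun l => (x l : ℝ)) b * Y.mulVec (fun l => (v l : ℝ)) a

/-- Plücker coordinates of a pair of integer vectors. -/
def wedge {n : ℕ} (x v : Fin n → ℤ) (q : IdxPair n) : ℤ := x q.1.1 * v q.1.2 - x q.1.2 * v q.1.1

theorem sum_compoundTwo_mul_wedge {n : ℕ} (A : Matrix (Fin n) (Fin n) ℝ) (x v : Fin n → ℤ)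
    (p : IdxPair n) :
    ∑ q, compoundTwo A p q * (wedge x v q : ℝ) = rowMinor A x v p.1.1 p.1.2 := by
  have h1 := sum_idxPair_add_swap fun i j =>
    A p.1.1 i * A p.1.2 j * ((x i : ℝ) * v j - x j * v i)
  rw [Finset.sum_eq_zero (s := Finset.univ) (f := fun i =>
    A p.1.1 i * A p.1.2 i * ((x i : ℝ) * v i - x i * v i)) fun i _ => by ring, add_zero] at h1
  rw [rowMinor, Finset.sum_congr rfl fun q _ =>
    (show compoundTwo A p q * (wedge x v q : ℝ) = A p.1.1 q.1.1 * A p.1.2 q.1.2 *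
      ((x q.1.1 : ℝ) * v q.1.2 - x q.1.2 * v q.1.1) + A p.1.1 q.1.2 * A p.1.2 q.1.1 *
      ((x q.1.2 : ℝ) * v q.1.1 - x q.1.1 * v q.1.2) by
        simp only [compoundTwo, wedge, Matrix.of_apply]; push_cast; ring), h1]
  simp only [Matrix.mulVec, dotProduct, Finset.sum_mul_sum]
  rw [Finset.sum_comm (f := fun i j => A p.1.2 i * (x i : ℝ) * (A p.1.1 j * (v j : ℝ))),
    ← Finset.sum_sub_distrib]
  refine Finset.sum_congr rfl fun i _ => ?_
  rw [← Finset.sum_sub_distrib]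
  exact Finset.sum_congr rfl fun j _ => by ring

theorem wedge_ne_zero {n : ℕ} {x v : Fin n → ℤ}
    (h : ∀ s t : ℤ, s • x + t • v = 0 → s = 0 ∧ t = 0) : wedge x v ≠ 0 := by
  intro h0
  have h1 : ∀ i j, x i * v j - x j * v i = 0 := by
    intro i j
    rcases lt_trichotomy i j with hij | hij | hij
    · exact congrFun h0 ⟨(i, j), hij⟩
    · subst hij; ring
    · have := congrFun h0 ⟨(j, i), hij⟩
      simp only [wedge, Pi.zero_apply] at this
      linarith
  have h2 : ∀ i, v i = 0 ∧ x i = 0 := fun i => by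
    have := h (v i) (-x i) (by
      funext j
      simp only [Pi.add_apply, Pi.smul_apply, smul_eq_mul, Pi.zero_apply]
      linarith [h1 j i])
    exact ⟨this.1, neg_eq_zero.1 this.2⟩
  have := h 1 1 (by funext i; simp [h2 i])
  exact one_ne_zero this.1

variable {k : ℕ}

/-- Every pair of independent integer vectors has a `2 × 2` row minor of size at least `R`, or the
minor of rows `0` and `i0.succ` is at least `η`. -/
def SpreadsPairs (i0 : Fin k) (R η : ℝ) (Y : Matrix (Fin (k + 1)) (Fin (k + 1)) ℝ) : Prop :=
  ∀ x v : Fin (k + 1) → ℤ, (∀ s t : ℤ, s • x + t • v = 0 → s = 0 ∧ t = 0) →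
    (∃ a b, R ≤ |rowMinor Y x v a b|) ∨ η ≤ |rowMinor Y x v 0 i0.succ|

theorem SpreadsPairs.mul_unimodular {i0 : Fin k} {R η : ℝ}
    {Y : Matrix (Fin (k + 1)) (Fin (k + 1)) ℝ} (h : SpreadsPairs i0 R η Y)
    {γ : Matrix (Fin (k + 1)) (Fin (k + 1)) ℤ} (hγ : γ.det = 1) :
    SpreadsPairs i0 R η (Y * γ.map (Int.cast : ℤ → ℝ)) := by
  intro x v hxv
  have h1 : ∀ a b, rowMinor (Y * γ.map (Int.cast : ℤ → ℝ)) x v a b =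
      rowMinor Y (γ.mulVec x) (γ.mulVec v) a b := fun a b => by
    simp only [rowMinor, ← Matrix.mulVec_mulVec, map_intCast_mulVec]
  simp only [h1]
  refine h _ _ fun s t hst => hxv s t ?_
  rw [← Matrix.mulVec_smul, ← Matrix.mulVec_smul, ← Matrix.mulVec_add] at hst
  exact Matrix.eq_zero_of_mulVec_eq_zero (by rw [hγ]; exact one_ne_zero) hst

theorem continuous_rowMinor (x v : Fin (k + 1) → ℤ) (a b : Fin (k + 1)) :
    Continuous fun Y : Matrix (Fin (k + 1)) (Fin (k + 1)) ℝ => rowMinor Y x v a b := by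
  have h : ∀ (w : Fin (k + 1) → ℤ) (c : Fin (k + 1)), Continuous fun
      Y : Matrix (Fin (k + 1)) (Fin (k + 1)) ℝ => Y.mulVec (fun l => (w l : ℝ)) c := fun w c =>
    (continuous_apply c).comp (continuous_id.matrix_mulVec continuous_const)
  exact ((h x a).mul (h v b)).sub ((h x b).mul (h v a))

theorem SpreadsPairs.of_tendsto {i0 : Fin k} {R η : ℝ}
    {Y : ℕ → Matrix (Fin (k + 1)) (Fin (k + 1)) ℝ} {Y' : Matrix (Fin (k + 1)) (Fin (k + 1)) ℝ}
    (hY : Filter.Tendsto Y Filter.atTop (nhds Y')) (h : ∀ j, SpreadsPairs i0 R η (Y j)) :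
    SpreadsPairs i0 R η Y' := by
  intro x v hxv
  by_contra! hcon
  have h1 : ∀ a b, Filter.Tendsto (fun j => |rowMinor (Y j) x v a b|) Filter.atTop
      (nhds |rowMinor Y' x v a b|) := fun a b =>
    (((continuous_rowMinor x v a b).tendsto Y').comp hY).abs
  have h2 : ∀ᶠ j in Filter.atTop, ∀ a b, |rowMinor (Y j) x v a b| < R :=
    Filter.eventually_all.2 fun a => Filter.eventually_all.2 fun b =>
      (h1 a b).eventually_lt_const (hcon.1 a b)
  obtain ⟨j, hj, hj'⟩ := (h2.and ((h1 0 i0.succ).eventually_lt_const hcon.2)).exists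
  rcases h j x v hxv with ⟨a, b, hab⟩ | hD
  · exact (hj a b).not_ge hab
  · exact hj'.not_ge hD

end Pairs

section Select

variable {k : ℕ}

/-- The frame at `s` in the coordinates adapted to the scales `N` and `t`. -/
noncomputable def scaledFrame (φ : ℝ → Fin k → ℝ) (i0 : Fin k) (t N s : ℝ) :
    Matrix (Fin (k + 1)) (Fin (k + 1)) ℝ :=
  dilate i0 (t ^ (k + 1))⁻¹ (flowMatrix i0 1 (t ^ 2 * N) 0 * curveFrame φ i0 s)

theorem dilate_scaledFrame (φ : ℝ → Fin k → ℝ) (i0 : Fin k) {t : ℝ} (ht : t ≠ 0) (N s : ℝ) :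
    dilate i0 (t ^ (k + 1)) (scaledFrame φ i0 t N s) =
      flowMatrix i0 1 (t ^ 2 * N) 0 * curveFrame φ i0 s := by
  have h : t ^ (k + 1) ≠ 0 := pow_ne_zero _ ht
  ext i j
  refine Fin.cases ?_ (fun i => ?_) i
  · rw [dilate_apply_zero, scaledFrame, dilate_apply_zero, mul_inv_cancel_left₀ h]
  · rw [dilate_apply_succ, scaledFrame, dilate_apply_succ]
    split_ifs
    · rw [inv_inv, inv_mul_cancel_left₀ h]
    · simp

theorem det_scaledFrame (φ : ℝ → Fin k → ℝ) (i0 : Fin k) {t N : ℝ} (ht : t ≠ 0) (hN : N ≠ 0)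
    (s : ℝ) : (scaledFrame φ i0 t N s).det = -deriv φ s i0 := by
  rw [scaledFrame, det_dilate _ (inv_ne_zero (pow_ne_zero _ ht)), Matrix.det_mul,
    det_flowMatrix _ _ (mul_ne_zero (pow_ne_zero _ ht) hN), Matrix.det_one, one_mul,
    det_curveFrame]

/-- The weights of the rows of `scaledFrame` relative to their powers of `N`. -/
noncomputable def frameWeight (i0 : Fin k) (t : ℝ) : Fin (k + 1) → ℝ :=
  Fin.cons ((t ^ (k + 1))⁻¹ * (t ^ 2) ^ k)
    fun a => (if a = i0 then t ^ (k + 1) else 1) * (t ^ 2)⁻¹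

theorem frameWeight_pos (i0 : Fin k) {t : ℝ} (ht : 0 < t) (i : Fin (k + 1)) :
    0 < frameWeight i0 t i := by
  refine Fin.cases ?_ (fun a => ?_) i
  · simp only [frameWeight, Fin.cons_zero]; positivity
  · simp only [frameWeight, Fin.cons_succ]; split_ifs <;> positivity

theorem prod_frameWeight (i0 : Fin k) {t : ℝ} (ht : t ≠ 0) : ∏ i, frameWeight i0 t i = 1 := by
  rw [Fin.prod_univ_succ]
  simp only [frameWeight, Fin.cons_zero, Fin.cons_succ, Finset.prod_mul_distrib]
  rw [Finset.prod_ite_eq' Finset.univ i0]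
  simp only [Finset.mem_univ, if_true, Finset.prod_const, Finset.card_univ, Fintype.card_fin]
  rw [inv_pow]
  field_simp

theorem scaledFrame_apply (φ : ℝ → Fin k → ℝ) (i0 : Fin k) (t N s : ℝ) (i l : Fin (k + 1)) :
    scaledFrame φ i0 t N s i l =
      frameWeight i0 t i * N ^ (if i = 0 then (k : ℤ) else -1) * curveFrame φ i0 s i l := by
  rw [scaledFrame, curveFrame, flowMatrix_mul_borderedMatrix]
  simp only [Matrix.one_mul, Matrix.one_mulVec, zero_mul, add_zero]
  refine Fin.cases ?_ (fun i => ?_) i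
  · rw [dilate_apply_zero]
    refine Fin.cases ?_ (fun l => ?_) l <;>
    simp [borderedMatrix, frameWeight, mul_pow] <;> ring
  · rw [dilate_apply_succ]
    refine Fin.cases ?_ (fun l => ?_) l
    · simp [borderedMatrix]
    · simp [borderedMatrix, frameWeight]; split_ifs <;> ring

theorem scaledFrame_mulVec (φ : ℝ → Fin k → ℝ) (i0 : Fin k) (t N s : ℝ) (w : Fin (k + 1) → ℝ)
    (i : Fin (k + 1)) :
    (scaledFrame φ i0 t N s).mulVec w i = frameWeight i0 t i *
      N ^ (if i = 0 then (k : ℤ) else -1) * (curveFrame φ i0 s).mulVec w i := by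
  simp only [Matrix.mulVec, dotProduct, scaledFrame_apply, Finset.mul_sum, mul_assoc]

theorem rowMinor_scaledFrame (φ : ℝ → Fin k → ℝ) (i0 : Fin k) (t : ℝ) {N : ℝ} (hN : N ≠ 0) (s : ℝ)
    (x v : Fin (k + 1) → ℤ) {a b : Fin (k + 1)} (hab : a < b) :
    rowMinor (scaledFrame φ i0 t N s) x v a b = frameWeight i0 t a * frameWeight i0 t b *
      N ^ (if a = 0 then (k : ℤ) - 1 else -2) * rowMinor (curveFrame φ i0 s) x v a b := by
  have hb : b ≠ 0 := (Fin.zero_le a).trans_lt hab |>.ne'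
  have h : N ^ (if a = 0 then (k : ℤ) - 1 else -2) =
      N ^ (if a = 0 then (k : ℤ) else -1) * N ^ (if b = 0 then (k : ℤ) else -1) := by
    rw [← zpow_add₀ hN, if_neg hb]
    congr 1
    split_ifs <;> ring
  rw [h]
  simp only [rowMinor, scaledFrame_mulVec]
  ring

theorem eventually_volume_frame_le {φ : ℝ → Fin k → ℝ} {i0 : Fin k} {c r δ ε : ℝ}
    (h : ∀ κ : Fin (k + 1) → ℝ, (∀ i, 0 < κ i) → ∏ i, κ i = 1 → ∀ᶠ N : ℕ in Filter.atTop,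
      volume {x ∈ Metric.closedBall c r | ∃ w : Fin (k + 1) → ℤ, w ≠ 0 ∧
          ∀ i, |κ i * (N : ℝ) ^ (if i = 0 then (k : ℤ) else -1) *
            ∑ l, curveFrame φ i0 x i l * (w l : ℝ)| ≤ ε} ≤ ENNReal.ofReal δ) {t : ℝ} (ht : 0 < t) :
    ∀ᶠ N : ℕ in Filter.atTop, volume {s ∈ Metric.closedBall c r |
      ¬ ∀ m : Fin (k + 1) → ℤ, m ≠ 0 → ∃ i,
        ε ≤ |(scaledFrame φ i0 t N s).mulVec (fun l => (m l : ℝ)) i|} ≤ ENNReal.ofReal δ := by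
  filter_upwards [h _ (frameWeight_pos i0 ht) (prod_frameWeight i0 ht.ne')] with N hN
  refine (measure_mono ?_).trans hN
  rintro s ⟨hs, hs'⟩
  push Not at hs'
  obtain ⟨m, hm, hm'⟩ := hs'
  refine ⟨hs, m, hm, fun i => ?_⟩
  have := hm' i
  rw [scaledFrame_mulVec] at this
  exact this.le

theorem exists_eventually_volume_not_spreadsPairs_le {φ : ℝ → Fin k → ℝ} {i0 : Fin k}
    {c r δ ε : ℝ} (hε : 0 < ε)
    (h : ∀ κ : IdxPair (k + 1) → ℝ, (∀ p, 0 < κ p) → ∏ p, κ p = 1 → ∀ᶠ N : ℕ in Filter.atTop,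
      volume {x ∈ Metric.closedBall c r | ∃ w : IdxPair (k + 1) → ℤ, w ≠ 0 ∧
          ∀ p, |κ p * (N : ℝ) ^ (if p.1.1 = 0 then (k : ℤ) - 1 else -2) *
            ∑ l, compoundTwo (curveFrame φ i0 x) p l * (w l : ℝ)| ≤ ε} ≤ ENNReal.ofReal δ)
    {R : ℝ} (hR : 0 < R) :
    ∃ η > 0, ∀ t : ℝ, 0 < t → ∀ᶠ N : ℕ in Filter.atTop, volume {s ∈ Metric.closedBall c r |
      ¬ SpreadsPairs i0 R η (scaledFrame φ i0 t N s)} ≤ ENNReal.ofReal δ := by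
  set D : IdxPair (k + 1) := ⟨(0, i0.succ), i0.succ_pos⟩ with hD
  set R' := R / ε with hR'
  have hR'0 : 0 < R' := div_pos hR hε
  set w : IdxPair (k + 1) → ℝ := fun p =>
    R'⁻¹ * (if p = D then R' ^ Fintype.card (IdxPair (k + 1)) else 1) with hw
  have hw0 : ∀ p, 0 < w p := fun p => by
    simp only [hw]; split_ifs <;> positivity
  have hw1 : ∏ p, w p = 1 := by
    simp only [hw, Finset.prod_mul_distrib]
    rw [Finset.prod_ite_eq' Finset.univ D]
    simp only [Finset.mem_univ, if_true, Finset.prod_const, Finset.card_univ]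
    rw [← mul_pow, inv_mul_cancel₀ hR'0.ne', one_pow]
  refine ⟨ε / w D, div_pos hε (hw0 D), fun t ht => ?_⟩
  filter_upwards [h (fun p => w p * (frameWeight i0 t p.1.1 * frameWeight i0 t p.1.2))
    (fun p => mul_pos (hw0 p) (mul_pos (frameWeight_pos i0 ht _) (frameWeight_pos i0 ht _)))
    (by rw [Finset.prod_mul_distrib, hw1, one_mul,
      prod_idxPair_mul (frameWeight_pos i0 ht) (prod_frameWeight i0 ht.ne')]),
    Filter.eventually_gt_atTop 0] with N hN hN0
  refine (measure_mono ?_).trans hN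
  rintro s ⟨hs, hs'⟩
  rw [SpreadsPairs] at hs'
  push Not at hs'
  obtain ⟨x, v, hxv, hlt, hDlt⟩ := hs'
  refine ⟨hs, wedge x v, wedge_ne_zero hxv, fun p => ?_⟩
  rw [sum_compoundTwo_mul_wedge]
  have h1 : w p * (frameWeight i0 t p.1.1 * frameWeight i0 t p.1.2) *
      (N : ℝ) ^ (if p.1.1 = 0 then (k : ℤ) - 1 else -2) *
        rowMinor (curveFrame φ i0 s) x v p.1.1 p.1.2 =
      w p * rowMinor (scaledFrame φ i0 t N s) x v p.1.1 p.1.2 := by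
    rw [rowMinor_scaledFrame φ i0 t (by positivity) s x v p.2]
    ring
  rw [h1, abs_mul, abs_of_pos (hw0 p)]
  by_cases hp : p = D
  · subst hp
    rw [mul_comm]
    exact ((lt_div_iff₀ (hw0 D)).1 hDlt).le
  · have h2 : w p = R'⁻¹ := by simp [hw, hp]
    rw [h2, hR', inv_div, div_mul_eq_mul_div, div_le_iff₀ hR]
    exact mul_le_mul_of_nonneg_left (hlt _ _).le hε.le

end Select

theorem measure_eventually_mem_le {α : Type*} [MeasurableSpace α] {ν : Measure α} {B : ℕ → Set α}
    {δ : ENNReal} (h : ∀ᶠ n in Filter.atTop, ν (B n) ≤ δ) :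
    ν {s | ∀ᶠ n in Filter.atTop, s ∈ B n} ≤ δ := by
  have h1 : {s | ∀ᶠ n in Filter.atTop, s ∈ B n} = ⋃ n, ⋂ m ≥ n, B m := by
    ext s
    simp [Filter.eventually_atTop]
  obtain ⟨n0, hn0⟩ := Filter.eventually_atTop.1 h
  have hmono : Monotone fun n => ⋂ m ≥ n, B m := fun a b hab =>
    Set.biInter_subset_biInter_left fun m (hm : b ≤ m) => hab.trans hm
  rw [h1, hmono.measure_iUnion]
  refine iSup_le fun n => (measure_mono (Set.biInter_subset_of_mem (le_max_left n n0))).trans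
    (hn0 _ (le_max_right _ _))

theorem exists_subseq_tendsto_of_abs_le {ι κ : Type*} [Fintype ι] [Fintype κ] {C : ℝ}
    {Y : ℕ → Matrix ι κ ℝ} (hY : ∀ n i j, |Y n i j| ≤ C) :
    ∃ (Y' : Matrix ι κ ℝ) (f : ℕ → ℕ), StrictMono f ∧
      Filter.Tendsto (fun n => Y (f n)) Filter.atTop (nhds Y') := by
  have hK : IsCompact (Set.pi Set.univ fun _ : ι => Set.pi Set.univ fun _ : κ => Set.Icc (-C) C) :=
    isCompact_univ_pi fun _ => isCompact_univ_pi fun _ => isCompact_Icc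
  obtain ⟨Y', -, f, hf, h⟩ := IsCompact.tendsto_subseq (X := ι → κ → ℝ) hK (x := Y)
    fun n i _ j _ => abs_le.1 (hY n i j)
  exact ⟨Y', f, hf, h⟩

section Limit

variable {k : ℕ}

theorem exists_isTrapped_limit {φ : ℝ → Fin k → ℝ} {i0 : Fin k} {s0 : ℝ}
    (hφ : DifferentiableAt ℝ φ s0) (hs0 : deriv φ s0 i0 ≠ 0) {F : Set ℝ}
    (hd : Filter.Tendsto (fun r => volume (F ∩ Metric.closedBall s0 r) /
      volume (Metric.closedBall s0 r)) (nhdsWithin 0 (Set.Ioi 0)) (nhds 1))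
    {μ : ℝ} {M : ℕ} (hF : ∀ s ∈ F, ∀ N : ℕ, M < N → ¬ AvoidsCube μ (curveLattice φ N s))
    {ε : ℝ} (hε : 0 < ε) :
    ∃ C, ∀ t : ℝ, 0 < t → ∀ (J : Set ℕ) (η : ℕ → ℝ), (∃ᶠ N : ℕ in Filter.atTop,
      (∀ m : Fin (k + 1) → ℤ, m ≠ 0 → ∃ i,
        ε ≤ |(scaledFrame φ i0 t N s0).mulVec (fun l => (m l : ℝ)) i|) ∧
      ∀ R ∈ J, SpreadsPairs i0 R (η R) (scaledFrame φ i0 t N s0)) →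
    ∃ Y : Matrix (Fin (k + 1)) (Fin (k + 1)) ℝ, (∀ i j, |Y i j| ≤ C) ∧
      |Y.det| = |deriv φ s0 i0| ∧
      IsTrapped μ i0 (tangentMatrix φ i0 s0)⁻¹ (dilate i0 (t ^ (k + 1)) Y) ∧
      ∀ R ∈ J, SpreadsPairs i0 R (η R) Y := by
  obtain ⟨C, -, hC⟩ := exists_unimodular_mul_bounded (ι := Fin (k + 1)) hε (abs_pos.2 hs0)
  refine ⟨C, fun t ht J η h => ?_⟩
  obtain ⟨f, hf, hf'⟩ := Filter.extraction_of_frequently_atTop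
    (h.and_eventually (Filter.eventually_gt_atTop 0))
  have hfpos : ∀ n, (0 : ℝ) < f n := fun n => by exact_mod_cast (hf' n).2
  have hdet : ∀ n, |(scaledFrame φ i0 t (f n) s0).det| = |deriv φ s0 i0| := fun n => by
    rw [det_scaledFrame φ i0 ht.ne' (hfpos n).ne', abs_neg]
  choose γ hγ hγC using fun n => hC (scaledFrame φ i0 t (f n) s0) (hdet n) (hf' n).1.1
  obtain ⟨Y, g, hg, hY⟩ := exists_subseq_tendsto_of_abs_le hγC
  have hdet' : ∀ n, |(scaledFrame φ i0 t (f n) s0 * (γ n).map (Int.cast : ℤ → ℝ)).det| =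
      |deriv φ s0 i0| := fun n => by
    rw [Matrix.det_mul, det_map_intCast_eq_one (hγ n), mul_one, hdet]
  have hYdet : |Y.det| = |deriv φ s0 i0| := by
    refine tendsto_nhds_unique (((continuous_id.matrix_det.tendsto Y).comp hY).abs) ?_
    simp only [Function.comp_def, id, hdet']
    exact tendsto_const_nhds
  refine ⟨Y, fun i j => ?_, hYdet, ?_, fun R hR => ?_⟩
  · exact le_of_tendsto' ((tendsto_pi_nhds.1 ((tendsto_pi_nhds.1 hY) i) j).abs)
      fun n => hγC _ i j
  · refine isTrapped_of_density (X := fun n => t ^ 2 * (f (g n) : ℝ)) (γ := fun n => γ (g n))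
      hφ hs0 hd hF ?_ (fun n => hγ _) ?_ ?_
    · exact ((tendsto_natCast_atTop_atTop.comp hf.tendsto_atTop).comp
        hg.tendsto_atTop).const_mul_atTop (by positivity)
    · rw [det_dilate _ (pow_ne_zero _ ht.ne')]
      exact abs_pos.1 (by rw [hYdet]; exact abs_pos.2 hs0)
    · have hc : Continuous fun A : Matrix (Fin (k + 1)) (Fin (k + 1)) ℝ =>
          dilate i0 (t ^ (k + 1)) A := by
        refine continuous_pi fun i => continuous_pi fun j => ?_
        refine Fin.cases ?_ (fun i => ?_) i
        · simp only [dilate_apply_zero]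
          exact continuous_const.mul (continuous_apply_apply 0 j)
        · simp only [dilate_apply_succ]
          exact continuous_const.mul (continuous_apply_apply i.succ j)
      have h1 := (hc.tendsto Y).comp hY
      refine h1.congr fun n => ?_
      simp only [Function.comp_apply]
      rw [dilate_mul, dilate_scaledFrame φ i0 ht.ne']
  · exact SpreadsPairs.of_tendsto hY fun n => ((hf' _).1.2 R hR).mul_unimodular (hγ _)

theorem false_of_density (hk : 0 < k) {φ : ℝ → Fin k → ℝ} {i0 : Fin k} {s0 : ℝ}
    (hφ : DifferentiableAt ℝ φ s0) (hs0 : deriv φ s0 i0 ≠ 0) {F : Set ℝ}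
    (hd : Filter.Tendsto (fun r => volume (F ∩ Metric.closedBall s0 r) /
      volume (Metric.closedBall s0 r)) (nhdsWithin 0 (Set.Ioi 0)) (nhds 1))
    {μ : ℝ} (hμ0 : 0 < μ) (hμ1 : μ < 1) {M : ℕ}
    (hF : ∀ s ∈ F, ∀ N : ℕ, M < N → ¬ AvoidsCube μ (curveLattice φ N s))
    {ε : ℝ} (hε : 0 < ε) {η : ℕ → ℝ} (hη : ∀ R, 0 < η R)
    (h : ∃ᶠ t : ℕ in Filter.atTop, ∃ᶠ N : ℕ in Filter.atTop,
      (∀ m : Fin (k + 1) → ℤ, m ≠ 0 → ∃ i,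
        ε ≤ |(scaledFrame φ i0 t N s0).mulVec (fun l => (m l : ℝ)) i|) ∧
      ∀ R ∈ Set.Ioo 0 t, SpreadsPairs i0 R (η R) (scaledFrame φ i0 t N s0)) : False := by
  obtain ⟨C, hC⟩ := exists_isTrapped_limit hφ hs0 hd hF hε
  obtain ⟨f, hf, hf'⟩ := Filter.extraction_of_frequently_atTop
    (h.and_eventually (Filter.eventually_gt_atTop 0))
  have hfpos : ∀ n, (0 : ℝ) < f n := fun n => by exact_mod_cast (hf' n).2
  choose Y hYC hYdet hYtr hYsp using fun n => hC (f n) (hfpos n) _ η (hf' n).1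
  obtain ⟨Y', g, hg, hY⟩ := exists_subseq_tendsto_of_abs_le hYC
  have hfg : Filter.Tendsto (fun n => f (g n)) Filter.atTop Filter.atTop :=
    hf.tendsto_atTop.comp hg.tendsto_atTop
  have hV := abs_pos.2 hs0
  refine false_of_isTrapped_dilate hk hμ0 hμ1 (E := (tangentMatrix φ i0 s0)⁻¹) hY hV
    (fun n => hYdet _) ?_ (T := fun n => ((f (g n) : ℕ) : ℝ) ^ (k + 1)) ?_ (fun n => hYtr _) ?_
  · rw [Matrix.det_nonsing_inv, Ring.inverse_eq_inv', det_tangentMatrix, abs_inv,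
      inv_mul_cancel₀ hV.ne']
  · exact (Filter.tendsto_pow_atTop (Nat.succ_ne_zero k)).comp
      (tendsto_natCast_atTop_atTop.comp hfg)
  · intro x v hxv
    change rowMinor Y' x v 0 i0.succ ≠ 0
    have h1 : ∀ a b, Filter.Tendsto (fun j => |rowMinor (Y (g j)) x v a b|) Filter.atTop
        (nhds |rowMinor Y' x v a b|) := fun a b =>
      (((continuous_rowMinor x v a b).tendsto Y').comp hY).abs
    set R : ℕ := ⌊∑ a, ∑ b, |rowMinor Y' x v a b|⌋₊ + 1 with hR
    have hlt : ∀ a b, |rowMinor Y' x v a b| < R := fun a b => by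
      refine lt_of_le_of_lt ?_ ((Nat.lt_floor_add_one (∑ a, ∑ b, |rowMinor Y' x v a b|)).trans_eq
        (by rw [hR]; push_cast; rfl))
      refine (Finset.single_le_sum (f := fun b => |rowMinor Y' x v a b|)
        (fun _ _ => abs_nonneg _) (Finset.mem_univ b)).trans ?_
      exact Finset.single_le_sum (f := fun a => ∑ b, |rowMinor Y' x v a b|)
        (fun _ _ => Finset.sum_nonneg fun _ _ => abs_nonneg _) (Finset.mem_univ a)
    have h2 : ∀ᶠ j in Filter.atTop, ∀ a b, |rowMinor (Y (g j)) x v a b| < R :=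
      Filter.eventually_all.2 fun a => Filter.eventually_all.2 fun b =>
        (h1 a b).eventually_lt_const (hlt a b)
    have h3 : η R ≤ |rowMinor Y' x v 0 i0.succ| := by
      refine ge_of_tendsto (h1 0 i0.succ) ?_
      filter_upwards [h2, hfg.eventually_gt_atTop R] with j hj hRj
      rcases hYsp (g j) R ⟨Nat.succ_pos _, hRj⟩ x v hxv with ⟨a, b, hab⟩ | hD
      · exact absurd (hj a b) hab.not_gt
      · exact hD
    exact abs_pos.1 ((hη R).trans_le h3)

end Limit

section Null

variable {k : ℕ}

theorem analyticAt_curveFrame {φ : ℝ → Fin k → ℝ} {i0 : Fin k} {s0 : ℝ} (hφ : AnalyticAt ℝ φ s0)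
    (i l : Fin (k + 1)) : AnalyticAt ℝ (fun s => curveFrame φ i0 s i l) s0 := by
  have h1 : ∀ j, AnalyticAt ℝ (fun s => φ s j) s0 := analyticAt_pi_iff.1 hφ
  have h2 : ∀ j, AnalyticAt ℝ (fun s => deriv φ s j) s0 := analyticAt_pi_iff.1 hφ.deriv
  refine Fin.cases ?_ (fun i => ?_) i <;> refine Fin.cases ?_ (fun l => ?_) l
  · simpa [curveFrame, borderedMatrix] using analyticAt_const
  · simpa [curveFrame, borderedMatrix] using h1 l
  · simpa [curveFrame, borderedMatrix] using analyticAt_const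
  · by_cases hi : i = i0
    · subst hi
      simpa [curveFrame, borderedMatrix, tangentMatrix] using h2 l
    · simpa [curveFrame, borderedMatrix, tangentMatrix, Matrix.updateRow_ne hi]
        using analyticAt_const

theorem exists_radius_volume_eq_zero (hk : 0 < k) {φ : ℝ → Fin k → ℝ} {i0 : Fin k} {c : ℝ}
    (hφ : AnalyticAt ℝ φ c) (hc : deriv φ c i0 ≠ 0)
    (hgen : ∀ v : Fin (k + 1) → ℝ, v ≠ 0 →
      ∀ᶠ s in nhdsWithin c {c}ᶜ, ∑ i, v i * curveFrame φ i0 s 0 i ≠ 0)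
    {μ : ℝ} (hμ0 : 0 < μ) (hμ1 : μ < 1) :
    ∃ r > 0, ∀ M : ℕ, volume {s ∈ Metric.closedBall c r |
      ∀ N : ℕ, M < N → ¬ AvoidsCube μ (curveLattice φ N s)} = 0 := by
  have hdet : (curveFrame φ i0 c).det ≠ 0 := by rwa [det_curveFrame, neg_ne_zero]
  obtain ⟨r1, hr1, h1⟩ := exists_radius_frame_volume_le (analyticAt_curveFrame hφ) hdet hgen
  obtain ⟨r2, hr2, h2⟩ := exists_radius_compoundTwo_volume_le (analyticAt_curveFrame hφ) hdet hgen
  have h3 : ∀ᶠ s in nhds c, DifferentiableAt ℝ φ s ∧ deriv φ s i0 ≠ 0 := by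
    have h4 : ContinuousAt (fun s => deriv φ s i0) c :=
      (continuous_apply i0).continuousAt.comp hφ.deriv.continuousAt
    filter_upwards [hφ.eventually_analyticAt, h4.eventually_ne hc] with s hs hs'
    exact ⟨hs.differentiableAt, hs'⟩
  obtain ⟨r3, hr3, hball⟩ := Metric.nhds_basis_closedBall.eventually_iff.1 h3
  set r := min r1 (min r2 r3) with hr
  have hr0 : 0 < r := lt_min hr1 (lt_min hr2 hr3)
  refine ⟨r, hr0, fun M => ?_⟩
  set F := {s ∈ Metric.closedBall c r |
      ∀ N : ℕ, M < N → ¬ AvoidsCube μ (curveLattice φ N s)} with hFdef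
  suffices hle : ∀ δ : ℝ, 0 < δ → volume F ≤ ENNReal.ofReal δ by
    refine le_antisymm (ENNReal.le_of_forall_pos_le_add fun δ hδ _ => ?_) bot_le
    simpa using hle δ hδ
  intro δ hδ
  obtain ⟨ε, hε, hε'⟩ := h1 r hr0 (min_le_left _ _) (δ / 2) (half_pos hδ)
  have h5 : ∀ R : ℕ, ∃ η > 0, 0 < R → ∀ t : ℝ, 0 < t → ∀ᶠ N : ℕ in Filter.atTop,
      volume {s ∈ Metric.closedBall c r | ¬ SpreadsPairs i0 R η (scaledFrame φ i0 t N s)} ≤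
        ENNReal.ofReal (δ / 4 * (1 / 2) ^ R) := by
    intro R
    rcases Nat.eq_zero_or_pos R with rfl | hR
    · exact ⟨1, one_pos, fun h => absurd h (lt_irrefl 0)⟩
    · obtain ⟨ε', hε1, hε2⟩ := h2 r hr0 ((min_le_right _ _).trans (min_le_left _ _))
        (δ / 4 * (1 / 2) ^ R) (by positivity)
      obtain ⟨η, hη, h⟩ := exists_eventually_volume_not_spreadsPairs_le (φ := φ) (i0 := i0) hε1
        hε2 (R := R) (by exact_mod_cast hR)
      exact ⟨η, hη, fun _ => h⟩
  choose η hη hη' using h5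
  set B1 : ℕ → ℕ → Set ℝ := fun t N => {s ∈ Metric.closedBall c r |
    ¬ ∀ m : Fin (k + 1) → ℤ, m ≠ 0 → ∃ i,
      ε ≤ |(scaledFrame φ i0 t N s).mulVec (fun l => (m l : ℝ)) i|} with hB1
  set B2 : ℕ → ℕ → ℕ → Set ℝ := fun t N R => {s ∈ Metric.closedBall c r |
    ¬ SpreadsPairs i0 R (η R) (scaledFrame φ i0 t N s)} with hB2
  set B : ℕ → ℕ → Set ℝ := fun t N => B1 t N ∪ ⋃ R ∈ Finset.Ioo 0 t, B2 t N R with hB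
  have hBle : ∀ t : ℕ, 0 < t → ∀ᶠ N in Filter.atTop, volume (B t N) ≤ ENNReal.ofReal δ := by
    intro t ht
    have ht' : (0 : ℝ) < t := by exact_mod_cast ht
    have h6 : ∀ᶠ N : ℕ in Filter.atTop, ∀ R ∈ Finset.Ioo 0 t, volume (B2 t N R) ≤
        ENNReal.ofReal (δ / 4 * (1 / 2) ^ R) :=
      (Filter.eventually_all_finset _).2 fun R hR => hη' R (Finset.mem_Ioo.1 hR).1 t ht'
    filter_upwards [eventually_volume_frame_le hε' ht', h6] with N hN1 hN2
    have h7 : ∑ R ∈ Finset.Ioo 0 t, δ / 4 * (1 / 2 : ℝ) ^ R ≤ δ / 2 := by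
      rw [← Finset.mul_sum]
      have h8 : ∑ R ∈ Finset.Ioo 0 t, (1 / 2 : ℝ) ^ R ≤ 2 :=
        (Finset.sum_le_sum_of_subset_of_nonneg
          (fun R hR => Finset.mem_range.2 (Finset.mem_Ioo.1 hR).2)
          (fun _ _ _ => by positivity)).trans (sum_geometric_two_le t)
      nlinarith
    calc volume (B t N) ≤ volume (B1 t N) + ∑ R ∈ Finset.Ioo 0 t, volume (B2 t N R) :=
          (measure_union_le _ _).trans (by gcongr; exact measure_biUnion_finset_le _ _)
      _ ≤ ENNReal.ofReal (δ / 2) + ∑ R ∈ Finset.Ioo 0 t, ENNReal.ofReal (δ / 4 * (1 / 2) ^ R) :=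
          add_le_add hN1 (Finset.sum_le_sum hN2)
      _ = ENNReal.ofReal (δ / 2 + ∑ R ∈ Finset.Ioo 0 t, δ / 4 * (1 / 2) ^ R) := by
          rw [← ENNReal.ofReal_sum_of_nonneg fun _ _ => by positivity,
            ENNReal.ofReal_add (by positivity) (Finset.sum_nonneg fun _ _ => by positivity)]
      _ ≤ ENNReal.ofReal δ := ENNReal.ofReal_le_ofReal (by linarith)
  have hL : volume {s | ∀ᶠ t in Filter.atTop, s ∈ {s | ∀ᶠ N in Filter.atTop, s ∈ B t N}} ≤
      ENNReal.ofReal δ := by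
    refine measure_eventually_mem_le ?_
    filter_upwards [Filter.eventually_gt_atTop 0] with t ht
    exact measure_eventually_mem_le (hBle t ht)
  refine le_trans (measure_mono_ae ?_) hL
  filter_upwards [ae_imp_of_ae_restrict (Besicovitch.ae_tendsto_measure_inter_div volume F)]
    with s hs hsF
  by_contra hcon
  have hsr := hball (Metric.closedBall_subset_closedBall
    ((min_le_right _ _).trans (min_le_right _ _)) hsF.1)
  refine false_of_density hk hsr.1 hsr.2 (hs hsF) hμ0 hμ1 (fun s' hs' => hs'.2) hε hη ?_
  have hcon' : ∃ᶠ t in Filter.atTop, ∃ᶠ N in Filter.atTop, s ∉ B t N := by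
    intro h
    refine hcon ?_
    change ∀ᶠ t in Filter.atTop, ∀ᶠ N in Filter.atTop, s ∈ B t N
    filter_upwards [h] with t ht
    simpa [Filter.Frequently] using ht
  refine hcon'.mono fun t ht => ht.mono fun N hN => ⟨?_, fun R hR => ?_⟩
  · by_contra hneg
    exact hN (Or.inl ⟨hsF.1, hneg⟩)
  · by_contra hneg
    exact hN (Or.inr (Set.mem_biUnion (Finset.mem_coe.2 (Finset.mem_Ioo.2 hR)) ⟨hsF.1, hneg⟩))

end Null

section Main

variable {k : ℕ}

/-- An affine functional that vanishes at points accumulating at some `c ∈ [a, b]` along an analytic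
curve is zero, unless the curve over `[a, b]` lies in a proper affine subspace. -/
theorem eventually_affine_ne_zero {a b : ℝ} {φ : ℝ → Fin k → ℝ}
    (hφ : AnalyticOnNhd ℝ φ (Set.Icc a b))
    (hflat : ¬ ∃ W : Submodule ℝ (Fin k → ℝ), W ≠ ⊤ ∧
      ∀ s ∈ Set.Icc a b, ∀ s' ∈ Set.Icc a b, φ s - φ s' ∈ W)
    {c : ℝ} (hc : c ∈ Set.Icc a b) {w : ℝ} {v : Fin k → ℝ} (hwv : w ≠ 0 ∨ v ≠ 0) :
    ∀ᶠ s in nhdsWithin c {c}ᶜ, w + v ⬝ᵥ φ s ≠ 0 := by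
  by_contra hcon
  have hf : AnalyticOnNhd ℝ (fun s => w + v ⬝ᵥ φ s) (Set.Icc a b) := fun s hs => by
    refine analyticAt_const.add (Finset.analyticAt_fun_sum _ fun i _ => analyticAt_const.mul ?_)
    exact analyticAt_pi_iff.1 (hφ s hs) i
  have hzero := hf.eqOn_zero_of_preconnected_of_frequently_eq_zero isPreconnected_Icc hc
    hcon
  by_cases hv : v = 0
  · subst hv
    have := hzero hc
    simp_all
  · refine hflat ⟨LinearMap.ker (dotProductBilin ℝ ℝ v), fun htop => hv ?_,
      fun s hs s' hs' => ?_⟩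
    · have := LinearMap.congr_fun (LinearMap.ker_eq_top.1 htop) v
      simpa using this
    · have h1 := hzero hs
      have h2 := hzero hs'
      simp only [Pi.zero_apply] at h1 h2
      simp only [LinearMap.mem_ker, map_sub, dotProductBilin_apply_apply]
      linarith

theorem eventually_deriv_ne_zero (hk : 0 < k) {a b : ℝ} {φ : ℝ → Fin k → ℝ}
    (hφ : AnalyticOnNhd ℝ φ (Set.Icc a b))
    (hflat : ¬ ∃ W : Submodule ℝ (Fin k → ℝ), W ≠ ⊤ ∧
      ∀ s ∈ Set.Icc a b, ∀ s' ∈ Set.Icc a b, φ s - φ s' ∈ W)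
    {c : ℝ} (hc : c ∈ Set.Icc a b) : ∀ᶠ s in nhdsWithin c {c}ᶜ, deriv φ s ≠ 0 := by
  by_contra hcon
  have hzero := hφ.deriv.eqOn_zero_of_preconnected_of_frequently_eq_zero isPreconnected_Icc hc
    hcon
  have hconst := constant_of_has_deriv_right_zero hφ.continuousOn fun x hx => by
    have hx' := Set.Ico_subset_Icc_self hx
    have h := (hφ x hx').differentiableAt.hasDerivAt
    rw [hzero hx'] at h
    exact h.hasDerivWithinAt
  have : Nonempty (Fin k) := ⟨⟨0, hk⟩⟩
  exact hflat ⟨⊥, bot_ne_top, fun s hs s' hs' => by simp [hconst s hs, hconst s' hs']⟩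

theorem volume_deriv_eq_zero (hk : 0 < k) {a b : ℝ} {φ : ℝ → Fin k → ℝ}
    (hφ : AnalyticOnNhd ℝ φ (Set.Icc a b))
    (hflat : ¬ ∃ W : Submodule ℝ (Fin k → ℝ), W ≠ ⊤ ∧
      ∀ s ∈ Set.Icc a b, ∀ s' ∈ Set.Icc a b, φ s - φ s' ∈ W) :
    volume {s ∈ Set.Icc a b | deriv φ s = 0} = 0 := by
  refine measure_null_of_locally_null _ fun c hc => ?_
  obtain ⟨u, hu, hsub⟩ := mem_nhdsWithin_iff_exists_mem_nhds_inter.1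
    (eventually_deriv_ne_zero hk hφ hflat hc.1)
  refine ⟨_, Filter.inter_mem self_mem_nhdsWithin (mem_nhdsWithin_of_mem_nhds hu),
    measure_mono_null (t := {c}) ?_ (measure_singleton c)⟩
  rintro s ⟨hs, hsu⟩
  by_contra hsc
  exact hsub ⟨hsu, hsc⟩ hs.2

theorem volume_not_avoidsCube_eq_zero (hk : 0 < k) {a b : ℝ} {φ : ℝ → Fin k → ℝ}
    (hφ : AnalyticOnNhd ℝ φ (Set.Icc a b))
    (hflat : ¬ ∃ W : Submodule ℝ (Fin k → ℝ), W ≠ ⊤ ∧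
      ∀ s ∈ Set.Icc a b, ∀ s' ∈ Set.Icc a b, φ s - φ s' ∈ W)
    {μ : ℝ} (hμ0 : 0 < μ) (hμ1 : μ < 1) (M : ℕ) :
    volume {s ∈ Set.Icc a b | deriv φ s ≠ 0 ∧
      ∀ N : ℕ, M < N → ¬ AvoidsCube μ (curveLattice φ N s)} = 0 := by
  refine measure_null_of_locally_null _ fun c hc => ?_
  obtain ⟨i0, hi0⟩ := Function.ne_iff.1 hc.2.1
  have hgen : ∀ v : Fin (k + 1) → ℝ, v ≠ 0 →
      ∀ᶠ s in nhdsWithin c {c}ᶜ, ∑ i, v i * curveFrame φ i0 s 0 i ≠ 0 := by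
    intro v hv
    have hwv : -v 0 ≠ 0 ∨ (fun i : Fin k => v i.succ) ≠ 0 := by
      by_contra! h
      refine hv (funext fun i => ?_)
      refine Fin.cases (by simpa using h.1) (fun j => congrFun h.2 j) i
    filter_upwards [eventually_affine_ne_zero hφ hflat hc.1 hwv] with s hs
    simpa [curveFrame, borderedMatrix, Fin.sum_univ_succ, dotProduct] using hs
  obtain ⟨r, hr, hnull⟩ := exists_radius_volume_eq_zero hk (hφ c hc.1) hi0 hgen hμ0 hμ1
  exact ⟨_, Filter.inter_mem self_mem_nhdsWithin
    (mem_nhdsWithin_of_mem_nhds (Metric.closedBall_mem_nhds c hr)),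
    measure_mono_null (fun _ hs => Set.mem_sep hs.2 hs.1.2.2) (hnull M)⟩

end Main

/-- Theorem 1.1(A) of the paper: if `φ : [a,b] → ℝ^k` is an analytic curve whose
image is not contained in a proper affine subspace of `ℝ^k`, then for every
`0 < μ < 1` and Lebesgue-almost every `s ∈ [a,b]` there are infinitely many positive
integers `N` for which there is no `(q₁, …, q_k, p) ∈ ℤ^k × ℤ` with
`0 < max_i |q_i| ≤ μN` and `|q₁φ₁(s) + ⋯ + q_kφ_k(s) − p| ≤ μ N^{-k}`;
that is, Dirichlet's theorem (A) cannot be `μ`-improved for `φ(s)`. -/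
theorem dirichlet_cannot_be_improved_along_analytic_curve
    (k : ℕ) (hk : 0 < k) (a b : ℝ) (φ : ℝ → Fin k → ℝ)
    (hφ : AnalyticOnNhd ℝ φ (Set.Icc a b))
    (hflat : ¬ ∃ W : Submodule ℝ (Fin k → ℝ), W ≠ ⊤ ∧
      ∀ s ∈ Set.Icc a b, ∀ s' ∈ Set.Icc a b, φ s - φ s' ∈ W)
    (μ : ℝ) (hμ0 : 0 < μ) (hμ1 : μ < 1) :
    ∀ᵐ s ∂(volume.restrict (Set.Icc a b)),
      {N : ℕ | 0 < N ∧
        ¬ ∃ (q : Fin k → ℤ) (p : ℤ), (∃ i, q i ≠ 0) ∧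
          (∀ i, |(q i : ℝ)| ≤ μ * N) ∧
          |∑ i, (q i : ℝ) * φ s i - (p : ℝ)| ≤ μ / (N : ℝ) ^ k}.Infinite := by
  have hzero := volume_deriv_eq_zero hk hφ hflat
  have hbad := measure_iUnion_null (volume_not_avoidsCube_eq_zero hk hφ hflat hμ0 hμ1)
  rw [ae_restrict_iff' measurableSet_Icc]
  filter_upwards [measure_eq_zero_iff_ae_notMem.1 hzero, measure_eq_zero_iff_ae_notMem.1 hbad]
    with s hs0 hsb hs
  refine Set.infinite_of_forall_exists_gt fun M => ?_
  by_contra h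
  refine hsb (Set.mem_iUnion.2 ⟨M, hs, fun h0 => hs0 ⟨hs, h0⟩, fun N hN hav => ?_⟩)
  have hN0 : 0 < N := by omega
  exact h ⟨N, ⟨hN0, not_exists_of_avoidsCube hN0 hav⟩, hN⟩
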